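/- A trace-closed ω-language L ⊆ Σ^ω is ω-regular if and only if there exist finitely many trace-closed ω-languages L_1, …, L_n ⊆ Σ^ω, each recognized by an I-diamond deterministic Büchi automaton, such that L is a finite Boolean combination (built with finite unions, finite intersections, and complements) of L_1, …, L_n. -/

import Mathlib

open Relation

variable {A : Type*} {σ : Type*} {S : Type*}

/-- The length-`n` prefix of an ω-word. -/
def wpre (α : ℕ → A) (n : ℕ) : List A := (List.range n).map α

/-- One swap of two adjacent independent letters. -/
def SwapStep (I : A → A → Prop) (u v : List A) : Prop :=
  ∃ (x y : List A) (a b : A), I a b ∧ u = x ++ a :: b :: y ∧ v = x ++ b :: a :: y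

/-- Trace equivalence `∼_I` on finite words: the equivalence closure of adjacent swaps. -/
def TrEq (I : A → A → Prop) : List A → List A → Prop := EqvGen (SwapStep I)

/-- Trace-prefix relation `u ⊑_I v`. -/
def TrPre (I : A → A → Prop) (u v : List A) : Prop := ∃ w, TrEq I (u ++ w) v

/-- Trace equivalence `≈_I` of ω-words. -/
def OmEq (I : A → A → Prop) (α β : ℕ → A) : Prop :=
  (∀ n, ∃ m, TrPre I (wpre α n) (wpre β m)) ∧ (∀ n, ∃ m, TrPre I (wpre β n) (wpre α m))

/-- A language of finite words is trace-closed. -/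
def TraceClosed (I : A → A → Prop) (K : Set (List A)) : Prop :=
  ∀ u v, u ∈ K → TrEq I u v → v ∈ K

/-- An ω-language is trace-closed. -/
def OmTraceClosed (I : A → A → Prop) (L : Set (ℕ → A)) : Prop :=
  ∀ α β, α ∈ L → OmEq I α β → β ∈ L

/-- `ext(K)`: ω-words with some finite prefix in `K`. -/
def extL (K : Set (List A)) : Set (ℕ → A) := {α | ∃ n, wpre α n ∈ K}

/-- `lim(K)`: ω-words with infinitely many finite prefixes in `K`. -/
def limL (K : Set (List A)) : Set (ℕ → A) := {α | ∀ N, ∃ n ≥ N, wpre α n ∈ K}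

/-- `[L]_{≈_I}`: the ω-trace closure of an ω-language. -/
def omCl (I : A → A → Prop) (L : Set (ℕ → A)) : Set (ℕ → A) := {α | ∃ β ∈ L, OmEq I α β}

/-- The `I`-suffix extension `K_I`. -/
def suffExt (I : A → A → Prop) (K : Set (List A)) : Set (List A) :=
  K ∪ {w | ∃ (a : A) (u x : List A),
    u ++ [a] ∈ K ∧ (∀ b ∈ x, I a b) ∧ TrEq I w (u ++ [a] ++ x)}

/-- A language is regular iff it is recognized by a DFA with finitely many states. -/
def RegularLang (K : Set (List A)) : Prop :=
  ∃ (σ : Type) (_ : Fintype σ) (M : DFA A σ), ∀ w, w ∈ M.accepts ↔ w ∈ K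

/-- A DFA is `I`-diamond. -/
def IDiamond (I : A → A → Prop) (M : DFA A σ) : Prop :=
  ∀ q a b, I a b → M.step (M.step q a) b = M.step (M.step q b) a

/-- The ω-language of a DFA viewed as a deterministic Büchi automaton. -/
def BuchiLang (M : DFA A σ) : Set (ℕ → A) :=
  {α | ∀ N, ∃ n ≥ N, M.evalFrom M.start (wpre α n) ∈ M.accept}

/-- The weakness condition: mutually reachable states agree on acceptance. -/
def IsWeak (M : DFA A σ) : Prop :=
  ∀ q q', (∃ u, M.evalFrom q u = q') → (∃ v, M.evalFrom q' v = q) →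
    (q ∈ M.accept ↔ q' ∈ M.accept)

/-- States visited infinitely often by the run of a DFA on an ω-word. -/
def InfStates (M : DFA A σ) (α : ℕ → A) : Set σ :=
  {q | ∀ N, ∃ n ≥ N, M.evalFrom M.start (wpre α n) = q}

/-- The ω-language of a DFA equipped with a Muller acceptance family. -/
def MullerLang (M : DFA A σ) (F : Set (Set σ)) : Set (ℕ → A) := {α | InfStates M α ∈ F}

/-- An ω-language is ω-regular iff it is recognized by a deterministic Muller automaton. -/
def OmegaRegular (L : Set (ℕ → A)) : Prop :=
  ∃ (σ : Type) (_ : Fintype σ) (M : DFA A σ) (F : Set (Set σ)), MullerLang M F = L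

/-- Finite Boolean combinations of a family of sets. -/
inductive BoolComb {X : Type*} (G : Set (Set X)) : Set X → Prop
  | base {L} : L ∈ G → BoolComb G L
  | compl {L} : BoolComb G L → BoolComb G Lᶜ
  | union {L₁ L₂} : BoolComb G L₁ → BoolComb G L₂ → BoolComb G (L₁ ∪ L₂)
  | inter {L₁ L₂} : BoolComb G L₁ → BoolComb G L₂ → BoolComb G (L₁ ∩ L₂)

/-- `φ : Σ* → S` is a monoid homomorphism (words under concatenation). -/
def IsHom [Monoid S] (φ : List A → S) : Prop :=
  φ [] = 1 ∧ ∀ u v, φ (u ++ v) = φ u * φ v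

/-- Linked pair of a monoid. -/
def LinkedPair [Monoid S] (s e : S) : Prop := s * e = s ∧ e * e = e

/-- The factor `α[i, j)` of an ω-word. -/
def seg (α : ℕ → A) (i j : ℕ) : List A := (List.range (j - i)).map (fun k => α (i + k))

/-- `φ⁻¹(s)·(φ⁻¹(e))^ω`: ω-words admitting a factorization `u·v₁·v₂⋯` with
`φ(u) = s` and `φ(vᵢ) = e`. -/
def LPWords (φ : List A → S) (s e : S) : Set (ℕ → A) :=
  {α | ∃ n : ℕ → ℕ, StrictMono n ∧ φ (wpre α (n 0)) = s ∧
    ∀ i, φ (seg α (n i) (n (i + 1))) = e}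

/-- `φ` saturates an ω-language `L`. -/
def Saturates [Monoid S] (φ : List A → S) (L : Set (ℕ → A)) : Prop :=
  ∀ s e : S, LinkedPair s e → LPWords φ s e ∩ L = ∅ ∨ LPWords φ s e ⊆ L

/-- The `P`-cut property of a linked pair `(s, e)` with respect to `φ`. -/
def PCut [Monoid S] (φ : List A → S) (P : Set S) (s e : S) : Prop :=
  (∀ w : List A, w ≠ [] → φ w = e →
      ∃ j, 1 ≤ j ∧ j ≤ w.length ∧ s * e * φ (w.take j) ∈ P) ∨
  (∀ w : List A, w ≠ [] → φ w = e →
      ∀ j, 1 ≤ j → j ≤ w.length → s * e * φ (w.take j) ∉ P)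

/-- The run from `q` on `u` visits an accepting state (endpoints included). -/
def VisitsAcc (M : DFA A σ) (q : σ) (u : List A) : Prop :=
  ∃ p, p <+: u ∧ M.evalFrom q p ∈ M.accept

/-- `q ⇒_u q'`: the run from `q` on `u` ends in `q'` and visits an accepting state. -/
def FICycleClosed (I : A → A → Prop) (M : DFA A σ) : Prop :=
  ∀ u v q, TrEq I u v →
    ((M.evalFrom q u = q ∧ VisitsAcc M q u) ↔ (M.evalFrom q v = q ∧ VisitsAcc M q v))





/-! ## Part 1: basic trace lemmas -/

theorem wpre_succ (α : ℕ → A) (n : ℕ) : wpre α (n+1) = wpre α n ++ [α n] := by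
  simp [wpre, List.range_succ]

theorem wpre_zero (α : ℕ → A) : wpre α 0 = [] := by simp [wpre]

theorem wpre_length (α : ℕ → A) (n : ℕ) : (wpre α n).length = n := by simp [wpre]

theorem wpre_prefix (α : ℕ → A) {m n : ℕ} (h : m ≤ n) : wpre α m <+: wpre α n := by
  induction n, h using Nat.le_induction with
  | base => exact List.prefix_refl _
  | succ n _ ih => rw [wpre_succ]; exact ih.trans (List.prefix_append _ _)

theorem TrEq.rfl' {I : A → A → Prop} {u : List A} : TrEq I u u := EqvGen.refl _
theorem TrEq.sym {I : A → A → Prop} {u v : List A} (h : TrEq I u v) : TrEq I v u :=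
  EqvGen.symm _ _ h
theorem TrEq.tr {I : A → A → Prop} {u v w : List A} (h : TrEq I u v) (h' : TrEq I v w) :
    TrEq I u w := EqvGen.trans _ _ _ h h'
theorem TrEq.of_eq {I : A → A → Prop} {u v : List A} (h : u = v) : TrEq I u v := h ▸ TrEq.rfl'

theorem TrEq.ctx {I : A → A → Prop} {u v : List A} (h : TrEq I u v) (x y : List A) :
    TrEq I (x ++ u ++ y) (x ++ v ++ y) := by
  induction h with
  | rel u v h =>
    obtain ⟨p, q, a, b, hab, rfl, rfl⟩ := h
    exact EqvGen.rel _ _ ⟨x ++ p, q ++ y, a, b, hab, by simp, by simp⟩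
  | refl u => exact TrEq.rfl'
  | symm u v _ ih => exact ih.sym
  | trans u v w _ _ ih1 ih2 => exact ih1.tr ih2

theorem TrEq.app {I : A → A → Prop} {u v u' v' : List A} (h : TrEq I u v) (h' : TrEq I u' v') :
    TrEq I (u ++ u') (v ++ v') := by
  have h1 := h.ctx [] u'
  have h2 := h'.ctx v []
  simp only [List.nil_append, List.append_nil] at h1 h2
  exact h1.tr h2

theorem TrEq.comm1 {I : A → A → Prop} {a : A} {u : List A} (h : ∀ b ∈ u, I b a) :
    TrEq I (u ++ [a]) ([a] ++ u) := by
  induction u with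
  | nil => exact TrEq.rfl'
  | cons b u ih =>
    have h1 : TrEq I ([b] ++ (u ++ [a])) ([b] ++ ([a] ++ u)) :=
      TrEq.rfl'.app (ih (fun c hc => h c (by simp [hc])))
    have h2 : TrEq I ([b, a] ++ u) ([a, b] ++ u) :=
      TrEq.app (EqvGen.rel _ _ ⟨[], [], b, a, h b (by simp), rfl, rfl⟩) TrEq.rfl'
    exact TrEq.tr (by simpa using h1) (by simpa using h2)

theorem TrEq.comm {I : A → A → Prop} {u v : List A} (h : ∀ b ∈ u, ∀ a ∈ v, I b a) :
    TrEq I (u ++ v) (v ++ u) := by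
  induction v with
  | nil => simpa using TrEq.rfl'
  | cons a v ih =>
    have h1 : TrEq I ((u ++ [a]) ++ v) (([a] ++ u) ++ v) :=
      (TrEq.comm1 (fun b hb => h b hb a (by simp))).app TrEq.rfl'
    have h2 : TrEq I ([a] ++ (u ++ v)) ([a] ++ (v ++ u)) :=
      TrEq.rfl'.app (ih (fun b hb c hc => h b hb c (by simp [hc])))
    exact TrEq.tr (by simpa using h1) (by simpa using h2)

theorem TrEq.perm {I : A → A → Prop} {u v : List A} (h : TrEq I u v) : u.Perm v := by
  induction h with
  | rel u v h =>
    obtain ⟨p, q, a, b, hab, rfl, rfl⟩ := h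
    exact (List.Perm.swap b a q).append_left p
  | refl u => exact List.Perm.refl _
  | symm u v _ ih => exact ih.symm
  | trans u v w _ _ ih1 ih2 => exact ih1.trans ih2

theorem TrPre.rfl' {I : A → A → Prop} {u : List A} : TrPre I u u := ⟨[], by simpa using TrEq.rfl'⟩
theorem TrPre.tr {I : A → A → Prop} {u v w : List A} (h : TrPre I u v) (h' : TrPre I v w) :
    TrPre I u w := by
  obtain ⟨x, hx⟩ := h
  obtain ⟨y, hy⟩ := h'
  refine ⟨x ++ y, ?_⟩
  rw [← List.append_assoc]
  exact (hx.app TrEq.rfl').tr hy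
theorem TrEq.pre {I : A → A → Prop} {u v : List A} (h : TrEq I u v) : TrPre I u v :=
  ⟨[], by simpa using h⟩
theorem TrPre.of_prefix {I : A → A → Prop} {u v : List A} (h : u <+: v) : TrPre I u v := by
  obtain ⟨w, rfl⟩ := h
  exact ⟨w, TrEq.rfl'⟩
theorem TrPre.app_left {I : A → A → Prop} {u v : List A} (x : List A) (h : TrPre I u v) :
    TrPre I (x ++ u) (x ++ v) := by
  obtain ⟨w, hw⟩ := h
  exact ⟨w, by rw [List.append_assoc]; exact TrEq.rfl'.app hw⟩

theorem TrPre.length {I : A → A → Prop} {u v : List A} (h : TrPre I u v) :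
    u.length ≤ v.length := by
  obtain ⟨w, hw⟩ := h
  have := hw.perm.length_eq
  simp at this; omega

theorem evalFrom_app (M : DFA A σ) (q : σ) (x y : List A) :
    M.evalFrom q (x ++ y) = M.evalFrom (M.evalFrom q x) y := by
  simp [DFA.evalFrom, List.foldl_append]

theorem eval_wpre_succ (M : DFA A σ) (q : σ) (α : ℕ → A) (n : ℕ) :
    M.evalFrom q (wpre α (n+1)) = M.step (M.evalFrom q (wpre α n)) (α n) := by
  rw [wpre_succ, evalFrom_app]; rfl

/-! ## Part 2: Boolean combinations of Büchi are Muller -/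

theorem frequently_fin {X : Type*} [Finite X] (f : ℕ → X) (P : X → Prop)
    (h : ∀ N, ∃ n ≥ N, P (f n)) : ∃ x, P x ∧ ∀ N, ∃ n ≥ N, f n = x := by
  by_contra hc
  push Not at hc
  have : ∀ x, ∃ N, P x → ∀ n ≥ N, f n ≠ x := fun x => by
    by_cases hx : P x
    · obtain ⟨N, hN⟩ := hc x hx; exact ⟨N, fun _ => hN⟩
    · exact ⟨0, fun h => absurd h hx⟩
  choose g hg using this
  obtain ⟨N, hN⟩ := (Set.finite_range g).bddAbove
  obtain ⟨n, hn, hP⟩ := h N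
  exact hg (f n) hP n ((hN ⟨f n, rfl⟩).trans hn) rfl

theorem buchi_omegaRegular {σ : Type} [Fintype σ] (M : DFA A σ) : OmegaRegular (BuchiLang M) := by
  refine ⟨σ, inferInstance, M, {X | ∃ q ∈ X, q ∈ M.accept}, ?_⟩
  ext α
  constructor
  · rintro ⟨q, hq, hacc⟩ N
    obtain ⟨n, hn, h⟩ := hq N
    exact ⟨n, hn, h ▸ hacc⟩
  · intro h
    obtain ⟨x, hx, hx'⟩ := frequently_fin (fun n => M.evalFrom M.start (wpre α n)) (· ∈ M.accept) h
    exact ⟨x, hx', hx⟩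

theorem compl_omegaRegular {L : Set (ℕ → A)} (h : OmegaRegular L) : OmegaRegular Lᶜ := by
  obtain ⟨σ, _, M, F, rfl⟩ := h
  exact ⟨σ, inferInstance, M, Fᶜ, rfl⟩

theorem union_omegaRegular {L L' : Set (ℕ → A)} (h : OmegaRegular L) (h' : OmegaRegular L') :
    OmegaRegular (L ∪ L') := by
  obtain ⟨σ, _, M, F, rfl⟩ := h
  obtain ⟨σ', _, M', F', rfl⟩ := h'
  let P : DFA A (σ × σ') := ⟨fun q a => (M.step q.1 a, M'.step q.2 a), (M.start, M'.start), ∅⟩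
  have hP : ∀ w, P.evalFrom P.start w = (M.evalFrom M.start w, M'.evalFrom M'.start w) := by
    intro w
    induction w using List.reverseRecOn with
    | nil => rfl
    | append_singleton w a ih => simp only [evalFrom_app, ih]; rfl
  have e1 : ∀ α, Prod.fst '' InfStates P α = InfStates M α := by
    intro α; ext q; constructor
    · rintro ⟨p, hp, rfl⟩ N
      obtain ⟨n, hn, h⟩ := hp N
      exact ⟨n, hn, by rw [← h, hP]⟩
    · intro h
      obtain ⟨x, hx, hx'⟩ := frequently_fin (fun n => P.evalFrom P.start (wpre α n)) (·.1 = q)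
        (fun N => by obtain ⟨n, hn, h⟩ := h N; exact ⟨n, hn, by rw [hP]; exact h⟩)
      exact ⟨x, hx', hx⟩
  have e2 : ∀ α, Prod.snd '' InfStates P α = InfStates M' α := by
    intro α; ext q; constructor
    · rintro ⟨p, hp, rfl⟩ N
      obtain ⟨n, hn, h⟩ := hp N
      exact ⟨n, hn, by rw [← h, hP]⟩
    · intro h
      obtain ⟨x, hx, hx'⟩ := frequently_fin (fun n => P.evalFrom P.start (wpre α n)) (·.2 = q)
        (fun N => by obtain ⟨n, hn, h⟩ := h N; exact ⟨n, hn, by rw [hP]; exact h⟩)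
      exact ⟨x, hx', hx⟩
  refine ⟨σ × σ', inferInstance, P, {X | Prod.fst '' X ∈ F ∨ Prod.snd '' X ∈ F'}, ?_⟩
  ext α
  simp only [MullerLang, Set.mem_ofPred_eq, e1, e2, Set.mem_union]

theorem boolComb_omegaRegular {G : Set (Set (ℕ → A))} (hG : ∀ L ∈ G, OmegaRegular L)
    {L : Set (ℕ → A)} (h : BoolComb G L) : OmegaRegular L := by
  induction h with
  | base h => exact hG _ h
  | compl _ ih => exact compl_omegaRegular ih
  | union _ _ ih1 ih2 => exact union_omegaRegular ih1 ih2
  | @inter L₁ L₂ _ _ ih1 ih2 =>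
    have : L₁ ∩ L₂ = (L₁ᶜ ∪ L₂ᶜ)ᶜ := by simp [Set.compl_union]
    rw [this]
    exact compl_omegaRegular (union_omegaRegular (compl_omegaRegular ih1) (compl_omegaRegular ih2))

/-! ## Part 3: Boolean combinations from saturation, robust languages -/

theorem boolComb_finset_inter {X ι : Type*} {G : Set (Set X)} (hu : BoolComb G Set.univ)
    (s : Finset ι) (f : ι → Set X) (hf : ∀ i ∈ s, BoolComb G (f i)) :
    BoolComb G {x | ∀ i ∈ s, x ∈ f i} := by
  classical
  induction s using Finset.induction_on with
  | empty => simpa [Set.ofPred_true] using hu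
  | insert i s _ ih =>
    have h := (hf i (by simp)).inter (ih (fun j hj => hf j (by simp [hj])))
    convert h using 1
    ext x; simp

theorem boolComb_finset_union {X ι : Type*} {G : Set (Set X)} (hu : BoolComb G ∅)
    (s : Finset ι) (f : ι → Set X) (hf : ∀ i ∈ s, BoolComb G (f i)) :
    BoolComb G {x | ∃ i ∈ s, x ∈ f i} := by
  classical
  induction s using Finset.induction_on with
  | empty => simpa using hu
  | insert i s _ ih =>
    have h := (hf i (by simp)).union (ih (fun j hj => hf j (by simp [hj])))
    convert h using 1
    ext x; simp

theorem boolComb_of_sat {X : Type*} {n : ℕ} (hn : 0 < n) (Ls : Fin n → Set X) (L : Set X)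
    (h : ∀ x y, (∀ i, x ∈ Ls i ↔ y ∈ Ls i) → x ∈ L → y ∈ L) : BoolComb (Set.range Ls) L := by
  classical
  have b0 : BoolComb (Set.range Ls) (Ls ⟨0, hn⟩) := .base ⟨_, rfl⟩
  have hu : BoolComb (Set.range Ls) Set.univ := by simpa using b0.union b0.compl
  have he : BoolComb (Set.range Ls) ∅ := by simpa using hu.compl
  let T : Finset (Finset (Fin n)) := Finset.univ.filter
    (fun t => ∃ x ∈ L, ∀ i, i ∈ t ↔ x ∈ Ls i)
  have := boolComb_finset_union he T
    (fun t => {x | ∀ i ∈ (Finset.univ : Finset (Fin n)),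
      x ∈ (if i ∈ t then Ls i else (Ls i)ᶜ)})
    (fun t _ => boolComb_finset_inter hu _ _ (fun i _ => by
      split_ifs
      · exact .base ⟨_, rfl⟩
      · exact BoolComb.compl (.base ⟨_, rfl⟩)))
  convert this using 1
  ext y
  constructor
  · intro hy
    refine ⟨Finset.univ.filter (fun i => y ∈ Ls i), ?_, ?_⟩
    · simp only [T, Finset.mem_filter, Finset.mem_univ, true_and]
      exact ⟨y, hy, fun i => Iff.rfl⟩
    · intro i _
      by_cases hi : y ∈ Ls i <;> simp [hi]
  · rintro ⟨t, ht, hy⟩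
    simp only [T, Finset.mem_filter, Finset.mem_univ, true_and] at ht
    obtain ⟨x, hx, hxt⟩ := ht
    refine h x y (fun i => ?_) hx
    rw [← hxt]
    have := hy i (Finset.mem_univ _)
    by_cases hi : i ∈ t
    · simp only [hi, if_true] at this; simp [hi, this]
    · simp only [hi, if_false] at this
      simpa [hi] using this

open Classical in
/-- value of `f` after reading `w` from `q` up to `k` letters `a`. -/
noncomputable def VV {X : Type*} (M : DFA A σ) (f : σ → X) (a : A) : σ → ℕ → List A → X
  | q, _, [] => f q
  | q, 0, (c :: w) => if c = a then f q else VV M f a (M.step q c) 0 w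
  | q, k+1, (c :: w) => if c = a then VV M f a (M.step q c) k w else VV M f a (M.step q c) (k+1) w

theorem VV_zero {X : Type*} (M : DFA A σ) (f : σ → X) (a : A)
    (hf : ∀ q c, c ≠ a → f (M.step q c) = f q) (q : σ) (w : List A) : VV M f a q 0 w = f q := by
  induction w generalizing q with
  | nil => rfl
  | cons c w ih =>
    rw [VV]; split_ifs with h
    · rfl
    · rw [ih, hf _ _ h]

open Classical in
theorem VV_app {X : Type*} (M : DFA A σ) (f : σ → X) (a : A)
    (hf : ∀ q c, c ≠ a → f (M.step q c) = f q) (q : σ) (w z : List A) :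
    VV M f a q (w.count a) (w ++ z) = f (M.evalFrom q w) := by
  induction w generalizing q with
  | nil => simpa using VV_zero M f a hf q z
  | cons c w ih =>
    by_cases h : c = a
    · subst h
      simp only [List.count_cons_self, List.cons_append, VV, if_true]
      exact ih _
    · rw [List.count_cons_of_ne h, List.cons_append]
      have : VV M f a q (w.count a) (c :: (w ++ z)) = VV M f a (M.step q c) (w.count a) (w ++ z) := by
        cases w.count a <;> simp [VV, h]
      rw [this, ih]; rfl

theorem VV_swap {X : Type*} (I : A → A → Prop) (hirr : ∀ a, ¬ I a a) (M : DFA A σ)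
    (hM : IDiamond I M) (f : σ → X) (a : A)
    (hf : ∀ q c, c ≠ a → f (M.step q c) = f q) {u v : List A} (h : TrEq I u v) :
    ∀ q k, VV M f a q k u = VV M f a q k v := by
  induction h with
  | refl u => intros; rfl
  | symm u v _ ih => intros; exact (ih _ _).symm
  | trans u v w _ _ ih1 ih2 => intros; exact (ih1 _ _).trans (ih2 _ _)
  | rel u v h =>
    obtain ⟨x, y, p, r, hpr, rfl, rfl⟩ := h
    induction x with
    | cons c x ih =>
      intro q k
      cases k <;> simp only [List.cons_append, VV] <;> split_ifs <;> first | rfl | exact ih _ _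
    | nil =>
      intro q k
      have hd := hM q p r hpr
      have hne : p = a → r ≠ a := fun h1 h2 => hirr a (by rw [h1, h2] at hpr; exact hpr)
      by_cases h1 : p = a
      · have h2 := hne h1
        rw [h1] at hd
        cases k with
        | zero => simp [VV_zero M f a hf]
        | succ k => simp only [List.nil_append]; cases k <;> simp [VV, h1, h2, hd, VV_zero M f a hf]
      · by_cases h2 : r = a
        · rw [h2] at hd
          cases k with
          | zero => simp [VV_zero M f a hf]
          | succ k => simp only [List.nil_append]; cases k <;> simp [VV, h1, h2, hd, VV_zero M f a hf]
        · cases k <;> simp [VV, h1, h2, hd]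

/-- ω-words for which the observable `f` takes value `x` infinitely often. -/
def ObsInf {X : Type*} (M : DFA A σ) (f : σ → X) (x : X) : Set (ℕ → A) :=
  {α | ∀ N, ∃ n ≥ N, f (M.evalFrom M.start (wpre α n)) = x}

open Classical in
theorem robust_closed {X : Type*} (I : A → A → Prop) (hirr : ∀ a, ¬ I a a) (M : DFA A σ)
    (hM : IDiamond I M) (f : σ → X) (a : A)
    (hf : ∀ q c, c ≠ a → f (M.step q c) = f q) (x : X) : OmTraceClosed I (ObsInf M f x) := by
  intro α β hα hab N
  set K := (wpre β N).count a with hK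
  have key : ∀ i m, TrPre I (wpre α i) (wpre β m) → ∀ n ≤ m,
      (wpre β n).count a = (wpre α i).count a →
      f (M.evalFrom M.start (wpre β n)) = f (M.evalFrom M.start (wpre α i)) := by
    rintro i m ⟨z, hz⟩ n hn hc
    obtain ⟨z', hz'⟩ := wpre_prefix β hn
    rw [← VV_app M f a hf _ (wpre β n) z', hz', ← VV_swap I hirr M hM f a hf hz, hc,
      VV_app M f a hf]
  by_cases hex : ∃ i, f (M.evalFrom M.start (wpre α i)) = x ∧ K < (wpre α i).count a
  · obtain ⟨i, hi, hc⟩ := hex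
    obtain ⟨m, hm⟩ := hab.1 i
    have hcm : (wpre α i).count a ≤ (wpre β m).count a := by
      obtain ⟨z, hz⟩ := hm
      rw [← hz.perm.count_eq, List.count_append]; omega
    have hexn : ∃ n, (wpre α i).count a ≤ (wpre β n).count a := ⟨m, hcm⟩
    let n := Nat.find hexn
    have hn1 : (wpre α i).count a ≤ (wpre β n).count a := Nat.find_spec hexn
    have hnm : n ≤ m := Nat.find_min' hexn hcm
    have hn2 : (wpre β n).count a = (wpre α i).count a := by
      rcases Nat.eq_zero_or_pos n with h0 | h0
      · rw [h0, wpre_zero] at hn1; simp at hn1; omega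
      · have := Nat.find_min hexn (Nat.sub_lt h0 Nat.one_pos)
        have e : n = n - 1 + 1 := by omega
        rw [e, wpre_succ, List.count_append] at hn1 ⊢
        have : List.count a [β (n-1)] ≤ 1 := by
          simpa using List.count_le_length (a := a) (l := [β (n-1)])
        change ¬ ((wpre α i).count a ≤ (wpre β (n-1)).count a) at *
        omega
    refine ⟨n, ?_, ?_⟩
    · by_contra hlt
      have := (wpre_prefix β (Nat.le_of_lt (not_le.mp hlt))).sublist.count_le a
      omega
    · rw [key i m hm n hnm hn2, hi]
  · push Not at hex
    obtain ⟨i0, hi0⟩ := hab.2 N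
    obtain ⟨i, hi, hx⟩ := hα i0
    have h1 := hex i hx
    have h2 : K ≤ (wpre α i).count a := by
      obtain ⟨z, hz⟩ := hi0.tr (TrPre.of_prefix (wpre_prefix α hi))
      rw [← hz.perm.count_eq, List.count_append]; omega
    obtain ⟨m, hm⟩ := hab.1 i
    refine ⟨N, le_refl _, ?_⟩
    rw [key i (max m N) (hm.tr (TrPre.of_prefix (wpre_prefix β (le_max_left _ _)))) N
      (le_max_right _ _) (by omega), hx]





/-! ## Part 4: chains and the Arnold congruence -/

def cc (f : ℕ → List A) : ℕ → List A
  | 0 => []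
  | n+1 => cc f n ++ f n

theorem cc_prefix (f : ℕ → List A) {m n : ℕ} (h : m ≤ n) : cc f m <+: cc f n := by
  induction n, h using Nat.le_induction with
  | base => exact List.prefix_refl _
  | succ n _ ih => exact ih.trans (List.prefix_append _ _)

theorem cc_add (f : ℕ → List A) (m n : ℕ) : cc f (m + n) = cc f m ++ cc (fun k => f (m + k)) n := by
  induction n with
  | zero => simp [cc]
  | succ n ih => rw [← add_assoc, cc, ih, cc, List.append_assoc]

def TLim (I : A → A → Prop) (c : ℕ → List A) (α : ℕ → A) : Prop :=
  (∀ n, ∃ m, TrPre I (c n) (wpre α m)) ∧ (∀ m, ∃ n, TrPre I (wpre α m) (c n))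

def InL (I : A → A → Prop) (L : Set (ℕ → A)) (f : ℕ → List A) : Prop :=
  ∃ α ∈ L, TLim I (cc f) α

/-- infinitely many nonempty entries -/
def InfNE (f : ℕ → List A) : Prop := ∀ N, ∃ n ≥ N, f n ≠ []

theorem inL_iff {I : A → A → Prop} {L : Set (ℕ → A)} (hL : OmTraceClosed I L)
    {f : ℕ → List A} {α : ℕ → A} (h : TLim I (cc f) α) : InL I L f ↔ α ∈ L := by
  constructor
  · rintro ⟨β, hβ, h1, h2⟩
    refine hL β α hβ ⟨fun n => ?_, fun n => ?_⟩
    · obtain ⟨m, hm⟩ := h2 n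
      obtain ⟨k, hk⟩ := h.1 m
      exact ⟨k, hm.tr hk⟩
    · obtain ⟨m, hm⟩ := h.2 n
      obtain ⟨k, hk⟩ := h1 m
      exact ⟨k, hm.tr hk⟩
  · intro hα; exact ⟨α, hα, h⟩

theorem inL_cof {I : A → A → Prop} {L : Set (ℕ → A)} {f g : ℕ → List A}
    (h1 : ∀ n, ∃ m, TrPre I (cc f n) (cc g m)) (h2 : ∀ n, ∃ m, TrPre I (cc g n) (cc f m)) :
    InL I L f ↔ InL I L g := by
  have key : ∀ {f g : ℕ → List A}, (∀ n, ∃ m, TrPre I (cc f n) (cc g m)) →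
      (∀ n, ∃ m, TrPre I (cc g n) (cc f m)) → InL I L f → InL I L g := by
    rintro f g h1 h2 ⟨α, hα, h3, h4⟩
    refine ⟨α, hα, fun n => ?_, fun n => ?_⟩
    · obtain ⟨m, hm⟩ := h2 n
      obtain ⟨k, hk⟩ := h3 m
      exact ⟨k, hm.tr hk⟩
    · obtain ⟨m, hm⟩ := h4 n
      obtain ⟨k, hk⟩ := h1 m
      exact ⟨k, hm.tr hk⟩
  exact ⟨key h1 h2, key h2 h1⟩

theorem cc_treq {I : A → A → Prop} {f g : ℕ → List A} (h : ∀ n, TrEq I (f n) (g n)) (n : ℕ) :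
    TrEq I (cc f n) (cc g n) := by
  induction n with
  | zero => exact TrEq.rfl'
  | succ n ih => exact ih.app (h n)

theorem inL_treq {I : A → A → Prop} {L : Set (ℕ → A)} {f g : ℕ → List A}
    (h : ∀ n, TrEq I (f n) (g n)) : InL I L f ↔ InL I L g :=
  inL_cof (fun n => ⟨n, (cc_treq h n).pre⟩) (fun n => ⟨n, (cc_treq h n).sym.pre⟩)

theorem InfNE.len {f : ℕ → List A} (h : InfNE f) (k : ℕ) : ∃ n, k ≤ (cc f n).length := by
  induction k with
  | zero => exact ⟨0, Nat.zero_le _⟩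
  | succ k ih =>
    obtain ⟨n, hn⟩ := ih
    obtain ⟨m, hm, hne⟩ := h n
    refine ⟨m+1, ?_⟩
    have h1 := (cc_prefix f hm).length_le
    have h2 := List.length_pos_iff.mpr hne
    simp only [cc, List.length_append]; omega

theorem exists_flat {f : ℕ → List A} (h : InfNE f) :
    ∃ α : ℕ → A, ∀ n, wpre α (cc f n).length = cc f n := by
  have : ∀ k : ℕ, ∃ a, ∃ n, (cc f n)[k]? = some a := by
    intro k
    obtain ⟨n, hn⟩ := h.len (k+1)
    exact ⟨(cc f n)[k], n, List.getElem?_eq_getElem (by omega)⟩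
  choose α hα using this
  refine ⟨α, fun n => ?_⟩
  apply List.ext_getElem?
  intro k
  by_cases hk : k < (cc f n).length
  · obtain ⟨m, hm⟩ := hα k
    have h1 : (cc f n)[k]? = some (α k) := by
      have hm' : k < (cc f m).length := by
        by_contra hc; rw [List.getElem?_eq_none (by omega)] at hm; simp at hm
      rcases le_total m n with hmn | hmn
      · obtain ⟨z, hz⟩ := cc_prefix f hmn
        rw [← hz, List.getElem?_append_left hm', hm]
      · obtain ⟨z, hz⟩ := cc_prefix f hmn
        rw [← hz, List.getElem?_append_left hk] at hm; exact hm
    rw [h1]; simp [wpre, hk]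
  · rw [List.getElem?_eq_none (by rw [wpre_length]; omega), List.getElem?_eq_none (by omega)]

theorem tlim_flat {I : A → A → Prop} {f : ℕ → List A} (h : InfNE f) {α : ℕ → A}
    (hα : ∀ n, wpre α (cc f n).length = cc f n) : TLim I (cc f) α := by
  refine ⟨fun n => ⟨_, TrEq.pre (TrEq.of_eq (hα n).symm)⟩, fun m => ?_⟩
  obtain ⟨n, hn⟩ := h.len m
  exact ⟨n, by rw [← hα n]; exact TrPre.of_prefix (wpre_prefix α hn)⟩

def vis (M : DFA A σ) (q : σ) (w : List A) : Set σ :=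
  {s | ∃ p, p ≠ [] ∧ p <+: w ∧ s = M.evalFrom q p}

def infV (M : DFA A σ) (f : ℕ → List A) : Set σ :=
  {s | ∀ N, ∃ n ≥ N, s ∈ vis M (M.evalFrom M.start (cc f n)) (f n)}

theorem vis_app (M : DFA A σ) (q : σ) (u v : List A) :
    vis M q (u ++ v) = vis M q u ∪ vis M (M.evalFrom q u) v := by
  ext s; constructor
  · rintro ⟨p, hp, hpre, rfl⟩
    rcases List.prefix_or_prefix_of_prefix hpre (List.prefix_append u v) with h | h
    · exact Or.inl ⟨p, hp, h, rfl⟩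
    · obtain ⟨r, rfl⟩ := h
      rcases r with _ | ⟨c, r⟩
      · left; refine ⟨u, by simpa using hp, List.prefix_refl _, by simp⟩
      · right
        exact ⟨c :: r, by simp, (List.prefix_append_right_inj u).mp hpre, evalFrom_app _ _ _ _⟩
  · rintro (⟨p, hp, hpre, rfl⟩ | ⟨p, hp, hpre, rfl⟩)
    · exact ⟨p, hp, hpre.trans (List.prefix_append _ _), rfl⟩
    · exact ⟨u ++ p, by simp [hp], (List.prefix_append_right_inj u).mpr hpre,
        (evalFrom_app _ _ _ _).symm⟩

theorem infStates_flat (M : DFA A σ) {f : ℕ → List A} (h : InfNE f) {α : ℕ → A}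
    (hα : ∀ n, wpre α (cc f n).length = cc f n) : InfStates M α = infV M f := by
  ext s; constructor
  · intro hs N
    obtain ⟨m, hm, rfl⟩ := hs ((cc f N).length + 1)
    have hex := h.len m
    classical
    let n := Nat.find hex
    have hn : m ≤ (cc f n).length := Nat.find_spec hex
    have hn0 : N < n := by
      by_contra hc
      have := (cc_prefix f (not_lt.mp hc)).length_le
      omega
    obtain ⟨k, hk⟩ : ∃ k, n = k + 1 := ⟨n - 1, by omega⟩
    have hk' : (cc f k).length < m := by
      have := Nat.find_min hex (m := k) (by change k < n; omega)
      omega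
    refine ⟨k, by omega, ?_⟩
    have h1 : cc f k <+: wpre α m := by rw [← hα k]; exact wpre_prefix α hk'.le
    have h2 : wpre α m <+: cc f k ++ f k := by
      have := wpre_prefix α hn
      rwa [hα n, hk] at this
    obtain ⟨p, hp⟩ := h1
    refine ⟨p, ?_, ?_, ?_⟩
    · rintro rfl
      have := congrArg List.length hp
      rw [wpre_length] at this; simp at this; omega
    · rw [← hp] at h2; exact (List.prefix_append_right_inj _).mp h2
    · rw [← hp, evalFrom_app]
  · intro hs N
    obtain ⟨n0, hn0⟩ := h.len N
    obtain ⟨n, hn, p, hp, hpre, rfl⟩ := hs n0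
    refine ⟨(cc f n ++ p).length, ?_, ?_⟩
    · have := (cc_prefix f hn).length_le
      simp; omega
    · rw [← evalFrom_app]
      congr 1
      have h1 : cc f n ++ p <+: cc f (n+1) := (List.prefix_append_right_inj _).mpr hpre
      have h2 := wpre_prefix α h1.length_le
      rw [hα] at h2
      rcases List.prefix_or_prefix_of_prefix h1 h2 with h | h
      · exact (h.eq_of_length (by rw [wpre_length])).symm
      · exact h.eq_of_length (by rw [wpre_length])

theorem muleq {I : A → A → Prop} {L : Set (ℕ → A)} (hL : OmTraceClosed I L)
    (M : DFA A σ) (F : Set (Set σ)) (hM : MullerLang M F = L)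
    {f g : ℕ → List A} (hf : InfNE f) (hg : InfNE g) (h : infV M f = infV M g) :
    InL I L f ↔ InL I L g := by
  obtain ⟨α, hα⟩ := exists_flat hf
  obtain ⟨β, hβ⟩ := exists_flat hg
  rw [inL_iff hL (tlim_flat hf hα), inL_iff hL (tlim_flat hg hβ), ← hM]
  change InfStates M α ∈ F ↔ InfStates M β ∈ F
  rw [infStates_flat M hf hα, infStates_flat M hg hβ, h]

def phi (M : DFA A σ) (w : List A) : σ → σ × Set σ := fun q => (M.evalFrom q w, vis M q w)

theorem phi_app (M : DFA A σ) {u v u' v' : List A} (h : phi M u = phi M u')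
    (h' : phi M v = phi M v') : phi M (u ++ v) = phi M (u' ++ v') := by
  funext q
  have a1 : M.evalFrom q u = M.evalFrom q u' := congrArg Prod.fst (congrFun h q)
  have a2 : vis M q u = vis M q u' := congrArg Prod.snd (congrFun h q)
  have b1 := congrFun h' (M.evalFrom q u')
  have b2 : M.evalFrom (M.evalFrom q u') v = _ := congrArg Prod.fst b1
  have b3 : vis M (M.evalFrom q u') v = _ := congrArg Prod.snd b1
  simp only [phi, evalFrom_app, vis_app, a1, a2, b2, b3]

theorem phi_ne (M : DFA A σ) {u v : List A} (h : phi M u = phi M v) (hu : u ≠ []) : v ≠ [] := by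
  rintro rfl
  have a2 : vis M M.start u = vis M M.start [] := congrArg Prod.snd (congrFun h M.start)
  have : M.evalFrom M.start u ∈ vis M M.start u := ⟨u, hu, List.prefix_refl _, rfl⟩
  rw [a2] at this
  obtain ⟨p, hp, hpre, _⟩ := this
  exact hp (List.prefix_nil.mp hpre)

theorem phi_cc (M : DFA A σ) {f g : ℕ → List A} (h : ∀ n, phi M (f n) = phi M (g n)) (n : ℕ) :
    phi M (cc f n) = phi M (cc g n) := by
  induction n with
  | zero => rfl
  | succ n ih => exact phi_app M ih (h n)

theorem muleq2 {I : A → A → Prop} {L : Set (ℕ → A)} (hL : OmTraceClosed I L)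
    (M : DFA A σ) (F : Set (Set σ)) (hM : MullerLang M F = L)
    {f g : ℕ → List A} (hf : InfNE f) (h : ∀ n, phi M (f n) = phi M (g n)) :
    InL I L f ↔ InL I L g := by
  refine muleq hL M F hM hf ?_ ?_
  · intro N
    obtain ⟨n, hn, hne⟩ := hf N
    exact ⟨n, hn, phi_ne M (h n) hne⟩
  · ext s
    have : ∀ n, vis M (M.evalFrom M.start (cc f n)) (f n)
        = vis M (M.evalFrom M.start (cc g n)) (g n) := by
      intro n
      have h1 : M.evalFrom M.start (cc f n) = M.evalFrom M.start (cc g n) :=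
        congrArg Prod.fst (congrFun (phi_cc M h n) M.start)
      rw [h1]
      exact congrArg Prod.snd (congrFun (h n) _)
    simp only [infV, this]

theorem ramsey {κ : Type*} [Finite κ] (c : ℕ → ℕ → κ) :
    ∃ (n : ℕ → ℕ) (e : κ), StrictMono n ∧ ∀ i, c (n i) (n (i+1)) = e := by
  classical
  let U := Filter.hyperfilter ℕ
  have ex : ∀ g : ℕ → κ, ∃ e, ∀ᶠ j in (U : Filter ℕ), g j = e := by
    intro g
    have : ∀ᶠ j in (U : Filter ℕ), ∃ e ∈ (Set.univ : Set κ), g j = e := by simp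
    rw [Ultrafilter.eventually_exists_mem_iff Set.finite_univ] at this
    obtain ⟨e, _, he⟩ := this
    exact ⟨e, he⟩
  choose E hE using fun i => ex (c i)
  obtain ⟨e, he⟩ := ex E
  have gt : ∀ i : ℕ, ∀ᶠ j in (U : Filter ℕ), i < j := by
    intro i
    exact Filter.Tendsto.eventually
      (Nat.hyperfilter_le_atTop) (Filter.eventually_gt_atTop i)
  have st : ∀ i : {i // E i = e}, ∃ j : {i // E i = e}, i.1 < j.1 ∧ c i j = e := by
    rintro ⟨i, hi⟩
    obtain ⟨j, h1, h2, h3⟩ := ((hE i).and ((gt i).and he)).exists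
    exact ⟨⟨j, h3⟩, h2, h1.trans hi⟩
  choose s hs using st
  obtain ⟨i0, hi0⟩ := he.exists
  let n : ℕ → {i // E i = e} := fun k => s^[k] ⟨i0, hi0⟩
  have hn : ∀ k, n (k+1) = s (n k) := fun k => Function.iterate_succ_apply' _ _ _
  exact ⟨fun k => n k, e, strictMono_nat_of_lt_succ (fun k => by rw [hn]; exact (hs _).1),
    fun k => by beta_reduce; rw [hn]; exact (hs _).2⟩

/-- the chunk `f i ++ … ++ f (j-1)` -/
def chunk (f : ℕ → List A) (i j : ℕ) : List A := cc (fun k => f (i + k)) (j - i)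

theorem cc_chunk (f : ℕ → List A) {i j : ℕ} (h : i ≤ j) : cc f j = cc f i ++ chunk f i j := by
  rw [chunk, ← cc_add]; congr 1; omega

def gr (f : ℕ → List A) (n : ℕ → ℕ) : ℕ → List A
  | 0 => cc f (n 0)
  | i+1 => chunk f (n i) (n (i+1))

theorem cc_gr (f : ℕ → List A) {n : ℕ → ℕ} (hn : StrictMono n) (i : ℕ) :
    cc (gr f n) (i+1) = cc f (n i) := by
  induction i with
  | zero => simp [cc, gr]
  | succ i ih => rw [cc, ih, gr, ← cc_chunk f (hn (Nat.lt_succ_self i)).le]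

theorem inL_gr {I : A → A → Prop} {L : Set (ℕ → A)} (f : ℕ → List A) {n : ℕ → ℕ}
    (hn : StrictMono n) : InL I L f ↔ InL I L (gr f n) := by
  refine inL_cof (fun m => ⟨m + 1, ?_⟩) (fun m => ?_)
  · rw [cc_gr f hn]; exact TrPre.of_prefix (cc_prefix f (hn.le_apply))
  · rcases m with _ | m
    · exact ⟨0, TrPre.rfl'⟩
    · exact ⟨n m, by rw [cc_gr f hn]; exact TrPre.rfl'⟩

theorem infNE_gr {f : ℕ → List A} (hf : InfNE f) {n : ℕ → ℕ} (hn : StrictMono n) :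
    InfNE (gr f n) := by
  intro N
  by_contra hc
  push Not at hc
  have h1 : ∀ k, cc (gr f n) (N + 1 + k) = cc (gr f n) (N + 1) := by
    intro k
    induction k with
    | zero => rfl
    | succ k ih => rw [← add_assoc, cc, ih, hc _ (by omega), List.append_nil]
  obtain ⟨m, hm⟩ := hf.len ((cc (gr f n) (N+1)).length + 1)
  have h2 := (cc_prefix f (hn.le_apply : m ≤ n m)).length_le
  rw [← cc_gr f hn] at h2
  have h3 := (cc_prefix (gr f n) (show m + 1 ≤ N + 1 + m by omega)).length_le
  rw [h1] at h3
  omega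

/-- the chain `x z z z …` -/
def om (x z : List A) : ℕ → List A
  | 0 => x
  | _+1 => z

theorem infNE_om {x z : List A} (h : z ≠ []) : InfNE (om x z) := fun N => ⟨N+1, by omega, h⟩

def AR (I : A → A → Prop) (L : Set (ℕ → A)) (u v : List A) : Prop :=
  (∀ a, a ∈ u ↔ a ∈ v) ∧ ∀ x y,
    (∀ z, z ≠ [] → (InL I L (om (x ++ u ++ y) z) ↔ InL I L (om (x ++ v ++ y) z))) ∧
    (∀ z, y ++ u ++ z ≠ [] → (InL I L (om x (y ++ u ++ z)) ↔ InL I L (om x (y ++ v ++ z))))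

theorem mem_ne {u v : List A} (h : ∀ a, a ∈ u ↔ a ∈ v) : u = [] ↔ v = [] := by
  simp only [List.eq_nil_iff_forall_not_mem, h]

theorem AR.rfl' {I : A → A → Prop} {L : Set (ℕ → A)} (u : List A) : AR I L u u :=
  ⟨fun _ => Iff.rfl, fun _ _ => ⟨fun _ _ => Iff.rfl, fun _ _ => Iff.rfl⟩⟩

theorem AR.sym {I : A → A → Prop} {L : Set (ℕ → A)} {u v : List A} (h : AR I L u v) :
    AR I L v u := by
  refine ⟨fun a => (h.1 a).symm, fun x y => ⟨fun z hz => ((h.2 x y).1 z hz).symm, fun z hz =>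
    ((h.2 x y).2 z ?_).symm⟩⟩
  have := mem_ne h.1
  simp only [ne_eq, List.append_eq_nil_iff] at hz ⊢
  tauto

theorem AR.tr {I : A → A → Prop} {L : Set (ℕ → A)} {u v w : List A} (h : AR I L u v)
    (h' : AR I L v w) : AR I L u w := by
  refine ⟨fun a => (h.1 a).trans (h'.1 a), fun x y => ⟨fun z hz =>
    ((h.2 x y).1 z hz).trans ((h'.2 x y).1 z hz), fun z hz =>
    ((h.2 x y).2 z hz).trans ((h'.2 x y).2 z ?_)⟩⟩
  have := mem_ne h.1
  simp only [ne_eq, List.append_eq_nil_iff] at hz ⊢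
  tauto

theorem AR.ctx {I : A → A → Prop} {L : Set (ℕ → A)} {u v : List A} (h : AR I L u v)
    (p q : List A) : AR I L (p ++ u ++ q) (p ++ v ++ q) := by
  refine ⟨fun a => by simp [h.1 a], fun x y => ⟨fun z hz => ?_, fun z hz => ?_⟩⟩
  · have := (h.2 (x ++ p) (q ++ y)).1 z hz
    simpa [List.append_assoc] using this
  · have := (h.2 x (y ++ p)).2 (q ++ z) (by simpa [List.append_assoc] using hz)
    simpa [List.append_assoc] using this

theorem AR.app {I : A → A → Prop} {L : Set (ℕ → A)} {u v u' v' : List A} (h : AR I L u v)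
    (h' : AR I L u' v') : AR I L (u ++ u') (v ++ v') := by
  have h1 := h.ctx [] u'
  have h2 := h'.ctx v []
  simp only [List.nil_append, List.append_nil] at h1 h2
  exact h1.tr h2

theorem AR.of_treq {I : A → A → Prop} {L : Set (ℕ → A)} {u v : List A} (h : TrEq I u v) :
    AR I L u v := by
  refine ⟨fun a => h.perm.mem_iff, fun x y => ⟨fun z _ => inL_treq ?_, fun z _ => inL_treq ?_⟩⟩
  · rintro (_ | n)
    · exact h.ctx x y
    · exact TrEq.rfl'
  · rintro (_ | n)
    · exact TrEq.rfl'
    · exact h.ctx y z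

theorem AR.of_phi {I : A → A → Prop} {L : Set (ℕ → A)} (hL : OmTraceClosed I L)
    (M : DFA A σ) (F : Set (Set σ)) (hM : MullerLang M F = L) {u v : List A}
    (h : phi M u = phi M v) (hm : ∀ a, a ∈ u ↔ a ∈ v) : AR I L u v := by
  refine ⟨hm, fun x y => ⟨fun z hz => muleq2 hL M F hM (infNE_om hz) ?_,
    fun z hz => muleq2 hL M F hM (infNE_om hz) ?_⟩⟩
  · rintro (_ | n)
    · exact phi_app M (phi_app M rfl h) rfl
    · rfl
  · rintro (_ | n)
    · rfl
    · exact phi_app M (phi_app M rfl h) rfl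

theorem AR.cc {I : A → A → Prop} {L : Set (ℕ → A)} {f g : ℕ → List A}
    (h : ∀ n, AR I L (f n) (g n)) (n : ℕ) : AR I L (cc f n) (cc g n) := by
  induction n with
  | zero => exact AR.rfl' _
  | succ n ih => exact ih.app (h n)

theorem AR.sat {I : A → A → Prop} {L : Set (ℕ → A)} (hL : OmTraceClosed I L) [Finite σ]
    (M : DFA A σ) (F : Set (Set σ)) (hM : MullerLang M F = L) {f g : ℕ → List A}
    (hf : InfNE f) (h : ∀ n, AR I L (f n) (g n)) : InL I L f ↔ InL I L g := by
  have hg : InfNE g := fun N => by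
    obtain ⟨n, hn, hne⟩ := hf N
    exact ⟨n, hn, fun h0 => hne ((mem_ne (h n).1).mpr h0)⟩
  obtain ⟨n, e, hn, he⟩ := ramsey (fun i j => (phi M (chunk f i j), phi M (chunk g i j)))
  have key : ∀ f : ℕ → List A, InfNE f → (∀ i, phi M (chunk f (n i) (n (i+1))) =
      phi M (chunk f (n 0) (n 1))) → (InL I L f ↔ InL I L (om (gr f n 0) (gr f n 1))) := by
    intro f hf hc
    rw [inL_gr f hn]
    refine muleq2 hL M F hM (infNE_gr hf hn) ?_
    rintro (_ | k)
    · rfl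
    · exact hc k
  have k1 := key f hf (fun i => (congrArg Prod.fst (he i)).trans (congrArg Prod.fst (he 0)).symm)
  have k2 := key g hg (fun i => (congrArg Prod.snd (he i)).trans (congrArg Prod.snd (he 0)).symm)
  have hne : gr f n 1 ≠ [] := by
    obtain ⟨m, hm, hne⟩ := infNE_gr hf hn 1
    obtain ⟨k, rfl⟩ : ∃ k, m = k + 1 := ⟨m - 1, by omega⟩
    exact phi_ne M ((congrArg Prod.fst (he k)).trans (congrArg Prod.fst (he 0)).symm) hne
  have a0 : AR I L (gr f n 0) (gr g n 0) := AR.cc h _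
  have a1 : AR I L (gr f n 1) (gr g n 1) := AR.cc (fun k => h _) _
  rw [k1, k2]
  have b0 := (a0.2 [] []).1 _ hne
  have b1 := (a1.2 (gr g n 0) []).2 [] (by simpa using hne)
  simp only [List.nil_append, List.append_nil] at b0 b1
  exact b0.trans b1

universe u in
theorem arnold {A : Type u} [Finite A] {I : A → A → Prop} {L : Set (ℕ → A)}
    (hL : OmTraceClosed I L) [Finite σ]
    (M : DFA A σ) (F : Set (Set σ)) (hM : MullerLang M F = L) :
    ∃ (S : Type u) (_ : Monoid S) (_ : Finite S) (h : List A → S), Function.Surjective h ∧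
      IsHom h ∧ (∀ u v, TrEq I u v → h u = h v) ∧ (∀ u v, h u = h v → ∀ a, a ∈ u ↔ a ∈ v) ∧
      (∀ f g, InfNE f → (∀ n, h (f n) = h (g n)) → (InL I L f ↔ InL I L g)) := by
  classical
  let con : Con (FreeMonoid A) :=
    { r := fun u v => AR I L (FreeMonoid.toList u) (FreeMonoid.toList v)
      iseqv := ⟨fun u => AR.rfl' _, fun h => h.sym, fun h h' => h.tr h'⟩
      mul' := fun h h' => AR.app h h' }
  let h : List A → con.Quotient := fun u => ((FreeMonoid.ofList u : FreeMonoid A) : con.Quotient)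
  have hiff : ∀ u v, h u = h v ↔ AR I L u v := fun u v => Con.eq con
  have hsurj : Function.Surjective h := fun s => by
    induction s using Con.induction_on with
    | H x => exact ⟨FreeMonoid.toList x, rfl⟩
  have hfin : Finite con.Quotient := by
    let ψ : List A → (σ → σ × Set σ) × Set A := fun u => (phi M u, {a | a ∈ u})
    have hψ : ∀ u v, ψ u = ψ v → h u = h v := fun u v huv => (hiff u v).mpr
      (AR.of_phi hL M F hM (congrArg Prod.fst huv)
        (fun a => Set.ext_iff.mp (congrArg Prod.snd huv) a))
    let g : Set.range ψ → con.Quotient := fun t => h t.2.choose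
    refine Finite.of_surjective g (fun s => ?_)
    obtain ⟨u, rfl⟩ := hsurj s
    exact ⟨⟨ψ u, u, rfl⟩, hψ _ _ (Exists.choose_spec (⟨u, rfl⟩ : ψ u ∈ Set.range ψ))⟩
  refine ⟨con.Quotient, inferInstance, hfin, h, hsurj, ⟨?_, fun u v => ?_⟩, fun u v huv => ?_,
    fun u v huv => ?_, fun f g hf hfg => ?_⟩
  · rfl
  · rfl
  · exact ((hiff u v).mpr (AR.of_treq huv))
  · exact ((hiff u v).mp huv).1
  · exact AR.sat hL M F hM hf (fun n => (hiff _ _).mp (hfg n))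





/-! ## Part 5: the diamond automaton -/

abbrev View (A : Type*) := Set A × Set A

/-- letters dependent on `c` -/
def dep (I : A → A → Prop) (c : A) : Set A := {d | ¬ I c d}

open Classical in
noncomputable def vact (I : A → A → Prop) (v : View A) (c : A) : View A :=
  if c ∈ v.1 then (v.1 ∪ dep I c, if c ∈ v.2 then v.2 ∪ dep I c else v.2) else v

def hit (v : View A) (c : A) : Prop := c ∈ v.1 ∧ c ∈ v.2

def eset (I : A → A → Prop) (l : A × A) : Set A := {x | x = l.1 ∨ (x = l.2 ∧ ¬ I l.1 l.2)}

abbrev Lbl (A : Type*) := Fin (Nat.card ((A × A) × (A × A)) + 1)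

abbrev NSt (A : Type*) := View A → A × A → Option (A × Lbl A)

theorem newlabel_ex [Finite A] (I : A → A → Prop) (N : NSt A) (c : A) :
    ∃ t : Lbl A, ∀ k l, N (dep I c, eset I k) l ≠ some (c, t) := by
  classical
  by_contra hc
  push Not at hc
  choose k l hkl using hc
  have : Function.Injective (fun t => (k t, l t)) := by
    intro t t' h
    have h1 := hkl t
    have h2 := hkl t'
    simp only [Prod.mk.injEq] at h
    rw [h.1, h.2, h2] at h1
    simpa using h1.symm
  have := Nat.card_le_card_of_injective _ this
  simp at this

open Classical in
noncomputable def newlabel [Finite A] (I : A → A → Prop) (N : NSt A) (c : A) : Lbl A :=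
  (newlabel_ex I N c).choose

open Classical in
noncomputable def stepN [Finite A] (I : A → A → Prop) (N : NSt A) (c : A) : NSt A :=
  fun v l => if hit v c ∧ c ∈ eset I l then some (c, newlabel I N c) else N (vact I v c) l

abbrev HSt (A S : Type*) := View A → Set (View A) → S

def hitm (v : View A) (V : Set (View A)) (c : A) : Prop := hit v c ∧ ∀ w ∈ V, ¬ hit w c

open Classical in
noncomputable def stepH [Monoid S] (I : A → A → Prop) (h : List A → S) (H : HSt A S) (c : A) :
    HSt A S :=
  fun v V => H (vact I v c) ((fun w => vact I w c) '' V) *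
    (if hitm v V c then h [c] else 1)

abbrev Dat (A σ S : Type*) :=
  (A × A → Option (A × Lbl A)) × (Set (A × A) → S) × (Set A → S → S → σ × Set σ)

open Classical in
/-- tracking step -/
noncomputable def trk (M : DFA A σ) (wd : S → List A) (s : S)
    (prev : Option (Set A → S → S → σ × Set σ)) : Set A → S → S → σ × Set σ :=
  fun C x E =>
    let q := match prev with
      | none => M.evalFrom M.start (wd x)
      | some t => (t C x E).1
    if ∀ a ∈ wd s, a ∈ C then (M.evalFrom q (wd s ++ wd E), vis M q (wd s ++ wd E))
    else (M.evalFrom M.start (wd x), ∅)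

noncomputable def newdat [Finite A] [Monoid S] (I : A → A → Prop) (h : List A → S)
    (M : DFA A σ) (wd : S → List A) (N : NSt A) (H : HSt A S) (g : Option (Dat A σ S)) (a : A) :
    Dat A σ S :=
  (stepN I N a ({a}, Set.univ),
   fun K => stepH I h H a ({a}, Set.univ) ((fun k => (({a} : Set A), eset I k)) '' K),
   trk M wd (H (dep I a, Set.univ) {({a}, Set.univ)} * h [a]) (g.map (fun d => d.2.2)))

abbrev ASt (A σ S : Type*) := NSt A × HSt A S × (A → Option (Dat A σ S)) × (A → Bool)

open Classical in
noncomputable def aut [Finite A] [Monoid S] (I : A → A → Prop) (h : List A → S)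
    (M : DFA A σ) (wd : S → List A) : DFA A (ASt A σ S) where
  step s c := (stepN I s.1 c, stepH I h s.2.1 c,
    Function.update s.2.2.1 c (some (newdat I h M wd s.1 s.2.1 (s.2.2.1 c) c)),
    Function.update s.2.2.2 c (!(s.2.2.2 c)))
  start := (fun _ _ => none, fun _ _ => 1, fun _ => none, fun _ => false)
  accept := ∅

theorem vact_triv {I : A → A → Prop} {v : View A} {c : A} (h : c ∉ v.1) : vact I v c = v := by
  simp [vact, h]

theorem vact_mem1 {I : A → A → Prop} (v : View A) {c d : A} (h : I c d) :
    d ∈ (vact I v c).1 ↔ d ∈ v.1 := by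
  unfold vact; split_ifs <;> simp [dep, h]

theorem vact_mem2 {I : A → A → Prop} (v : View A) {c d : A} (h : I c d) :
    d ∈ (vact I v c).2 ↔ d ∈ v.2 := by
  unfold vact; split_ifs <;> simp [dep, h]

theorem hit_vact {I : A → A → Prop} (v : View A) {c d : A} (h : I c d) :
    hit (vact I v c) d ↔ hit v d := by
  rw [hit, vact_mem1 v h, vact_mem2 v h, hit]

theorem vact_comm {I : A → A → Prop} (hsym : ∀ a b, I a b → I b a) (v : View A) {c d : A}
    (h : I c d) : vact I (vact I v c) d = vact I (vact I v d) c := by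
  classical
  have a1 := vact_mem1 v h
  have a2 := vact_mem2 v h
  have b1 := vact_mem1 v (hsym _ _ h)
  have b2 := vact_mem2 v (hsym _ _ h)
  have e1 : ∀ (w : View A) (x : A), vact I w x = if x ∈ w.1 then
    (w.1 ∪ dep I x, if x ∈ w.2 then w.2 ∪ dep I x else w.2) else w := fun w x => rfl
  rw [e1 (vact I v c) d, e1 (vact I v d) c, a1, a2, b1, b2, e1 v c, e1 v d]
  split_ifs <;> simp only [Set.union_right_comm]

theorem newlabel_congr [Finite A] {I : A → A → Prop} {N N' : NSt A} {c : A}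
    (h : ∀ Y l, N (dep I c, Y) l = N' (dep I c, Y) l) : newlabel I N c = newlabel I N' c := by
  unfold newlabel
  congr 1
  simp only [h]

theorem newlabel_spec [Finite A] (I : A → A → Prop) (N : NSt A) (c : A) (k l : A × A) :
    N (dep I c, eset I k) l ≠ some (c, newlabel I N c) := (newlabel_ex I N c).choose_spec k l

theorem stepN_triv [Finite A] {I : A → A → Prop} (N : NSt A) {c : A} {v : View A} (h : c ∉ v.1)
    (l : A × A) : stepN I N c v l = N v l := by
  rw [stepN, if_neg (fun hh => h hh.1.1), vact_triv h]

theorem eset_clique {I : A → A → Prop} (hirr : ∀ a, ¬ I a a) (hsym : ∀ a b, I a b → I b a)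
    {l : A × A} {c d : A} (hc : c ∈ eset I l) (hd : d ∈ eset I l) : ¬ I c d := by
  rcases hc with rfl | ⟨rfl, h⟩ <;> rcases hd with rfl | ⟨rfl, h'⟩
  · exact hirr _
  · exact h'
  · exact fun hh => h (hsym _ _ hh)
  · exact hirr _

theorem stepN_comm [Finite A] {I : A → A → Prop} (hirr : ∀ a, ¬ I a a)
    (hsym : ∀ a b, I a b → I b a) (N : NSt A) {c d : A}
    (h : I c d) : stepN I (stepN I N c) d = stepN I (stepN I N d) c := by
  have e1 : newlabel I (stepN I N c) d = newlabel I N d :=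
    newlabel_congr (fun Y l => stepN_triv N (by simpa [dep] using hsym _ _ h) l)
  have e2 : newlabel I (stepN I N d) c = newlabel I N c :=
    newlabel_congr (fun Y l => stepN_triv N (by simpa [dep] using h) l)
  funext v l
  rw [stepN, e1, stepN, hit_vact v (hsym _ _ h), stepN, e2, stepN, hit_vact v h,
    vact_comm hsym v h]
  by_cases hc : hit v c ∧ c ∈ eset I l
  · by_cases hd : hit v d ∧ d ∈ eset I l
    · exact absurd h (eset_clique hirr hsym hc.2 hd.2)
    · simp only [hc, hd, if_false]
  · simp only [hc, if_false]

theorem stepH_triv [Monoid S] {I : A → A → Prop} {h : List A → S} (H : HSt A S) {c : A}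
    {v : View A} {V : Set (View A)} (h1 : c ∉ v.1) (h2 : ∀ w ∈ V, c ∉ w.1) :
    stepH I h H c v V = H v V := by
  rw [stepH, if_neg (fun hh => h1 hh.1.1), vact_triv h1, mul_one]
  congr 1
  ext w
  simp only [Set.mem_image]
  constructor
  · rintro ⟨w', hw', rfl⟩; rwa [vact_triv (h2 _ hw')]
  · intro hw; exact ⟨w, hw, vact_triv (h2 _ hw)⟩

theorem hitm_vact {I : A → A → Prop} (v : View A) (V : Set (View A)) {c d : A} (h : I c d) :
    hitm (vact I v c) ((fun w => vact I w c) '' V) d = hitm v V d := by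
  simp only [hitm, Set.forall_mem_image, hit_vact _ h]

theorem stepH_comm [Monoid S] {I : A → A → Prop}
    (hsym : ∀ a b, I a b → I b a) {h : List A → S} (hh : IsHom h)
    (ht : ∀ u v, TrEq I u v → h u = h v) (H : HSt A S) {c d : A}
    (hcd : I c d) : stepH I h (stepH I h H c) d = stepH I h (stepH I h H d) c := by
  classical
  have key : h [c] * h [d] = h [d] * h [c] := by
    rw [← hh.2, ← hh.2]
    exact ht _ _ (EqvGen.rel _ _ ⟨[], [], c, d, hcd, rfl, rfl⟩)
  funext v V
  have e1 : ∀ (H : HSt A S) (c : A) v V, stepH I h H c v V = H (vact I v c)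
    ((fun w => vact I w c) '' V) * (if hitm v V c then h [c] else 1) := fun H c v V => rfl
  rw [e1, e1, e1 _ c, e1, hitm_vact v V hcd, hitm_vact v V (hsym _ _ hcd), Set.image_image,
    Set.image_image, vact_comm hsym v hcd]
  simp only [vact_comm hsym _ hcd, mul_assoc]
  congr 1
  split_ifs <;> simp [key]

theorem newdat_congr [Finite A] [Monoid S] {I : A → A → Prop} (hirr : ∀ a, ¬ I a a)
    (hsym : ∀ a b, I a b → I b a) {h : List A → S} (hh : IsHom h)
    (ht : ∀ u v, TrEq I u v → h u = h v) (M : DFA A σ) (wd : S → List A) (N : NSt A) (H : HSt A S)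
    (g : Option (Dat A σ S)) {a c : A} (hac : I a c) :
    newdat I h M wd (stepN I N c) (stepH I h H c) g a = newdat I h M wd N H g a := by
  have hca : c ∉ ({a} : Set A) := fun h => hirr a (by rw [Set.mem_singleton_iff.mp h] at hac; exact hac)
  unfold newdat
  rw [stepN_comm hirr hsym N (hsym _ _ hac), stepH_comm hsym hh ht H (hsym _ _ hac)]
  refine Prod.ext ?_ (Prod.ext ?_ ?_)
  · funext l; exact stepN_triv _ hca l
  · funext K
    refine stepH_triv _ hca ?_
    rintro w ⟨k, _, rfl⟩
    exact hca
  · change trk _ _ _ _ = trk _ _ _ _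
    rw [stepH_triv H (by simpa [dep] using hac) (by simpa using hca)]

theorem aut_diamond [Finite A] [Monoid S] {I : A → A → Prop} (hirr : ∀ a, ¬ I a a)
    (hsym : ∀ a b, I a b → I b a) {h : List A → S} (hh : IsHom h)
    (ht : ∀ u v, TrEq I u v → h u = h v) (M : DFA A σ) (wd : S → List A) :
    IDiamond I (aut I h M wd) := by
  classical
  rintro ⟨N, H, G, P⟩ a b hab
  have hne : a ≠ b := fun e => hirr a (by rw [← e] at hab; exact hab)
  simp only [aut, stepN_comm hirr hsym N hab, stepH_comm hsym hh ht H hab,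
    newdat_congr hirr hsym hh ht M wd N H _ hab,
    newdat_congr hirr hsym hh ht M wd N H _ (hsym _ _ hab),
    Function.update_of_ne hne, Function.update_of_ne hne.symm]
  rw [Function.update_comm hne, Function.update_comm hne]

def color (a : A) (s : ASt A σ S) : Bool × Option (Dat A σ S) := (s.2.2.2 a, s.2.2.1 a)

theorem color_step [Finite A] [Monoid S] (I : A → A → Prop) (h : List A → S)
    (M : DFA A σ) (wd : S → List A) (a : A) (s : ASt A σ S) (c : A) (hc : c ≠ a) :
    color a ((aut I h M wd).step s c) = color a s := by
  classical
  simp [color, aut, Function.update_of_ne hc.symm]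





/-! ## Part 6: semantics of the automaton on positions -/

def tle (I : A → A → Prop) (α : ℕ → A) : ℕ → ℕ → Prop :=
  ReflTransGen (fun i j => i < j ∧ ¬ I (α i) (α j))

theorem tle.rfl' {I : A → A → Prop} {α : ℕ → A} {i : ℕ} : tle I α i i := ReflTransGen.refl
theorem tle.tr {I : A → A → Prop} {α : ℕ → A} {i j k : ℕ} (h : tle I α i j) (h' : tle I α j k) :
    tle I α i k := ReflTransGen.trans h h'
theorem tle.le {I : A → A → Prop} {α : ℕ → A} {i j : ℕ} (h : tle I α i j) : i ≤ j := by
  induction h with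
  | refl => exact le_refl _
  | tail _ h ih => exact ih.trans h.1.le
theorem tle.of_dep {I : A → A → Prop} {α : ℕ → A} {i j : ℕ} (h : i ≤ j) (h' : ¬ I (α i) (α j)) :
    tle I α i j := by
  rcases h.eq_or_lt with rfl | h
  · exact tle.rfl'
  · exact ReflTransGen.single ⟨h, h'⟩
theorem tle.last {I : A → A → Prop} {α : ℕ → A} {i j : ℕ} (h : tle I α i j) :
    i = j ∨ ∃ k, tle I α i k ∧ k < j ∧ ¬ I (α k) (α j) := by
  rcases ReflTransGen.cases_tail h with h | ⟨k, h1, h2, h3⟩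
  · exact Or.inl h.symm
  · exact Or.inr ⟨k, h1, h2, h3⟩
theorem tle.first {I : A → A → Prop} {α : ℕ → A} {i j : ℕ} (h : tle I α i j) :
    i = j ∨ ∃ k, i < k ∧ ¬ I (α i) (α k) ∧ tle I α k j := by
  rcases ReflTransGen.cases_head h with h | ⟨k, ⟨h1, h2⟩, h3⟩
  · exact Or.inl h
  · exact Or.inr ⟨k, h1, h2, h3⟩

def sem (I : A → A → Prop) (α : ℕ → A) (n : ℕ) (v : View A) (i : ℕ) : Prop :=
  ∃ m j, tle I α i m ∧ tle I α m j ∧ j < n ∧ α m ∈ v.2 ∧ α j ∈ v.1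

theorem sem.lt {I : A → A → Prop} {α : ℕ → A} {n : ℕ} {v : View A} {i : ℕ}
    (h : sem I α n v i) : i < n := by
  obtain ⟨m, j, h1, h2, h3, _⟩ := h
  have := h1.le; have := h2.le; omega

theorem sem_succ {I : A → A → Prop} (hsym : ∀ a b, I a b → I b a)
    {α : ℕ → A} {n : ℕ} {v : View A} {i : ℕ} :
    sem I α (n+1) v i ↔ sem I α n (vact I v (α n)) i ∨ (i = n ∧ hit v (α n)) := by
  by_cases hX : α n ∈ v.1
  swap
  · rw [vact_triv hX]
    constructor
    · rintro ⟨m, j, h1, h2, h3, h4, h5⟩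
      refine Or.inl ⟨m, j, h1, h2, ?_, h4, h5⟩
      rcases (Nat.lt_succ_iff.mp h3).eq_or_lt with rfl | h
      · exact absurd h5 hX
      · exact h
    · rintro (⟨m, j, h1, h2, h3, h4, h5⟩ | ⟨_, h⟩)
      · exact ⟨m, j, h1, h2, by omega, h4, h5⟩
      · exact absurd h.1 hX
  have hd : ∀ {j}, ¬ I (α j) (α n) → α j ∈ dep I (α n) := fun h hh => h (hsym _ _ hh)
  have hd' : ∀ {j}, α j ∈ dep I (α n) → ¬ I (α j) (α n) := fun h hh => h (hsym _ _ hh)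
  have e1 : (vact I v (α n)).1 = v.1 ∪ dep I (α n) := by simp [vact, hX]
  have e2 : v.2 ⊆ (vact I v (α n)).2 := by
    unfold vact; split_ifs
    · exact Set.subset_union_left
    · exact subset_rfl
  constructor
  · rintro ⟨m, j, h1, h2, h3, h4, h5⟩
    rcases (Nat.lt_succ_iff.mp h3).eq_or_lt with rfl | h
    · rcases h2.last with rfl | ⟨k, hk, hkj, hdep⟩
      · have e3 : (vact I v (α m)).2 = v.2 ∪ dep I (α m) := by simp [vact, hX, h4]
        rcases h1.last with rfl | ⟨k, hk, hkj, hdep⟩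
        · exact Or.inr ⟨rfl, hX, h4⟩
        · exact Or.inl ⟨k, k, hk, tle.rfl', hkj, by rw [e3]; exact Or.inr (hd hdep),
            by rw [e1]; exact Or.inr (hd hdep)⟩
      · exact Or.inl ⟨m, k, h1, hk, hkj, e2 h4, by rw [e1]; exact Or.inr (hd hdep)⟩
    · exact Or.inl ⟨m, j, h1, h2, h, e2 h4, by rw [e1]; exact Or.inl h5⟩
  · rintro (⟨m, j, h1, h2, h3, h4, h5⟩ | ⟨rfl, h⟩)
    · have hY : α m ∈ v.2 ∨ (α n ∈ v.2 ∧ α m ∈ dep I (α n)) := by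
        unfold vact at h4
        rw [if_pos hX] at h4
        simp only at h4
        split_ifs at h4 with h6
        · rcases h4 with h4 | h4
          · exact Or.inl h4
          · exact Or.inr ⟨h6, h4⟩
        · exact Or.inl h4
      rcases hY with hY | ⟨hY, hm⟩
      · rw [e1] at h5
        rcases h5 with h5 | h5
        · exact ⟨m, j, h1, h2, by omega, hY, h5⟩
        · exact ⟨m, n, h1, h2.tr (tle.of_dep h3.le (hd' h5)), by omega, hY, hX⟩
      · have : tle I α m n := tle.of_dep (by have := h2.le; omega) (hd' hm)
        exact ⟨n, n, h1.tr this, tle.rfl', by omega, hY, hX⟩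
    · exact ⟨i, i, tle.rfl', tle.rfl', by omega, h.2, h.1⟩

open Classical in
noncomputable def W (α : ℕ → A) (P : ℕ → Prop) : ℕ → List A
  | 0 => []
  | n+1 => W α P n ++ (if P n then [α n] else [])

theorem W_congr {α : ℕ → A} {P Q : ℕ → Prop} {n : ℕ} (h : ∀ i < n, P i ↔ Q i) :
    W α P n = W α Q n := by
  induction n with
  | zero => rfl
  | succ n ih =>
    rw [W, W, ih (fun i hi => h i (by omega))]
    have hn := h n (by omega)
    by_cases hp : P n
    · rw [if_pos hp, if_pos (hn.mp hp)]
    · rw [if_neg hp, if_neg (fun hq => hp (hn.mpr hq))]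

theorem W_stable {α : ℕ → A} {P : ℕ → Prop} {n m : ℕ} (h : ∀ i, P i → i < n) (hm : n ≤ m) :
    W α P m = W α P n := by
  induction m, hm using Nat.le_induction with
  | base => rfl
  | succ m hm ih =>
    rw [W, ih, if_neg (fun hp => by have := h m hp; omega), List.append_nil]

theorem mem_W {α : ℕ → A} {P : ℕ → Prop} {n : ℕ} {c : A} :
    c ∈ W α P n ↔ ∃ i < n, P i ∧ α i = c := by
  induction n with
  | zero => simp [W]
  | succ n ih =>
    rw [W, List.mem_append, ih]
    constructor
    · rintro (⟨i, h1, h2⟩ | h)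
      · exact ⟨i, by omega, h2⟩
      · split_ifs at h with hp
        · exact ⟨n, by omega, hp, (List.mem_singleton.mp h).symm⟩
        · simp at h
    · rintro ⟨i, h1, h2, h3⟩
      rcases (Nat.lt_succ_iff.mp h1).eq_or_lt with rfl | h
      · right; rw [if_pos h2]; simp [h3]
      · exact Or.inl ⟨i, h, h2, h3⟩

theorem W_true (α : ℕ → A) (n : ℕ) : W α (fun _ => True) n = wpre α n := by
  induction n with
  | zero => rfl
  | succ n ih => rw [W, ih, wpre_succ, if_pos trivial]

theorem W_false (α : ℕ → A) (n : ℕ) : W α (fun _ => False) n = [] := by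
  induction n with
  | zero => rfl
  | succ n ih => rw [W, ih, if_neg not_false]; rfl

theorem W_split {I : A → A → Prop} {α : ℕ → A} {P R : ℕ → Prop} (hd : ∀ i, P i → ¬ R i)
    (h : ∀ i j, i < j → R i → P j → I (α i) (α j)) (n : ℕ) :
    TrEq I (W α (fun i => P i ∨ R i) n) (W α P n ++ W α R n) := by
  induction n with
  | zero => exact TrEq.rfl'
  | succ n ih =>
    rw [W, W, W]
    by_cases hP : P n
    · rw [if_pos (Or.inl hP), if_pos hP, if_neg (hd n hP), List.append_nil]
      refine (ih.app TrEq.rfl').tr ?_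
      rw [List.append_assoc, List.append_assoc]
      refine TrEq.rfl'.app (TrEq.comm1 ?_)
      intro b hb
      obtain ⟨i, hi, hR, rfl⟩ := mem_W.mp hb
      exact h i n hi hR hP
    · by_cases hR : R n
      · rw [if_pos (Or.inr hR), if_neg hP, if_pos hR, List.append_nil, ← List.append_assoc]
        exact ih.app TrEq.rfl'
      · rw [if_neg (by tauto), if_neg hP, if_neg hR]
        simpa using ih

noncomputable def st [Finite A] [Monoid S] (I : A → A → Prop) (h : List A → S)
    (M : DFA A σ) (wd : S → List A) (α : ℕ → A) (n : ℕ) : ASt A σ S :=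
  (aut I h M wd).evalFrom (aut I h M wd).start (wpre α n)

theorem st_succ [Finite A] [Monoid S] (I : A → A → Prop) (h : List A → S)
    (M : DFA A σ) (wd : S → List A) (α : ℕ → A) (n : ℕ) :
    st I h M wd α (n+1) = (aut I h M wd).step (st I h M wd α n) (α n) :=
  eval_wpre_succ _ _ _ _

noncomputable def Lab [Finite A] [Monoid S] (I : A → A → Prop) (h : List A → S)
    (M : DFA A σ) (wd : S → List A) (α : ℕ → A) (i : ℕ) : Lbl A :=
  newlabel I (st I h M wd α i).1 (α i)

noncomputable def dat [Finite A] [Monoid S] (I : A → A → Prop) (h : List A → S)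
    (M : DFA A σ) (wd : S → List A) (α : ℕ → A) (i : ℕ) : Dat A σ S :=
  newdat I h M wd (st I h M wd α i).1 (st I h M wd α i).2.1 ((st I h M wd α i).2.2.1 (α i)) (α i)

def IsLast (I : A → A → Prop) (α : ℕ → A) (n : ℕ) (v : View A) (l : A × A) (i : ℕ) : Prop :=
  sem I α n v i ∧ α i ∈ eset I l ∧ ∀ j, sem I α n v j → α j ∈ eset I l → j ≤ i

theorem N_sem [Finite A] [Monoid S] {I : A → A → Prop} (hsym : ∀ a b, I a b → I b a)
    (h : List A → S) (M : DFA A σ) (wd : S → List A) (α : ℕ → A) (n : ℕ) (v : View A) (l : A × A) :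
    ((st I h M wd α n).1 v l = none ∧ ∀ i, sem I α n v i → α i ∉ eset I l) ∨
    ∃ i, IsLast I α n v l i ∧ (st I h M wd α n).1 v l = some (α i, Lab I h M wd α i) := by
  induction n generalizing v with
  | zero => exact Or.inl ⟨rfl, fun i hi => absurd hi.lt (Nat.not_lt_zero _)⟩
  | succ n ih =>
    have e : (st I h M wd α (n+1)).1 v l = stepN I (st I h M wd α n).1 (α n) v l := by
      rw [st_succ]; rfl
    rw [e, stepN]
    by_cases hc : hit v (α n) ∧ α n ∈ eset I l
    · rw [if_pos hc]
      refine Or.inr ⟨n, ⟨(sem_succ hsym).mpr (Or.inr ⟨rfl, hc.1⟩), hc.2, fun j hj _ => ?_⟩, rfl⟩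
      have := hj.lt; omega
    · rw [if_neg hc]
      rcases ih (vact I v (α n)) with ⟨h1, h2⟩ | ⟨i, ⟨h1, h2, h3⟩, h4⟩
      · refine Or.inl ⟨h1, fun i hi hl => ?_⟩
        rcases (sem_succ hsym).mp hi with hi | ⟨rfl, hi⟩
        · exact h2 i hi hl
        · exact hc ⟨hi, hl⟩
      · refine Or.inr ⟨i, ⟨(sem_succ hsym).mpr (Or.inl h1), h2, fun j hj hl => ?_⟩, h4⟩
        rcases (sem_succ hsym).mp hj with hj | ⟨rfl, hi⟩
        · exact h3 j hj hl
        · exact absurd ⟨hi, hl⟩ hc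

theorem N_last [Finite A] [Monoid S] {I : A → A → Prop} (hsym : ∀ a b, I a b → I b a)
    (h : List A → S) (M : DFA A σ) (wd : S → List A) (α : ℕ → A) {n : ℕ} {v : View A} {l : A × A}
    {i : ℕ} (hi : IsLast I α n v l i) :
    (st I h M wd α n).1 v l = some (α i, Lab I h M wd α i) := by
  rcases N_sem hsym h M wd α n v l with ⟨_, h2⟩ | ⟨j, h1, h2⟩
  · exact absurd hi.2.1 (h2 i hi.1)
  · have : i = j := le_antisymm (h1.2.2 i hi.1 hi.2.1) (hi.2.2 j h1.1 h1.2.1)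
    rw [this]; exact h2

theorem H_sem [Finite A] [Monoid S] {I : A → A → Prop} (hsym : ∀ a b, I a b → I b a)
    {h : List A → S} (hh : IsHom h) (M : DFA A σ) (wd : S → List A) (α : ℕ → A) (n : ℕ)
    (v : View A) (V : Set (View A)) :
    (st I h M wd α n).2.1 v V =
      h (W α (fun i => sem I α n v i ∧ ∀ w ∈ V, ¬ sem I α n w i) n) := by
  classical
  induction n generalizing v V with
  | zero => exact hh.1.symm
  | succ n ih =>
    have e : (st I h M wd α (n+1)).2.1 v V = stepH I h (st I h M wd α n).2.1 (α n) v V := by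
      rw [st_succ]; rfl
    rw [e, stepH, ih, W, hh.2]
    congr 1
    · congr 1
      refine W_congr (fun i hi => ?_)
      have : ∀ w, sem I α (n+1) w i ↔ sem I α n (vact I w (α n)) i := fun w => by
        rw [sem_succ hsym]; constructor
        · rintro (h | ⟨rfl, _⟩)
          · exact h
          · omega
        · exact Or.inl
      simp only [this, Set.forall_mem_image]
    · have : ∀ w, sem I α (n+1) w n ↔ hit w (α n) := fun w => by
        rw [sem_succ hsym]; constructor
        · rintro (h | ⟨_, h⟩)
          · exact absurd h.lt (lt_irrefl _)
          · exact h
        · exact fun h => Or.inr ⟨rfl, h⟩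
      by_cases hc : hit v (α n) ∧ ∀ w ∈ V, ¬ hit w (α n)
      · rw [if_pos (show hitm v V (α n) from hc), if_pos (by simpa only [this] using hc)]
      · rw [if_neg (show ¬ hitm v V (α n) from hc), if_neg (by simpa only [this] using hc)]
        exact hh.1.symm

theorem G_sem [Finite A] [Monoid S] (I : A → A → Prop)
    (h : List A → S) (M : DFA A σ) (wd : S → List A) (α : ℕ → A) (n : ℕ) (a : A) :
    ((st I h M wd α n).2.2.1 a = none ∧ ∀ e < n, α e ≠ a) ∨
    ∃ e < n, α e = a ∧ (∀ j < n, α j = a → j ≤ e) ∧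
      (st I h M wd α n).2.2.1 a = some (dat I h M wd α e) := by
  classical
  induction n with
  | zero => exact Or.inl ⟨rfl, fun e he => absurd he (Nat.not_lt_zero _)⟩
  | succ n ih =>
    have e : (st I h M wd α (n+1)).2.2.1 = Function.update (st I h M wd α n).2.2.1 (α n)
        (some (dat I h M wd α n)) := by
      rw [st_succ]; rfl
    rw [e]
    by_cases hc : a = α n
    · right
      refine ⟨n, by omega, hc.symm, fun j hj _ => by omega, ?_⟩
      rw [hc, Function.update_self]
    · rw [Function.update_of_ne hc]
      rcases ih with ⟨h1, h2⟩ | ⟨e, h1, h2, h3, h4⟩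
      · refine Or.inl ⟨h1, fun e he => ?_⟩
        rcases (Nat.lt_succ_iff.mp he).eq_or_lt with rfl | he
        · exact fun h => hc h.symm
        · exact h2 e he
      · refine Or.inr ⟨e, by omega, h2, fun j hj hja => ?_, h4⟩
        rcases (Nat.lt_succ_iff.mp hj).eq_or_lt with rfl | he
        · exact absurd hja.symm hc
        · exact h3 j he hja

theorem semA {I : A → A → Prop} (hirr : ∀ a, ¬ I a a) {α : ℕ → A} {e : ℕ} {Y : Set A} {i : ℕ} :
    sem I α (e+1) ({α e}, Y) i ↔ ∃ m, tle I α i m ∧ tle I α m e ∧ α m ∈ Y := by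
  constructor
  · rintro ⟨m, j, h1, h2, h3, h4, h5⟩
    refine ⟨m, h1, h2.tr (tle.of_dep (by omega) ?_), h4⟩
    rw [Set.mem_singleton_iff.mp h5]; exact hirr _
  · rintro ⟨m, h1, h2, h3⟩
    exact ⟨m, e, h1, h2, by omega, h3, rfl⟩

theorem semA' {I : A → A → Prop} (hirr : ∀ a, ¬ I a a) {α : ℕ → A} {e : ℕ} {i : ℕ} :
    sem I α (e+1) ({α e}, Set.univ) i ↔ tle I α i e := by
  rw [semA hirr]
  exact ⟨fun ⟨m, h1, h2, _⟩ => h1.tr h2, fun h => ⟨i, tle.rfl', h, trivial⟩⟩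

theorem semB {I : A → A → Prop} (hsym : ∀ a b, I a b → I b a) {α : ℕ → A} {y : ℕ} {Y : Set A}
    {i : ℕ} : sem I α y (dep I (α y), Y) i ↔
      ∃ m, tle I α i m ∧ tle I α m y ∧ m ≠ y ∧ α m ∈ Y := by
  constructor
  · rintro ⟨m, j, h1, h2, h3, h4, h5⟩
    refine ⟨m, h1, h2.tr (tle.of_dep h3.le (fun hh => h5 (hsym _ _ hh))), ?_, h4⟩
    have := h2.le; omega
  · rintro ⟨m, h1, h2, h3, h4⟩
    rcases h2.last with rfl | ⟨k, hk, hkj, hdep⟩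
    · exact absurd rfl h3
    · exact ⟨m, k, h1, hk, hkj, h4, fun hh => hdep (hsym _ _ hh)⟩

/-! ## Part 7: finite part -/

def LastIn (I : A → A → Prop) (α : ℕ → A) (e : ℕ) (l : A × A) (x : ℕ) : Prop :=
  tle I α x e ∧ α x ∈ eset I l ∧ ∀ m, tle I α m e → α m ∈ eset I l → m ≤ x

theorem lastIn_iff {I : A → A → Prop} (hirr : ∀ a, ¬ I a a) {α : ℕ → A} {e : ℕ} {l : A × A}
    {x : ℕ} : LastIn I α e l x ↔ IsLast I α (e+1) ({α e}, Set.univ) l x := by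
  simp only [LastIn, IsLast, semA' hirr]

theorem dN_last [Finite A] [Monoid S] {I : A → A → Prop} (hirr : ∀ a, ¬ I a a)
    (hsym : ∀ a b, I a b → I b a) (h : List A → S) (M : DFA A σ) (wd : S → List A) {α : ℕ → A}
    {e : ℕ} {l : A × A} {x : ℕ} (hx : LastIn I α e l x) :
    (dat I h M wd α e).1 l = some (α x, Lab I h M wd α x) := by
  rw [← N_last hsym h M wd α ((lastIn_iff hirr).mp hx), st_succ]; rfl

theorem dN_some [Finite A] [Monoid S] {I : A → A → Prop} (hirr : ∀ a, ¬ I a a)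
    (hsym : ∀ a b, I a b → I b a) (h : List A → S) (M : DFA A σ) (wd : S → List A) {α : ℕ → A}
    {e : ℕ} {l : A × A} (hx : (dat I h M wd α e).1 l ≠ none) :
    ∃ x, LastIn I α e l x := by
  have e1 : (dat I h M wd α e).1 l = (st I h M wd α (e+1)).1 ({α e}, Set.univ) l := by
    rw [st_succ]; rfl
  rw [e1] at hx
  rcases N_sem hsym h M wd α (e+1) ({α e}, Set.univ) l with ⟨h1, _⟩ | ⟨i, h1, _⟩
  · exact absurd h1 hx
  · exact ⟨i, (lastIn_iff hirr).mpr h1⟩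

/-- the key cut lemma -/
theorem cut_lemma {I : A → A → Prop} (hirr : ∀ a, ¬ I a a) (hsym : ∀ a b, I a b → I b a)
    {α : ℕ → A} {Q1 Q2 : ℕ → Prop}
    (d1 : ∀ i j, tle I α i j → Q1 j → Q1 i) (d2 : ∀ i j, tle I α i j → Q2 j → Q2 i)
    {f f' : ℕ} (hmax : ∀ m, Q1 m → Q2 m → tle I α f m → m ≤ f)
    (hf' : ¬ Q1 f') (hf2 : Q2 f') (hdep : ¬ I (α f) (α f'))
    {m : ℕ} (hm : Q1 m) (hl : α m ∈ eset I (α f, α f')) : m ≤ f := by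
  have c1 : ¬ I (α m) (α f') := by
    rcases hl with hl | ⟨hl, _⟩
    · rw [hl]; exact hdep
    · rw [hl]; exact hirr _
  have c2 : ¬ I (α f) (α m) := by
    rcases hl with hl | ⟨hl, _⟩
    · rw [hl]; exact hirr _
    · rw [hl]; exact hdep
  by_contra hlt
  push Not at hlt
  rcases le_total m f' with h | h
  · exact absurd (hmax m hm (d2 _ _ (tle.of_dep h c1) hf2) (tle.of_dep hlt.le c2)) (by omega)
  · exact hf' (d1 _ _ (tle.of_dep h (fun hh => c1 (hsym _ _ hh))) hm)

theorem exists_max {P : ℕ → Prop} (hex : ∃ i, P i) {b : ℕ} (hb : ∀ i, P i → i ≤ b) :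
    ∃ f, P f ∧ ∀ m, P m → m ≤ f := by
  classical
  obtain ⟨i, hi⟩ := hex
  refine ⟨Nat.findGreatest P b, Nat.findGreatest_spec (hb i hi) hi, fun m hm => ?_⟩
  exact Nat.le_findGreatest (hb m hm) hm

theorem mem_eset_self {I : A → A → Prop} (a b : A) : a ∈ eset I (a, b) := Or.inl rfl

theorem lab_ne [Finite A] [Monoid S] {I : A → A → Prop} (hirr : ∀ a, ¬ I a a)
    (hsym : ∀ a b, I a b → I b a) (h : List A → S) (M : DFA A σ) (wd : S → List A) {α : ℕ → A}
    {e : ℕ} {l : A × A} {x y : ℕ} (hx : LastIn I α e l x) (hxy : x < y) (hl : α x = α y)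
    (he : ∀ m, tle I α m y → α m = α e → m ≤ e) : Lab I h M wd α x ≠ Lab I h M wd α y := by
  have hxy' : tle I α x y := tle.of_dep hxy.le (by rw [hl]; exact hirr _)
  have hye : ¬ tle I α y e := fun hh => by
    have := hx.2.2 y hh (hl ▸ hx.2.1); omega
  have key : ∃ k : A × A, IsLast I α y (dep I (α y), eset I k) l x := by
    by_cases hey : tle I α e y
    · refine ⟨(α e, α e), semB hsym |>.mpr ⟨e, hx.1, hey, ?_, mem_eset_self _ _⟩, hx.2.1, ?_⟩
      · rintro rfl; exact hye tle.rfl'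
      · intro j hj hjl
        obtain ⟨m, h1, h2, h3, h4⟩ := (semB hsym).mp hj
        have h5 : α m = α e := by rcases h4 with h | ⟨h, _⟩ <;> exact h
        refine hx.2.2 j (h1.tr (tle.of_dep (he m h2 h5) ?_)) hjl
        rw [h5]; exact hirr _
    · obtain ⟨f, ⟨f1, f2, f3⟩, fmax⟩ := exists_max (b := e)
        (P := fun f => tle I α x f ∧ tle I α f y ∧ tle I α f e)
        ⟨x, tle.rfl', hxy', hx.1⟩ (fun i hi => hi.2.2.le)
      rcases f3.first with rfl | ⟨f', hf1, hf2, hf3⟩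
      · exact absurd f2 hey
      refine ⟨(α f, α f'), semB hsym |>.mpr ⟨f, f1, f2, ?_, mem_eset_self _ _⟩, hx.2.1, ?_⟩
      · rintro rfl; exact hye f3
      · intro j hj hjl
        obtain ⟨m, h1, h2, h3, h4⟩ := (semB hsym).mp hj
        have hmf : m ≤ f := cut_lemma hirr hsym (Q1 := fun i => tle I α i y)
          (Q2 := fun i => tle I α i e) (fun i j a b => a.tr b) (fun i j a b => a.tr b)
          (fun m a b c => fmax m ⟨f1.tr c, a, b⟩)
          (fun hh => by
            have := fmax f' ⟨f1.tr (tle.of_dep hf1.le hf2), hh, hf3⟩; omega) hf3 hf2 h2 h4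
        refine hx.2.2 j ((h1.tr (tle.of_dep hmf ?_)).tr f3) hjl
        exact eset_clique hirr hsym h4 (mem_eset_self _ _)
  obtain ⟨k, hk⟩ := key
  have h1 := N_last hsym h M wd α hk
  have h2 := newlabel_spec I (st I h M wd α y).1 (α y) k l
  intro hc
  rw [h1, hl, hc] at h2
  exact h2 rfl





def Coh (I : A → A → Prop) (α : ℕ → A) (e : A → ℕ) (T : Finset A) : Prop :=
  (∀ b ∈ T, α (e b) = b) ∧ ∀ b ∈ T, ∀ c ∈ T, ∀ m, tle I α m (e b) → α m = c → m ≤ e c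

def JJ (I : A → A → Prop) (α : ℕ → A) (e : A → ℕ) (T : Finset A) (i : ℕ) : Prop :=
  ∃ b ∈ T, tle I α i (e b)

def KK (D : A → Dat A σ S) (T : Finset A) (c : A) : Set (A × A) :=
  {k | ∃ b ∈ T, ∃ l, (D b).1 l = (D c).1 k ∧ (D c).1 k ≠ none}

theorem cover [Finite A] [DecidableEq A] [Monoid S] {I : A → A → Prop} (hirr : ∀ a, ¬ I a a)
    (hsym : ∀ a b, I a b → I b a) (h : List A → S) (M : DFA A σ) (wd : S → List A) {α : ℕ → A}
    {e : A → ℕ} {T : Finset A} {c : A} (hc : Coh I α e (insert c T)) (i : ℕ) :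
    (tle I α i (e c) ∧ JJ I α e T i) ↔
      ∃ k ∈ KK (fun b => dat I h M wd α (e b)) T c,
        ∃ m, tle I α i m ∧ tle I α m (e c) ∧ α m ∈ eset I k := by
  have hcT : c ∈ insert c T := Finset.mem_insert_self _ _
  have hbT : ∀ {b}, b ∈ T → b ∈ insert c T := fun hb => Finset.mem_insert_of_mem hb
  constructor
  · rintro ⟨h1, h2⟩
    obtain ⟨f, ⟨f1, f2, b, hb, f3⟩, fmax⟩ := exists_max (b := e c)
      (P := fun f => tle I α i f ∧ tle I α f (e c) ∧ JJ I α e T f) ⟨i, tle.rfl', h1, h2⟩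
      (fun i hi => hi.2.1.le)
    suffices hk : ∃ k l, α f ∈ eset I k ∧ LastIn I α (e c) k f ∧ LastIn I α (e b) l f by
      obtain ⟨k, l, h3, h4, h5⟩ := hk
      refine ⟨k, ⟨b, hb, l, ?_, ?_⟩, f, f1, f2, h3⟩
      · simp only
        rw [dN_last hirr hsym h M wd h4, dN_last hirr hsym h M wd h5]
      · simp only
        rw [dN_last hirr hsym h M wd h4]; simp
    have same : ∀ d ∈ insert c T, f = e d → ∀ d' ∈ insert c T, tle I α f (e d') →
        LastIn I α (e d') (d, d) f := by
      intro d hd hfd d' hd' hh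
      refine ⟨hh, Or.inl (by rw [hfd]; exact hc.1 d hd), fun m hm hl => ?_⟩
      have : α m = d := by rcases hl with h | ⟨h, _⟩ <;> exact h
      rw [hfd]
      exact hc.2 d' hd' d hd m hm this
    by_cases e1 : f = e c
    · exact ⟨(c, c), (c, c), (same c hcT e1 c hcT f2).2.1, same c hcT e1 c hcT f2,
        same c hcT e1 b (hbT hb) f3⟩
    by_cases e2 : f = e b
    · exact ⟨(b, b), (b, b), (same b (hbT hb) e2 c hcT f2).2.1, same b (hbT hb) e2 c hcT f2,
        same b (hbT hb) e2 b (hbT hb) f3⟩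
    obtain ⟨f', a1, a2, a3⟩ := f3.first.resolve_left e2
    obtain ⟨f'', b1, b2, b3⟩ := f2.first.resolve_left e1
    have dJ : ∀ i j, tle I α i j → JJ I α e T j → JJ I α e T i :=
      fun i j h ⟨b, hb, h'⟩ => ⟨b, hb, h.tr h'⟩
    have hf' : ¬ tle I α f' (e c) := fun hh => by
      have := fmax f' ⟨f1.tr (tle.of_dep a1.le a2), hh, b, hb, a3⟩; omega
    have hf'' : ¬ JJ I α e T f'' := fun hh => by
      have := fmax f'' ⟨f1.tr (tle.of_dep b1.le b2), b3, hh⟩; omega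
    refine ⟨(α f, α f'), (α f, α f''), mem_eset_self _ _, ⟨f2, mem_eset_self _ _, fun m hm hl => ?_⟩,
      ⟨f3, mem_eset_self _ _, fun m hm hl => ?_⟩⟩
    · exact cut_lemma hirr hsym (Q1 := fun i => tle I α i (e c)) (Q2 := JJ I α e T)
        (fun i j a b => a.tr b) dJ (fun m a b c => fmax m ⟨f1.tr c, a, b⟩) hf' ⟨b, hb, a3⟩ a2 hm hl
    · exact cut_lemma hirr hsym (Q2 := fun i => tle I α i (e c)) (Q1 := JJ I α e T)
        dJ (fun i j a b => a.tr b) (fun m a b c => fmax m ⟨f1.tr c, b, a⟩) hf'' b3 b2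
        ⟨b, hb, hm⟩ hl
  · rintro ⟨k, ⟨b, hb, l, hl, hne⟩, m, h1, h2, h3⟩
    refine ⟨h1.tr h2, ?_⟩
    simp only at hl hne
    obtain ⟨x, hx⟩ := dN_some hirr hsym h M wd hne
    obtain ⟨y, hy⟩ := dN_some hirr hsym h M wd (hl ▸ hne)
    rw [dN_last hirr hsym h M wd hx, dN_last hirr hsym h M wd hy] at hl
    simp only [Option.some.injEq, Prod.mk.injEq] at hl
    have hxy : x = y := by
      rcases lt_trichotomy x y with hlt | heq | hlt
      · refine absurd hl.2.symm (lab_ne hirr hsym h M wd hx hlt hl.1.symm fun m hm hme => ?_)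
        exact hc.2 b (hbT hb) c hcT m (hm.tr hy.1) (hme.trans (hc.1 c hcT))
      · exact heq
      · refine absurd hl.2 (lab_ne hirr hsym h M wd hy hlt hl.1 fun m hm hme => ?_)
        exact hc.2 c hcT b (hbT hb) m (hm.tr hx.1) (hme.trans (hc.1 b (hbT hb)))
    subst hxy
    refine ⟨b, hb, (h1.tr (tle.of_dep (hx.2.2 m h2 h3) ?_)).tr hy.1⟩
    exact eset_clique hirr hsym h3 hx.2.1

theorem W_JJ [Finite A] [DecidableEq A] [Monoid S] {I : A → A → Prop} (hirr : ∀ a, ¬ I a a)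
    (hsym : ∀ a b, I a b → I b a) {h : List A → S} (hh : IsHom h)
    (ht : ∀ u v, TrEq I u v → h u = h v) (M : DFA A σ) (wd : S → List A) {α : ℕ → A}
    {e : A → ℕ} {T : Finset A} {c : A} (hc : Coh I α e (insert c T)) {n : ℕ} (hn : e c < n) :
    h (W α (JJ I α e (insert c T)) n) = h (W α (JJ I α e T) n) *
      (dat I h M wd α (e c)).2.1 (KK (fun b => dat I h M wd α (e b)) T c) := by
  have e1 : W α (JJ I α e (insert c T)) n =
      W α (fun i => JJ I α e T i ∨ (tle I α i (e c) ∧ ¬ JJ I α e T i)) n := by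
    refine W_congr fun i _ => ?_
    constructor
    · rintro ⟨b, hb, hi⟩
      rcases Finset.mem_insert.mp hb with rfl | hb
      · by_cases hj : JJ I α e T i
        · exact Or.inl hj
        · exact Or.inr ⟨hi, hj⟩
      · exact Or.inl ⟨b, hb, hi⟩
    · rintro (⟨b, hb, hi⟩ | ⟨hi, _⟩)
      · exact ⟨b, Finset.mem_insert_of_mem hb, hi⟩
      · exact ⟨c, Finset.mem_insert_self _ _, hi⟩
  have e2 : TrEq I (W α (fun i => JJ I α e T i ∨ (tle I α i (e c) ∧ ¬ JJ I α e T i)) n)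
      (W α (JJ I α e T) n ++ W α (fun i => tle I α i (e c) ∧ ¬ JJ I α e T i) n) := by
    refine W_split (fun i hi hi' => hi'.2 hi) (fun i j hij hi hj => ?_) n
    by_contra hI
    obtain ⟨b, hb, hj⟩ := hj
    exact hi.2 ⟨b, hb, (tle.of_dep hij.le hI).tr hj⟩
  rw [e1, ht _ _ e2, hh.2]
  congr 1
  have hαc : α (e c) = c := hc.1 c (Finset.mem_insert_self _ _)
  have e3 : (dat I h M wd α (e c)).2.1 (KK (fun b => dat I h M wd α (e b)) T c) =
      (st I h M wd α (e c + 1)).2.1 ({α (e c)}, Set.univ)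
      ((fun k => (({α (e c)} : Set A), eset I k)) '' (KK (fun b => dat I h M wd α (e b)) T c)) := by
    rw [st_succ]; rfl
  rw [e3, H_sem hsym hh, W_stable (n := e c + 1) (fun i hi => Nat.lt_succ_of_le hi.1.le) hn]
  congr 1
  refine W_congr fun i _ => ?_
  simp only [Set.forall_mem_image, semA' hirr, semA hirr]
  have := cover hirr hsym h M wd hc i
  constructor
  · rintro ⟨h1, h2⟩
    refine ⟨h1, fun k hk hex => h2 (this.mpr ⟨k, hk, hex⟩).2⟩
  · rintro ⟨h1, h2⟩
    refine ⟨h1, fun hJ => ?_⟩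
    obtain ⟨k, hk, hex⟩ := this.mp ⟨h1, hJ⟩
    exact h2 hk hex

/-- finite part theorem -/
theorem FC [Finite A] [Monoid S] {I : A → A → Prop} (hirr : ∀ a, ¬ I a a)
    (hsym : ∀ a b, I a b → I b a) {h : List A → S} (hh : IsHom h)
    (ht : ∀ u v, TrEq I u v → h u = h v) (M : DFA A σ) (wd : S → List A) {α α' : ℕ → A}
    {e e' : A → ℕ} {T : Finset A} (hc : Coh I α e T) (hc' : Coh I α' e' T)
    (hd : ∀ b ∈ T, dat I h M wd α (e b) = dat I h M wd α' (e' b)) {n n' : ℕ}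
    (hn : ∀ b ∈ T, e b < n) (hn' : ∀ b ∈ T, e' b < n') :
    h (W α (JJ I α e T) n) = h (W α' (JJ I α' e' T) n') := by
  classical
  induction T using Finset.induction_on with
  | empty =>
    have : ∀ (α : ℕ → A) e n, W α (JJ I α e ∅) n = [] := fun α e n => by
      rw [← W_false α n]; exact W_congr fun i _ => by simp [JJ]
    rw [this, this]
  | insert c T hcT ih =>
    rw [W_JJ hirr hsym hh ht M wd hc (hn c (Finset.mem_insert_self _ _)),
      W_JJ hirr hsym hh ht M wd hc' (hn' c (Finset.mem_insert_self _ _))]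
    have m : ∀ {b}, b ∈ T → b ∈ insert c T := fun hb => Finset.mem_insert_of_mem hb
    rw [ih ⟨fun b hb => hc.1 b (m hb), fun b hb d hd => hc.2 b (m hb) d (m hd)⟩
      ⟨fun b hb => hc'.1 b (m hb), fun b hb d hd => hc'.2 b (m hb) d (m hd)⟩
      (fun b hb => hd b (m hb)) (fun b hb => hn b (m hb)) (fun b hb => hn' b (m hb))]
    congr 1
    rw [hd c (Finset.mem_insert_self _ _)]
    refine congrArg _ (Set.ext fun k => ?_)
    constructor
    · rintro ⟨b, hb, l, h1, h2⟩
      exact ⟨b, hb, l, by simp only; rw [← hd b (m hb), ← hd c (Finset.mem_insert_self _ _)]; exact h1,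
        by simp only; rw [← hd c (Finset.mem_insert_self _ _)]; exact h2⟩
    · rintro ⟨b, hb, l, h1, h2⟩
      exact ⟨b, hb, l, by simp only; rw [hd b (m hb), hd c (Finset.mem_insert_self _ _)]; exact h1,
        by simp only; rw [hd c (Finset.mem_insert_self _ _)]; exact h2⟩





/-! ## Part 8a: product chains -/

def cn (z : List A) (f : ℕ → List A) : ℕ → List A
  | 0 => z
  | j+1 => f j

theorem cc_cn (z : List A) (f : ℕ → List A) (n : ℕ) : cc (cn z f) (n+1) = z ++ cc f n := by
  induction n with
  | zero => simp [cc, cn]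
  | succ n ih => rw [cc, ih, cn, cc, List.append_assoc]

theorem mem_cc {f : ℕ → List A} {n : ℕ} {a : A} : a ∈ cc f n ↔ ∃ j < n, a ∈ f j := by
  induction n with
  | zero => simp [cc]
  | succ n ih =>
    rw [cc, List.mem_append, ih]
    constructor
    · rintro (⟨j, h1, h2⟩ | h)
      · exact ⟨j, by omega, h2⟩
      · exact ⟨n, by omega, h⟩
    · rintro ⟨j, h1, h2⟩
      rcases (Nat.lt_succ_iff.mp h1).eq_or_lt with rfl | h
      · exact Or.inr h2
      · exact Or.inl ⟨j, h, h2⟩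

def Ind (I : A → A → Prop) (u v : List A) : Prop := ∀ a ∈ u, ∀ b ∈ v, I a b

theorem Ind.comm {I : A → A → Prop} {u v : List A} (h : Ind I u v) :
    TrEq I (u ++ v) (v ++ u) := TrEq.comm h

theorem cc_mix {I : A → A → Prop} {ρ κ : ℕ → List A} (n : ℕ)
    (h : ∀ i j, i < n → j < n → Ind I (κ i) (ρ j)) :
    TrEq I (cc (fun j => ρ j ++ κ j) n) (cc ρ n ++ cc κ n) := by
  induction n with
  | zero => exact TrEq.rfl'
  | succ n ih =>
    rw [cc, cc, cc]
    refine ((ih (fun i j hi hj => h i j (by omega) (by omega))).app TrEq.rfl').tr ?_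
    have h1 : TrEq I (cc κ n ++ ρ n) (ρ n ++ cc κ n) := Ind.comm (fun a ha b hb => by
      obtain ⟨j, hj, ha⟩ := mem_cc.mp ha
      exact h j n (by omega) (by omega) a ha b hb)
    have := h1.ctx (cc ρ n) (κ n)
    simpa [List.append_assoc] using this

theorem inL_nf {I : A → A → Prop} {L : Set (ℕ → A)} {z z' : List A} {ρ κ ρ' κ' : ℕ → List A}
    (h : ∀ i j, Ind I (κ i) (ρ j)) (h' : ∀ i j, Ind I (κ' i) (ρ' j))
    (h1 : ∀ n, ∃ m, TrPre I (z ++ (cc ρ n ++ cc κ n)) (z' ++ (cc ρ' m ++ cc κ' m)))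
    (h2 : ∀ n, ∃ m, TrPre I (z' ++ (cc ρ' n ++ cc κ' n)) (z ++ (cc ρ m ++ cc κ m))) :
    InL I L (cn z (fun j => ρ j ++ κ j)) ↔ InL I L (cn z' (fun j => ρ' j ++ κ' j)) := by
  have key : ∀ {z z' : List A} {ρ κ ρ' κ' : ℕ → List A},
    (∀ i j, Ind I (κ i) (ρ j)) → (∀ i j, Ind I (κ' i) (ρ' j)) →
    (∀ n, ∃ m, TrPre I (z ++ (cc ρ n ++ cc κ n)) (z' ++ (cc ρ' m ++ cc κ' m))) →
    ∀ n, ∃ m, TrPre I (cc (cn z (fun j => ρ j ++ κ j)) n) (cc (cn z' (fun j => ρ' j ++ κ' j)) m) := by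
    intro z z' ρ κ ρ' κ' h h' h1 n
    rcases n with _ | n
    · exact ⟨0, TrPre.rfl'⟩
    · obtain ⟨m, hm⟩ := h1 n
      refine ⟨m+1, ?_⟩
      rw [cc_cn, cc_cn]
      have a1 := (cc_mix (ρ := ρ) (κ := κ) n (fun i j _ _ => h i j))
      have a2 := (cc_mix (ρ := ρ') (κ := κ') m (fun i j _ _ => h' i j))
      exact ((TrEq.rfl'.app a1).pre.tr hm).tr (TrEq.rfl'.app a2.sym).pre
  exact inL_cof (key h h' h1) (key h' h h2)

theorem TrPre.prod {I : A → A → Prop} {u u' v v' : List A} (h1 : TrPre I u u') (h2 : TrPre I v v')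
    (h : Ind I v' u') : TrPre I (u ++ v) (u' ++ v') := by
  obtain ⟨w, hw⟩ := h1
  obtain ⟨w', hw'⟩ := h2
  refine ⟨w ++ w', ?_⟩
  have c : TrEq I (v ++ w) (w ++ v) := Ind.comm (fun a ha b hb =>
    h a (hw'.perm.mem_iff.mp (List.mem_append_left _ ha)) b
      (hw.perm.mem_iff.mp (List.mem_append_right _ hb)))
  have := (c.ctx u w').tr (TrEq.of_eq (I := I) (show u ++ (w ++ v) ++ w' = (u ++ w) ++ (v ++ w') by
    simp [List.append_assoc]))
  simpa [List.append_assoc] using this.tr (hw.app hw')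

theorem TrPre.ctxl {I : A → A → Prop} {u v : List A} (h : TrPre I u v) (z : List A) :
    TrPre I (z ++ u) (z ++ v) := by
  obtain ⟨w, hw⟩ := h
  exact ⟨w, by rw [List.append_assoc]; exact TrEq.rfl'.app hw⟩

def Cof (I : A → A → Prop) (f g : ℕ → List A) : Prop := ∀ n, ∃ m, TrPre I (cc f n) (cc g m)

theorem Cof.up {I : A → A → Prop} {f g : ℕ → List A} (h : Cof I f g) (n : ℕ) :
    ∃ m, ∀ m' ≥ m, TrPre I (cc f n) (cc g m') := by
  obtain ⟨m, hm⟩ := h n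
  exact ⟨m, fun m' h' => hm.tr (TrPre.of_prefix (cc_prefix g h'))⟩

theorem ind_cc {I : A → A → Prop} {f g : ℕ → List A} (h : ∀ i j, Ind I (f i) (g j)) (n m : ℕ) :
    Ind I (cc f n) (cc g m) := fun a ha b hb => by
  obtain ⟨i, _, ha⟩ := mem_cc.mp ha
  obtain ⟨j, _, hb⟩ := mem_cc.mp hb
  exact h i j a ha b hb

theorem cof_prod {I : A → A → Prop} {ρ κ ρ' κ' : ℕ → List A} (z : List A)
    (h' : ∀ i j, Ind I (κ' i) (ρ' j)) (h1 : Cof I ρ ρ') (h2 : Cof I κ κ') (n : ℕ) :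
    ∃ m, TrPre I (z ++ (cc ρ n ++ cc κ n)) (z ++ (cc ρ' m ++ cc κ' m)) := by
  obtain ⟨m1, h1⟩ := h1.up n
  obtain ⟨m2, h2⟩ := h2.up n
  refine ⟨max m1 m2, TrPre.ctxl (TrPre.prod (h1 _ (le_max_left _ _)) (h2 _ (le_max_right _ _))
    (ind_cc h' _ _)) z⟩

theorem hom_cc [Monoid S] {h : List A → S} (hh : IsHom h) {f g : ℕ → List A}
    (hfg : ∀ j, h (f j) = h (g j)) (n : ℕ) : h (cc f n) = h (cc g n) := by
  induction n with
  | zero => rfl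
  | succ n ih => rw [cc, cc, hh.2, hh.2, ih, hfg]

/-- the step lemma -/
theorem stepL [Finite S] [Monoid S] {I : A → A → Prop} (hsym : ∀ a b, I a b → I b a)
    {L : Set (ℕ → A)} {h : List A → S} (hh : IsHom h)
    (ht : ∀ u v, TrEq I u v → h u = h v)
    (hS : ∀ f g : ℕ → List A, InfNE f → (∀ n, h (f n) = h (g n)) → (InL I L f ↔ InL I L g))
    {wd : S → List A} (hwd : ∀ s, h (wd s) = s) {C : Set A} {U w0 r : List A} {y : ℕ → List A}
    {k : ℕ} (hU : TrEq I U (w0 ++ cc y k ++ r)) (hy : ∀ j < k, ∀ b ∈ y j, b ∈ C)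
    (hr : ∀ a ∈ r, ∀ c ∈ C, I a c) {ρ : ℕ → List A} (hρ : ∀ j, ∀ a ∈ ρ j, ∀ c ∈ C, I a c) :
    ∃ x E, ∀ Y κ : ℕ → List A, (∀ j, (∀ b ∈ Y j, b ∈ C) ∧ Y j ≠ []) → (∀ j, ∀ b ∈ κ j, b ∈ C) →
      Cof I κ Y → Cof I Y κ →
      (InL I L (cn U (fun j => ρ j ++ κ j)) ↔
        InL I L (cn (wd x ++ cc (fun j => wd (h (y j)) ++ wd E) k)
          (fun j => wd (h (Y j)) ++ wd E))) := by
  obtain ⟨n, E, hn, hE⟩ := ramsey (fun i j => h (chunk ρ i j))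
  let ρ0 := cc ρ (n 0)
  let f := fun j => chunk ρ (n j) (n (j+1))
  have hE' : ∀ j, h (f j) = E := hE
  have ccf : ∀ j, cc ρ (n j) = ρ0 ++ cc f j := by
    intro j
    induction j with
    | zero => simp [ρ0, cc]
    | succ j ih =>
      rw [cc, ← List.append_assoc, ← ih, ← cc_chunk ρ (hn (Nat.lt_succ_self j)).le]
  have hρcc : ∀ m, ∀ a ∈ cc ρ m, ∀ c ∈ C, I a c := fun m a ha c hc => by
    obtain ⟨j, _, ha⟩ := mem_cc.mp ha
    exact hρ j a ha c hc
  have hρ0 : ∀ a ∈ ρ0, ∀ c ∈ C, I a c := hρcc _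
  have hf : ∀ j, ∀ a ∈ f j, ∀ c ∈ C, I a c := fun j a ha => by
    refine hρcc (n (j+1)) a ?_
    rw [ccf, cc]
    simp [ha]
  refine ⟨h (w0 ++ r ++ ρ0), E, fun Y κ hY hκ c1 c2 => ?_⟩
  have i1 : ∀ i j, Ind I (κ i) (ρ j) := fun i j a ha b hb => hsym _ _ (hρ j b hb a (hκ i a ha))
  have i2 : ∀ i j, Ind I (Y i) (f j) := fun i j a ha b hb => hsym _ _ (hf j b hb a ((hY i).1 a ha))
  have i2' : ∀ i j, Ind I (Y i) (ρ j) := fun i j a ha b hb =>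
    hsym _ _ (hρ j b hb a ((hY i).1 a ha))
  have i3 : ∀ i j : ℕ, Ind I (Y i) ((fun _ => f 0) j) := fun i j => i2 i 0
  have s1 : InL I L (cn U (fun j => ρ j ++ κ j)) ↔ InL I L (cn (U ++ ρ0) (fun j => f j ++ Y j)) := by
    refine inL_nf i1 i2 (fun m => ?_) (fun m => ?_)
    · obtain ⟨m1, h1⟩ := c1.up m
      refine ⟨max m m1, ?_⟩
      rw [List.append_assoc, ← List.append_assoc ρ0, ← ccf]
      refine TrPre.ctxl (TrPre.prod (TrPre.of_prefix (cc_prefix ρ ?_)) (h1 _ (le_max_right _ _))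
        (ind_cc i2' _ _)) _
      exact (le_max_left m m1).trans (hn.le_apply)
    · obtain ⟨m1, h1⟩ := c2.up m
      refine ⟨max (n m) m1, ?_⟩
      rw [List.append_assoc, ← List.append_assoc ρ0, ← ccf]
      exact TrPre.ctxl (TrPre.prod (TrPre.of_prefix (cc_prefix ρ (le_max_left _ _)))
        (h1 _ (le_max_right _ _)) (ind_cc i1 _ _)) _
  have s2 : InL I L (cn (U ++ ρ0) (fun j => f j ++ Y j)) ↔
      InL I L (cn (U ++ ρ0) (fun j => f 0 ++ Y j)) := by
    refine hS _ _ (fun N => ⟨N+1, by omega, ?_⟩) ?_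
    · simp [cn, (hY N).2]
    · rintro (_ | j)
      · rfl
      · simp only [cn, hh.2, hE']
  have hz : TrEq I (w0 ++ r ++ ρ0 ++ cc (fun j => f 0 ++ y j) k)
      (U ++ ρ0 ++ cc (fun _ => f 0) k) := by
    have a1 : TrEq I (cc (fun j => f 0 ++ y j) k) (cc (fun _ => f 0) k ++ cc y k) := by
      refine cc_mix (ρ := fun _ => f 0) (κ := y) k ?_
      intro i j hi _ a ha b hb
      exact hsym _ _ (hf 0 b hb a (hy i hi a ha))
    have a2 : TrEq I ((r ++ ρ0 ++ cc (fun _ => f 0) k) ++ cc y k)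
        (cc y k ++ (r ++ ρ0 ++ cc (fun _ => f 0) k)) := by
      refine Ind.comm (fun a ha b hb => ?_)
      obtain ⟨j, hj, hb⟩ := mem_cc.mp hb
      have hb := hy j hj b hb
      rcases List.mem_append.mp ha with ha | ha
      · rcases List.mem_append.mp ha with ha | ha
        · exact hr a ha b hb
        · exact hρ0 a ha b hb
      · obtain ⟨j, _, ha⟩ := mem_cc.mp ha
        exact hf 0 a ha b hb
    have a3 := (TrEq.rfl' (I := I) (u := w0 ++ r ++ ρ0)).app a1
    have a4 := (TrEq.rfl' (I := I) (u := w0)).app a2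
    have a5 := hU.sym.app (TrEq.rfl' (I := I) (u := ρ0 ++ cc (fun _ => f 0) k))
    simp only [List.append_assoc] at a3 a4 a5 ⊢
    exact (a3.tr a4).tr a5
  have s3 : InL I L (cn (U ++ ρ0) (fun j => f 0 ++ Y j)) ↔
      InL I L (cn (w0 ++ r ++ ρ0 ++ cc (fun j => f 0 ++ y j) k) (fun j => f 0 ++ Y j)) := by
    have e1 : ∀ m, TrEq I (w0 ++ r ++ ρ0 ++ cc (fun j => f 0 ++ y j) k ++
        (cc (fun _ => f 0) m ++ cc Y m)) (U ++ ρ0 ++ (cc (fun _ => f 0) (k + m) ++ cc Y m)) := by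
      intro m
      have := hz.app (TrEq.rfl' (I := I) (u := cc (fun _ => f 0) m ++ cc Y m))
      rw [cc_add]
      simpa only [List.append_assoc] using this
    refine inL_nf (ρ := fun _ => f 0) (ρ' := fun _ => f 0) i3 i3 (fun m => ⟨m, ?_⟩)
      (fun m => ⟨k + m, ?_⟩)
    · refine TrPre.tr ?_ (e1 m).sym.pre
      exact TrPre.ctxl (TrPre.prod (TrPre.of_prefix (cc_prefix _ (by omega))) TrPre.rfl'
        (ind_cc i3 _ _)) _
    · refine (e1 m).pre.tr ?_
      exact TrPre.ctxl (TrPre.prod TrPre.rfl' (TrPre.of_prefix (cc_prefix _ (by omega)))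
        (ind_cc i3 _ _)) _
  have hswap : ∀ w : List A, (∀ b ∈ w, b ∈ C) → h (f 0 ++ w) = h (wd (h w) ++ wd E) := by
    intro w hw
    rw [ht _ _ (Ind.comm (I := I) (u := f 0) (v := w) (fun a ha b hb => hf 0 a ha b (hw b hb))),
      hh.2, hh.2, hwd, hwd, hE']
  have s4 : InL I L (cn (w0 ++ r ++ ρ0 ++ cc (fun j => f 0 ++ y j) k) (fun j => f 0 ++ Y j)) ↔
      InL I L (cn (wd (h (w0 ++ r ++ ρ0)) ++ cc (fun j => wd (h (y j)) ++ wd E) k)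
          (fun j => wd (h (Y j)) ++ wd E)) := by
    refine hS _ _ (fun N => ⟨N+1, by omega, ?_⟩) ?_
    · simp [cn, (hY N).2]
    · rintro (_ | j)
      · simp only [cn]
        rw [hh.2 (w0 ++ r ++ ρ0), hh.2 (wd _), hwd]
        congr 1
        have : ∀ m ≤ k, h (cc (fun j => f 0 ++ y j) m) =
            h (cc (fun j => wd (h (y j)) ++ wd E) m) := by
          intro m hm
          induction m with
          | zero => rfl
          | succ m ih => rw [cc, cc, hh.2, ih (by omega), hh.2 (cc _ m), hswap _ (hy m (by omega))]
        exact this k le_rfl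
      · simp only [cn]
        exact hswap _ (hY j).1
  exact s1.trans (s2.trans (s3.trans s4))





/-! ## Part 8b: structure of a single word -/

structure RepOK (I : A → A → Prop) (B : Set A) (rep : A → A) : Prop where
  dep : ∀ b ∈ B, ∀ c ∈ B, ¬ I b c → rep b = rep c
  mem : ∀ b ∈ B, rep b ∈ B
  path : ∀ b ∈ B, EqvGen (fun b c => b ∈ B ∧ c ∈ B ∧ ¬ I b c) b (rep b)
  idem : ∀ b ∈ B, rep (rep b) = rep b

structure Good (I : A → A → Prop) (α : ℕ → A) (B : Set A) (rep : A → A) (n0 : ℕ) (e : A → ℕ)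
    (T : Finset A) : Prop where
  rk : RepOK I B rep
  inf : ∀ b ∈ B, ∀ N, ∃ n ≥ N, α n = b
  tail : ∀ j, n0 ≤ j → α j ∈ B
  memT : ∀ b, b ∈ T ↔ (b ∈ B ∧ rep b = b) ∨ (b ∉ B ∧ ∃ i, α i = b)
  g1 : ∀ b ∈ T, α (e b) = b
  g2 : ∀ b, b ∉ B → ∀ m, α m = b → m ≤ e b
  g3 : ∀ a ∈ B, rep a = a → n0 ≤ e a
  g4 : ∀ a ∈ B, rep a = a → ∀ i < n0, ∀ j, α j = a → tle I α i j → tle I α i (e a)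

theorem path_up {I : A → A → Prop} (hsym : ∀ a b, I a b → I b a) {α : ℕ → A} {B : Set A}
    (hinf : ∀ b ∈ B, ∀ N, ∃ n ≥ N, α n = b) {b c : A}
    (h : EqvGen (fun b c => b ∈ B ∧ c ∈ B ∧ ¬ I b c) b c) :
    (∀ i, α i = b → ∃ j, α j = c ∧ tle I α i j) ∧ (∀ i, α i = c → ∃ j, α j = b ∧ tle I α i j) := by
  induction h with
  | rel b c h =>
    obtain ⟨hb, hc, hd⟩ := h
    constructor
    · intro i hi
      obtain ⟨j, hj, hjc⟩ := hinf c hc i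
      exact ⟨j, hjc, tle.of_dep hj (by rw [hi, hjc]; exact hd)⟩
    · intro i hi
      obtain ⟨j, hj, hjc⟩ := hinf b hb i
      exact ⟨j, hjc, tle.of_dep hj (by rw [hi, hjc]; exact fun h => hd (hsym _ _ h))⟩
  | refl b => exact ⟨fun i hi => ⟨i, hi, tle.rfl'⟩, fun i hi => ⟨i, hi, tle.rfl'⟩⟩
  | symm b c _ ih => exact ⟨ih.2, ih.1⟩
  | trans b c d _ _ ih1 ih2 =>
    constructor
    · intro i hi
      obtain ⟨j, h1, h2⟩ := ih1.1 i hi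
      obtain ⟨k, h3, h4⟩ := ih2.1 j h1
      exact ⟨k, h3, h2.tr h4⟩
    · intro i hi
      obtain ⟨j, h1, h2⟩ := ih2.2 i hi
      obtain ⟨k, h3, h4⟩ := ih1.2 j h1
      exact ⟨k, h3, h2.tr h4⟩

namespace Good
variable {I : A → A → Prop} {α : ℕ → A} {B : Set A} {rep : A → A} {n0 : ℕ} {e : A → ℕ}
    {T : Finset A}

theorem up (G : Good I α B rep n0 e T) (hsym : ∀ a b, I a b → I b a) {i : ℕ} (hi : α i ∈ B) :
    ∃ j, α j = rep (α i) ∧ tle I α i j :=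
  (path_up hsym G.inf (G.rk.path _ hi)).1 i rfl

theorem chain (G : Good I α B rep n0 e T) {m j : ℕ} (hm : n0 ≤ m) (h : tle I α m j) :
    rep (α m) = rep (α j) := by
  induction h with
  | refl => rfl
  | tail h1 h2 ih =>
    rw [ih]
    have := tle.le h1
    exact G.rk.dep _ (G.tail _ (by omega)) _ (G.tail _ (by omega)) h2.2

theorem repT (G : Good I α B rep n0 e T) {b : A} (hb : b ∈ B) : rep b ∈ T :=
  (G.memT _).mpr (Or.inl ⟨G.rk.mem b hb, G.rk.idem b hb⟩)

theorem small (G : Good I α B rep n0 e T) (hirr : ∀ a, ¬ I a a) (hsym : ∀ a b, I a b → I b a)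
    {i : ℕ} (hi : i < n0) : JJ I α e T i := by
  by_cases hB : α i ∈ B
  · obtain ⟨j, h1, h2⟩ := G.up hsym hB
    exact ⟨_, G.repT hB, G.g4 _ (G.rk.mem _ hB) (G.rk.idem _ hB) i hi j h1 h2⟩
  · have hT : α i ∈ T := (G.memT _).mpr (Or.inr ⟨hB, i, rfl⟩)
    exact ⟨_, hT, tle.of_dep (G.g2 _ hB i rfl) (by rw [G.g1 _ hT]; exact hirr _)⟩

theorem coh (G : Good I α B rep n0 e T) : Coh I α e T := by
  refine ⟨G.g1, fun b hb c hc m hm hmc => ?_⟩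
  rcases (G.memT c).mp hc with ⟨h1, h2⟩ | ⟨h1, _⟩
  · rcases lt_or_ge m n0 with h | h
    · have := G.g3 c h1 h2; omega
    · have hbB : b ∈ B := by rw [← G.g1 b hb]; exact G.tail _ (h.trans hm.le)
      have hrb : rep b = b := by
        rcases (G.memT b).mp hb with ⟨_, h⟩ | ⟨h, _⟩
        · exact h
        · exact absurd hbB h
      have := G.chain h hm
      rw [hmc, G.g1 b hb, h2, hrb] at this
      rw [this]; exact hm.le
  · exact G.g2 c h1 m hmc

theorem big (G : Good I α B rep n0 e T) {i : ℕ} (hi : n0 ≤ i) :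
    JJ I α e T i ↔ tle I α i (e (rep (α i))) := by
  constructor
  · rintro ⟨b, hb, hib⟩
    have hbB : b ∈ B := by rw [← G.g1 b hb]; exact G.tail _ (hi.trans hib.le)
    have hrb : rep b = b := by
      rcases (G.memT b).mp hb with ⟨_, h⟩ | ⟨h, _⟩
      · exact h
      · exact absurd hbB h
    have := G.chain hi hib
    rw [G.g1 b hb, hrb] at this
    rw [this]; exact hib
  · intro h
    exact ⟨_, G.repT (G.tail _ hi), h⟩

/-- anything below an `a`-event outside the cone is in the tail -/
theorem outside (G : Good I α B rep n0 e T) {a : A} (ha : a ∈ B) (hr : rep a = a) {i j : ℕ}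
    (hj : α j = a) (hij : tle I α i j) (hn : ¬ tle I α i (e a)) :
    n0 ≤ i ∧ rep (α i) = a ∧ ¬ JJ I α e T i := by
  have h0 : n0 ≤ i := by
    by_contra hc
    exact hn (G.g4 a ha hr i (by omega) j hj hij)
  have h1 : rep (α i) = a := by rw [G.chain h0 hij, hj, hr]
  exact ⟨h0, h1, fun hJ => hn (by have := (G.big h0).mp hJ; rwa [h1] at this)⟩

theorem indep (G : Good I α B rep n0 e T) (hsym : ∀ a b, I a b → I b a) {a : A} (ha : a ∈ B)
    (hr : rep a = a) {i : ℕ} (hi : JJ I α e T i) (hn : ¬ tle I α i (e a)) {c : A} (hc : c ∈ B)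
    (hca : rep c = a) : I (α i) c := by
  by_contra hI
  obtain ⟨j, hj, hjc⟩ := G.inf c hc i
  obtain ⟨k, hk1, hk2⟩ := G.up hsym (i := j) (by rw [hjc]; exact hc)
  rw [hjc, hca] at hk1
  exact (G.outside ha hr hk1 ((tle.of_dep hj (by rw [hjc]; exact hI)).tr hk2) hn).2.2 hi

end Good

/-- enumeration of events of a letter -/
structure Enum (α : ℕ → A) (a : A) (ev : ℕ → ℕ) : Prop where
  mono : StrictMono ev
  val : ∀ j, α (ev j) = a
  surj : ∀ i, α i = a → ∃ j, ev j = i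

theorem exists_enum {α : ℕ → A} {a : A} (h : ∀ N, ∃ n ≥ N, α n = a) : ∃ ev, Enum α a ev := by
  have hinf : {i | α i = a}.Infinite := by
    rw [Set.infinite_iff_exists_gt]
    intro N
    obtain ⟨n, hn, hna⟩ := h (N+1)
    exact ⟨n, hna, hn⟩
  classical
  refine ⟨Nat.nth (fun i => α i = a), Nat.nth_strictMono hinf, fun j => Nat.nth_mem_of_infinite hinf j,
    fun i hi => ⟨Nat.count (fun i => α i = a) i, Nat.nth_count (p := fun i => α i = a) hi⟩⟩

def Dn (I : A → A → Prop) (α : ℕ → A) (ev : ℕ → ℕ) (m : ℕ) (i : ℕ) : Prop :=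
  ∃ j < m, tle I α i (ev j)

noncomputable def yy (I : A → A → Prop) (α : ℕ → A) (ev : ℕ → ℕ) (m : ℕ) : List A :=
  W α (fun i => Dn I α ev (m+1) i ∧ ¬ Dn I α ev m i) (ev m + 1)

theorem Dn.mono {I : A → A → Prop} {α : ℕ → A} {ev : ℕ → ℕ} {m m' i : ℕ} (h : m ≤ m')
    (hi : Dn I α ev m i) : Dn I α ev m' i := by
  obtain ⟨j, hj, hi⟩ := hi; exact ⟨j, by omega, hi⟩

theorem Dn.down {I : A → A → Prop} {α : ℕ → A} {ev : ℕ → ℕ} {m i i' : ℕ} (h : tle I α i i')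
    (hi : Dn I α ev m i') : Dn I α ev m i := by
  obtain ⟨j, hj, hi⟩ := hi; exact ⟨j, hj, h.tr hi⟩

theorem Enum.tle {I : A → A → Prop} (hirr : ∀ a, ¬ I a a) {α : ℕ → A} {a : A} {ev : ℕ → ℕ}
    (E : Enum α a ev) {i j : ℕ} (h : i ≤ j) : tle I α (ev i) (ev j) :=
  tle.of_dep (E.mono.monotone h) (by rw [E.val, E.val]; exact hirr _)

theorem Enum.Dn_succ {I : A → A → Prop} (hirr : ∀ a, ¬ I a a) {α : ℕ → A} {a : A} {ev : ℕ → ℕ}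
    (E : Enum α a ev) {m i : ℕ} : Dn I α ev (m+1) i ↔ _root_.tle I α i (ev m) := by
  constructor
  · rintro ⟨j, hj, hi⟩
    exact hi.tr (E.tle hirr (by omega))
  · intro h
    exact ⟨m, by omega, h⟩

theorem Dn.lt {I : A → A → Prop} {α : ℕ → A} {ev : ℕ → ℕ} (hm : StrictMono ev) {m i : ℕ}
    (hi : Dn I α ev (m+1) i) : i < ev m + 1 := by
  obtain ⟨j, hj, hi⟩ := hi
  have := hi.le
  have := hm.monotone (show j ≤ m by omega)
  omega

/-- differences of cones compose -/
theorem cc_yy {I : A → A → Prop} {α : ℕ → A} {ev : ℕ → ℕ} (hm : StrictMono ev) (N k n : ℕ)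
    (hn : ∀ j < N + k, ev j < n) :
    TrEq I (cc (fun j => yy I α ev (N + j)) k)
      (W α (fun i => Dn I α ev (N + k) i ∧ ¬ Dn I α ev N i) n) := by
  induction k with
  | zero =>
    rw [cc]
    refine TrEq.of_eq ?_
    rw [← W_false α n]
    refine W_congr fun i _ => ?_
    simp
  | succ k ih =>
    rw [cc]
    have e1 : yy I α ev (N + k) =
        W α (fun i => Dn I α ev (N + k + 1) i ∧ ¬ Dn I α ev (N + k) i) n := by
      rw [yy]
      exact (W_stable (fun i hi => hi.1.lt hm) (hn (N+k) (by omega))).symm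
    rw [e1]
    have e2 : W α (fun i => Dn I α ev (N + (k + 1)) i ∧ ¬ Dn I α ev N i) n =
        W α (fun i => (Dn I α ev (N + k) i ∧ ¬ Dn I α ev N i) ∨
          (Dn I α ev (N + k + 1) i ∧ ¬ Dn I α ev (N + k) i)) n := by
      refine W_congr fun i _ => ?_
      have h1 := fun h => Dn.mono (I := I) (α := α) (ev := ev) (i := i)
        (show N ≤ N + k by omega) h
      have h2 := fun h => Dn.mono (I := I) (α := α) (ev := ev) (i := i)
        (show N + k ≤ N + k + 1 by omega) h
      rw [← add_assoc]
      tauto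
    rw [e2]
    refine ((ih (fun j hj => hn j (by omega))).app TrEq.rfl').tr (TrEq.sym ?_)
    refine W_split (fun i hi hi' => hi'.2 hi.1) (fun i j hij hi hj => ?_) n
    by_contra hI
    exact hi.2 (hj.1.down (tle.of_dep hij.le hI))





open Classical in
noncomputable def kap (I : A → A → Prop) (α : ℕ → A) (rep : A → A) (e : A → ℕ) (T : Finset A)
    (a : A) (j : ℕ) : List A :=
  if ¬ JJ I α e T j ∧ rep (α j) = a then [α j] else []

theorem cc_kap (I : A → A → Prop) (α : ℕ → A) (rep : A → A) (e : A → ℕ) (T : Finset A)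
    (a : A) (n : ℕ) :
    cc (kap I α rep e T a) n = W α (fun j => ¬ JJ I α e T j ∧ rep (α j) = a) n := by
  induction n with
  | zero => rfl
  | succ n ih =>
    rw [cc, W, ih, kap]
    congr 1
    split_ifs <;> rfl

namespace Good
variable {I : A → A → Prop} {α : ℕ → A} {B : Set A} {rep : A → A} {n0 : ℕ} {e : A → ℕ}
    {T : Finset A}

theorem kap_mem (G : Good I α B rep n0 e T) (hirr : ∀ a, ¬ I a a) (hsym : ∀ a b, I a b → I b a)
    {a : A} {j : ℕ} {b : A} (hb : b ∈ kap I α rep e T a j) : b ∈ B ∧ rep b = a := by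
  unfold kap at hb
  split_ifs at hb with hc
  · rw [List.mem_singleton.mp hb]
    refine ⟨G.tail _ ?_, hc.2⟩
    by_contra h
    exact hc.1 (G.small hirr hsym (by omega))
  · simp at hb

theorem yy_mem (G : Good I α B rep n0 e T) {a : A} (ha : a ∈ B)
    (hr : rep a = a) {ev : ℕ → ℕ} (E : Enum α a ev) {P : ℕ} (hP : ev P = e a) {m : ℕ} (hm : P < m)
    {b : A} (hb : b ∈ yy I α ev m) : b ∈ B ∧ rep b = a := by
  obtain ⟨i, _, ⟨⟨j, hj, hij⟩, h2⟩, rfl⟩ := mem_W.mp hb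
  have := G.outside ha hr (E.val j) hij (fun h => h2 ⟨P, hm, by rw [hP]; exact h⟩)
  exact ⟨G.tail _ this.1, this.2.1⟩

theorem Q_iff (G : Good I α B rep n0 e T) (hirr : ∀ a, ¬ I a a) (hsym : ∀ a b, I a b → I b a)
    {a : A} (ha : a ∈ B)
    (hr : rep a = a) {ev : ℕ → ℕ} (E : Enum α a ev) {P : ℕ} (hP : ev P = e a) (i : ℕ) :
    (¬ JJ I α e T i ∧ rep (α i) = a) ↔ ∃ k, Dn I α ev (P + 1 + k) i ∧ ¬ Dn I α ev (P + 1) i := by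
  rw [E.Dn_succ hirr, hP]
  constructor
  · rintro ⟨h1, h2⟩
    have h0 : n0 ≤ i := by
      by_contra h
      exact h1 (G.small hirr hsym (by omega))
    obtain ⟨j, hj, hij⟩ := G.up hsym (G.tail i h0)
    rw [h2] at hj
    obtain ⟨k, rfl⟩ := E.surj j hj
    refine ⟨k, ⟨k, by omega, hij⟩, fun hh => h1 ((G.big h0).mpr ?_)⟩
    rw [h2]; exact hh
  · rintro ⟨k, ⟨j, hj, hij⟩, h2⟩
    have := G.outside ha hr (E.val j) hij h2
    exact ⟨this.2.2, this.2.1⟩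

theorem cof1 (G : Good I α B rep n0 e T) (hirr : ∀ a, ¬ I a a) (hsym : ∀ a b, I a b → I b a)
    {a : A} (ha : a ∈ B)
    (hr : rep a = a) {ev : ℕ → ℕ} (E : Enum α a ev) {P : ℕ} (hP : ev P = e a) :
    Cof I (fun j => yy I α ev (P + 1 + j)) (kap I α rep e T a) := by
  intro k
  refine ⟨ev (P + 1 + k), ?_⟩
  rw [cc_kap]
  refine (cc_yy E.mono (P+1) k (ev (P + 1 + k)) (fun j hj => E.mono (by omega))).pre.tr ?_
  have e1 : W α (fun j => ¬ JJ I α e T j ∧ rep (α j) = a) (ev (P + 1 + k)) =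
    W α (fun i => (Dn I α ev (P + 1 + k) i ∧ ¬ Dn I α ev (P + 1) i) ∨
      ((¬ JJ I α e T i ∧ rep (α i) = a) ∧ ¬ Dn I α ev (P + 1 + k) i)) (ev (P + 1 + k)) := by
    refine W_congr fun i _ => ?_
    rw [G.Q_iff hirr hsym ha hr E hP]
    constructor
    · rintro ⟨k', h1, h2⟩
      by_cases h3 : Dn I α ev (P + 1 + k) i
      · exact Or.inl ⟨h3, h2⟩
      · exact Or.inr ⟨⟨k', h1, h2⟩, h3⟩
    · rintro (h | h)
      · exact ⟨k, h⟩
      · exact h.1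
  rw [e1]
  refine ⟨_, (W_split (fun i hi hi' => hi'.2 hi.1) (fun i j hij hi hj => ?_) _).sym⟩
  by_contra hI
  exact hi.2 (hj.1.down (tle.of_dep hij.le hI))

theorem cof2 (G : Good I α B rep n0 e T) (hirr : ∀ a, ¬ I a a) (hsym : ∀ a b, I a b → I b a)
    {a : A} (ha : a ∈ B)
    (hr : rep a = a) {ev : ℕ → ℕ} (E : Enum α a ev) {P : ℕ} (hP : ev P = e a) :
    Cof I (kap I α rep e T a) (fun j => yy I α ev (P + 1 + j)) := by
  intro n
  have hk : ∃ k, ∀ i < n, (¬ JJ I α e T i ∧ rep (α i) = a) → Dn I α ev (P + 1 + k) i := by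
    have h1 : ∀ i, ∃ k, (¬ JJ I α e T i ∧ rep (α i) = a) → Dn I α ev (P + 1 + k) i := by
      intro i
      by_cases hi : ¬ JJ I α e T i ∧ rep (α i) = a
      · obtain ⟨k, hk, _⟩ := (G.Q_iff hirr hsym ha hr E hP i).mp hi
        exact ⟨k, fun _ => hk⟩
      · exact ⟨0, fun h => absurd h hi⟩
    choose k hk using h1
    refine ⟨(Finset.range n).sup k, fun i hi hq => (hk i hq).mono ?_⟩
    have := Finset.le_sup (f := k) (Finset.mem_range.mpr hi)
    omega
  obtain ⟨k, hk⟩ := hk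
  refine ⟨k, ?_⟩
  let n' := max n (ev (P + 1 + k))
  refine TrPre.tr ?_ (cc_yy E.mono (P+1) k n'
    (fun j hj => lt_of_lt_of_le (E.mono (by omega)) (le_max_right _ _))).sym.pre
  have e0 : cc (kap I α rep e T a) n =
      W α (fun i => (¬ JJ I α e T i ∧ rep (α i) = a) ∧ i < n) n' := by
    rw [cc_kap, W_stable (n := n) (fun i hi => hi.2) (le_max_left _ _)]
    exact W_congr fun i hi => by simp [hi]
  have e1 : W α (fun i => Dn I α ev (P + 1 + k) i ∧ ¬ Dn I α ev (P + 1) i) n' =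
    W α (fun i => ((¬ JJ I α e T i ∧ rep (α i) = a) ∧ i < n) ∨
      ((Dn I α ev (P + 1 + k) i ∧ ¬ Dn I α ev (P + 1) i) ∧ ¬ i < n)) n' := by
    refine W_congr fun i _ => ?_
    constructor
    · intro h
      by_cases hi : i < n
      · exact Or.inl ⟨(G.Q_iff hirr hsym ha hr E hP i).mpr ⟨k, h⟩, hi⟩
      · exact Or.inr ⟨h, hi⟩
    · rintro (⟨h, hi⟩ | h)
      · refine ⟨hk i hi h, ?_⟩
        obtain ⟨_, _, h3⟩ := (G.Q_iff hirr hsym ha hr E hP i).mp h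
        exact h3
      · exact h.1
  rw [e0, e1]
  refine ⟨_, (W_split (fun i hi hi' => hi'.2 hi.2) (fun i j hij hi hj => ?_) _).sym⟩
  exact absurd hj.2 (by have := hi.2; omega)

theorem U_dec (G : Good I α B rep n0 e T) (hirr : ∀ a, ¬ I a a) (hsym : ∀ a b, I a b → I b a)
    {a : A} (ha : a ∈ B)
    (hr : rep a = a) {ev : ℕ → ℕ} (E : Enum α a ev) {P : ℕ} (hP : ev P = e a) {n : ℕ}
    (hn : ∀ b ∈ T, e b < n) {M : ℕ} (hM : M ≤ P + 1) :
    ∃ w0 r, TrEq I (W α (JJ I α e T) n) (w0 ++ cc (fun j => yy I α ev (M + j)) (P + 1 - M) ++ r) ∧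
      ∀ b ∈ r, ∀ c ∈ {c | c ∈ B ∧ rep c = a}, I b c := by
  have haT : a ∈ T := (G.memT a).mpr (Or.inl ⟨ha, hr⟩)
  refine ⟨W α (Dn I α ev M) n, W α (fun i => JJ I α e T i ∧ ¬ Dn I α ev (P+1) i) n, ?_, ?_⟩
  · have hDJ : ∀ i, Dn I α ev (P+1) i → JJ I α e T i := fun i hi =>
      ⟨a, haT, by rw [← hP]; exact (E.Dn_succ hirr).mp hi⟩
    have e1 : W α (JJ I α e T) n = W α (fun i => Dn I α ev (P+1) i ∨
        (JJ I α e T i ∧ ¬ Dn I α ev (P+1) i)) n := W_congr fun i _ => by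
      have := hDJ i; tauto
    have e2 : W α (Dn I α ev (P+1)) n = W α (fun i => Dn I α ev M i ∨
        (Dn I α ev (P+1) i ∧ ¬ Dn I α ev M i)) n := W_congr fun i _ => by
      have := fun h => Dn.mono (I := I) (α := α) (ev := ev) (i := i) hM h
      tauto
    rw [e1]
    refine (W_split (fun i hi hi' => hi'.2 hi) (fun i j hij hi hj => ?_) _).tr (TrEq.app ?_ TrEq.rfl')
    · by_contra hI
      exact hi.2 (hj.down (tle.of_dep hij.le hI))
    rw [e2]
    refine (W_split (fun i hi hi' => hi'.2 hi) (fun i j hij hi hj => ?_) _).tr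
      (TrEq.app TrEq.rfl' ?_)
    · by_contra hI
      exact hi.2 (hj.down (tle.of_dep hij.le hI))
    have := cc_yy (I := I) (α := α) E.mono M (P + 1 - M) n (fun j hj => by
      have h1 := E.mono.monotone (show j ≤ P by omega)
      have h2 := hn a haT
      omega)
    rw [show M + (P + 1 - M) = P + 1 by omega] at this
    exact this.sym
  · intro b hb c hc
    obtain ⟨i, _, ⟨h1, h2⟩, rfl⟩ := mem_W.mp hb
    exact G.indep hsym ha hr h1 (fun h => h2 ((E.Dn_succ hirr).mpr (by rw [hP]; exact h))) hc.1 hc.2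

end Good

theorem yy_eq {I : A → A → Prop} (hirr : ∀ a, ¬ I a a) {α : ℕ → A} {a : A} {ev : ℕ → ℕ}
    (E : Enum α a ev) (m : ℕ) :
    yy I α ev m = W α (fun i => Dn I α ev (m+1) i ∧ ¬ Dn I α ev m i) (ev m) ++ [a] := by
  rw [yy, W, if_pos, E.val]
  refine ⟨(E.Dn_succ hirr).mpr tle.rfl', ?_⟩
  rintro ⟨j, hj, hh⟩
  have := hh.le
  have := E.mono hj
  omega

theorem h_yy [Finite A] [Monoid S] {I : A → A → Prop} (hirr : ∀ a, ¬ I a a)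
    (hsym : ∀ a b, I a b → I b a) {h : List A → S} (hh : IsHom h) (M : DFA A σ) (wd : S → List A)
    {α : ℕ → A} {a : A} {ev : ℕ → ℕ} (E : Enum α a ev) (m : ℕ) :
    (st I h M wd α (ev m)).2.1 (dep I a, Set.univ) {({a}, Set.univ)} * h [a] =
      h (yy I α ev m) := by
  rw [yy_eq hirr E, hh.2, H_sem hsym hh]
  congr 2
  refine W_congr fun i hi => ?_
  have h1 : sem I α (ev m) (dep I a, Set.univ) i ↔ Dn I α ev (m+1) i := by
    have := semB (I := I) hsym (α := α) (y := ev m) (Y := Set.univ) (i := i)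
    rw [E.val] at this
    rw [this, E.Dn_succ hirr]
    constructor
    · rintro ⟨m, h1, h2, _⟩
      exact h1.tr h2
    · intro h
      exact ⟨i, tle.rfl', h, by omega, trivial⟩
  have h2 : sem I α (ev m) ({a}, Set.univ) i ↔ Dn I α ev m i := by
    constructor
    · rintro ⟨k, j, h1, h2, h3, _, h5⟩
      obtain ⟨j', rfl⟩ := E.surj j h5
      exact ⟨j', E.mono.lt_iff_lt.mp h3, h1.tr h2⟩
    · rintro ⟨j, hj, hij⟩
      exact ⟨i, ev j, tle.rfl', hij, E.mono hj, trivial, E.val j⟩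
  simp only [Set.mem_singleton_iff, forall_eq, h1, h2]

theorem dat_zero [Finite A] [Monoid S] {I : A → A → Prop} (hirr : ∀ a, ¬ I a a)
    (hsym : ∀ a b, I a b → I b a) {h : List A → S} (hh : IsHom h) (M : DFA A σ) (wd : S → List A)
    {α : ℕ → A} {a : A} {ev : ℕ → ℕ} (E : Enum α a ev) :
    (dat I h M wd α (ev 0)).2.2 = trk M wd (h (yy I α ev 0)) none := by
  rw [← h_yy hirr hsym hh M wd E, dat, newdat, E.val]
  rcases G_sem I h M wd α (ev 0) a with ⟨h1, _⟩ | ⟨e, he, hea, _⟩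
  · rw [h1]; rfl
  · obtain ⟨j, rfl⟩ := E.surj e hea
    exact absurd (E.mono.lt_iff_lt.mp he) (Nat.not_lt_zero _)

theorem dat_succ [Finite A] [Monoid S] {I : A → A → Prop} (hirr : ∀ a, ¬ I a a)
    (hsym : ∀ a b, I a b → I b a) {h : List A → S} (hh : IsHom h) (M : DFA A σ) (wd : S → List A)
    {α : ℕ → A} {a : A} {ev : ℕ → ℕ} (E : Enum α a ev) (m : ℕ) :
    (dat I h M wd α (ev (m+1))).2.2 =
      trk M wd (h (yy I α ev (m+1))) (some (dat I h M wd α (ev m)).2.2) := by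
  rw [← h_yy hirr hsym hh M wd E, dat, newdat, E.val]
  rcases G_sem I h M wd α (ev (m+1)) a with ⟨_, h1⟩ | ⟨e, he, hea, hmax, h4⟩
  · exact absurd (E.val m) (h1 (ev m) (E.mono (Nat.lt_succ_self m)))
  · obtain ⟨j, rfl⟩ := E.surj e hea
    have h1 := E.mono.lt_iff_lt.mp he
    have h2 := E.mono.le_iff_le.mp (hmax (ev m) (E.mono (Nat.lt_succ_self m)) (E.val m))
    have : j = m := by omega
    rw [h4, this]; rfl

theorem track [Finite A] [Monoid S] {I : A → A → Prop} (hirr : ∀ a, ¬ I a a)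
    (hsym : ∀ a b, I a b → I b a) {h : List A → S} (hh : IsHom h) (M : DFA A σ) {wd : S → List A}
    (hmem : ∀ u a, a ∈ wd (h u) ↔ a ∈ u)
    {α : ℕ → A} {a : A} {ev : ℕ → ℕ} (E : Enum α a ev) (C : Set A) (m : ℕ) :
    ∃ N ≤ m + 1, (∀ j < m + 1 - N, ∀ b ∈ yy I α ev (N + j), b ∈ C) ∧
      ∀ x s, ((dat I h M wd α (ev m)).2.2 C x s).1 = M.evalFrom M.start
        (wd x ++ cc (fun j => wd (h (yy I α ev (N + j))) ++ wd s) (m + 1 - N)) := by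
  induction m with
  | zero =>
    rw [dat_zero hirr hsym hh M wd E]
    by_cases hc : ∀ b ∈ wd (h (yy I α ev 0)), b ∈ C
    · refine ⟨0, by omega, fun j hj b hb => ?_, fun x s => ?_⟩
      · have : j = 0 := by omega
        subst this
        exact hc b ((hmem _ _).mpr hb)
      · simp only [trk, if_pos hc]
        simp [cc, evalFrom_app]
    · refine ⟨1, by omega, fun j hj => by omega, fun x s => ?_⟩
      simp only [trk, if_neg hc]
      simp [cc]
  | succ m ih =>
    rw [dat_succ hirr hsym hh M wd E]
    by_cases hc : ∀ b ∈ wd (h (yy I α ev (m+1))), b ∈ C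
    · obtain ⟨N, hN, h1, h2⟩ := ih
      refine ⟨N, by omega, fun j hj b hb => ?_, fun x s => ?_⟩
      · rcases Nat.lt_or_ge j (m + 1 - N) with hj' | hj'
        · exact h1 j hj' b hb
        · have : N + j = m + 1 := by omega
          rw [this] at hb
          exact hc b ((hmem _ _).mpr hb)
      · simp only [trk, if_pos hc]
        rw [h2, show m + 1 + 1 - N = (m + 1 - N) + 1 by omega, cc,
          show N + (m + 1 - N) = m + 1 by omega, ← List.append_assoc, evalFrom_app M _ (wd x ++ _)]
    · refine ⟨m + 2, by omega, fun j hj => by omega, fun x s => ?_⟩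
      simp only [trk, if_neg hc]
      simp [cc]

/-- evolution of the chain in terms of data -/
theorem chain_run [Finite A] [Monoid S] {I : A → A → Prop} (hirr : ∀ a, ¬ I a a)
    (hsym : ∀ a b, I a b → I b a) {h : List A → S} (hh : IsHom h) (M : DFA A σ) {wd : S → List A}
    (hmem : ∀ u a, a ∈ wd (h u) ↔ a ∈ u)
    {α : ℕ → A} {a : A} {ev : ℕ → ℕ} (E : Enum α a ev) {C : Set A} {P : ℕ}
    (hY : ∀ j, ∀ b ∈ yy I α ev (P + 1 + j), b ∈ C) (x s : S) {z : List A}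
    (hz : ((dat I h M wd α (ev P)).2.2 C x s).1 = M.evalFrom M.start z) (j : ℕ) :
    M.evalFrom M.start (cc (cn z (fun j => wd (h (yy I α ev (P + 1 + j))) ++ wd s)) (j+1)) =
      ((dat I h M wd α (ev (P + j))).2.2 C x s).1 ∧
    vis M (M.evalFrom M.start (cc (cn z (fun j => wd (h (yy I α ev (P + 1 + j))) ++ wd s)) (j+1)))
      (cn z (fun j => wd (h (yy I α ev (P + 1 + j))) ++ wd s) (j+1)) =
      ((dat I h M wd α (ev (P + 1 + j))).2.2 C x s).2 := by
  have hc : ∀ j, ∀ b ∈ wd (h (yy I α ev (P + 1 + j))), b ∈ C := fun j b hb =>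
    hY j b ((hmem _ _).mp hb)
  have e1 : ∀ j, (dat I h M wd α (ev (P + 1 + j))).2.2 =
      trk M wd (h (yy I α ev (P + 1 + j))) (some (dat I h M wd α (ev (P + j))).2.2) := fun j => by
    rw [show P + 1 + j = P + j + 1 by omega]
    exact dat_succ hirr hsym hh M wd E (P + j)
  have e2 : ∀ j, M.evalFrom M.start
      (cc (cn z (fun j => wd (h (yy I α ev (P + 1 + j))) ++ wd s)) (j+1)) =
      ((dat I h M wd α (ev (P + j))).2.2 C x s).1 := by
    intro j
    induction j with
    | zero => rw [add_zero, hz]; simp [cc, cn]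
    | succ j ih =>
      rw [cc, evalFrom_app, ih, show P + (j + 1) = P + 1 + j by omega, e1]
      simp only [trk, if_pos (hc j), cn]
  refine ⟨e2 j, ?_⟩
  rw [e2, e1]
  simp only [trk, if_pos (hc j), cn]





def Rec [Finite A] [Monoid S] (I : A → A → Prop) (h : List A → S)
    (M : DFA A σ) (wd : S → List A) (α : ℕ → A) (a : A) (d : Dat A σ S) : Prop :=
  ∀ N, ∃ e ≥ N, α e = a ∧ dat I h M wd α e = d

theorem mem_yy {I : A → A → Prop} (hirr : ∀ a, ¬ I a a) {α : ℕ → A} {a : A} {ev : ℕ → ℕ}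
    (E : Enum α a ev) (m : ℕ) : a ∈ yy I α ev m := by rw [yy_eq hirr E]; simp

theorem infV_chain [Finite A] [Finite σ] [Finite S] [Monoid S] {I : A → A → Prop}
    (hirr : ∀ a, ¬ I a a)
    (hsym : ∀ a b, I a b → I b a) {h : List A → S} (hh : IsHom h) (M : DFA A σ) {wd : S → List A}
    (hmem : ∀ u a, a ∈ wd (h u) ↔ a ∈ u)
    {α : ℕ → A} {a : A} {ev : ℕ → ℕ} (E : Enum α a ev) {C : Set A} {P : ℕ}
    (hY : ∀ j, ∀ b ∈ yy I α ev (P + 1 + j), b ∈ C) (x s : S) {z : List A}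
    (hz : ((dat I h M wd α (ev P)).2.2 C x s).1 = M.evalFrom M.start z) :
    infV M (cn z (fun j => wd (h (yy I α ev (P + 1 + j))) ++ wd s)) =
      {t | ∃ d, Rec I h M wd α a d ∧ t ∈ (d.2.2 C x s).2} := by
  have run := fun j => (chain_run hirr hsym hh M hmem E hY x s hz j).2
  ext t
  constructor
  · intro ht
    obtain ⟨d, h1, h2⟩ := frequently_fin (fun j => dat I h M wd α (ev (P + 1 + j)))
      (fun d => t ∈ (d.2.2 C x s).2) (fun N => by
        obtain ⟨n, hn, hv⟩ := ht (N+1)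
        obtain ⟨j, rfl⟩ : ∃ j, n = j + 1 := ⟨n - 1, by omega⟩
        rw [run] at hv
        exact ⟨j, by omega, hv⟩)
    refine ⟨d, fun N => ?_, h1⟩
    obtain ⟨j, hj, hd⟩ := h2 N
    refine ⟨ev (P + 1 + j), ?_, E.val _, hd⟩
    have : P + 1 + j ≤ ev (P + 1 + j) := E.mono.le_apply
    omega
  · rintro ⟨d, hd, ht⟩ N
    obtain ⟨e, he, hea, hed⟩ := hd (ev (P + 1 + N))
    obtain ⟨k, rfl⟩ := E.surj e hea
    have hk := E.mono.le_iff_le.mp he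
    refine ⟨k - (P + 1) + 1, by omega, ?_⟩
    rw [run, show P + 1 + (k - (P + 1)) = k by omega, hed]
    exact ht

theorem swapC {A : Type*} [Finite A] [Finite σ] [Finite S] [Monoid S] {I : A → A → Prop}
    (hirr : ∀ a, ¬ I a a) (hsym : ∀ a b, I a b → I b a)
    {L : Set (ℕ → A)} (hL : OmTraceClosed I L)
    (M : DFA A σ) (F : Set (Set σ)) (hM : MullerLang M F = L)
    {h : List A → S} (hh : IsHom h)
    (ht : ∀ u v, TrEq I u v → h u = h v)
    (hS : ∀ f g : ℕ → List A, InfNE f → (∀ n, h (f n) = h (g n)) → (InL I L f ↔ InL I L g))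
    {wd : S → List A} (hwd : ∀ s, h (wd s) = s) (hmem : ∀ u a, a ∈ wd (h u) ↔ a ∈ u)
    {α α' : ℕ → A} {B : Set A} {rep : A → A} {n0 n0' : ℕ} {e e' : A → ℕ} {T : Finset A}
    (G : Good I α B rep n0 e T) (G' : Good I α' B rep n0' e' T) {a : A} (ha : a ∈ B)
    (hr : rep a = a) (hd : dat I h M wd α (e a) = dat I h M wd α' (e' a))
    (hrec : ∀ d, Rec I h M wd α a d ↔ Rec I h M wd α' a d) {n : ℕ} (hn : ∀ b ∈ T, e b < n)
    {ρ : ℕ → List A} (hρ : ∀ j, ∀ b ∈ ρ j, ∀ c ∈ {c | c ∈ B ∧ rep c = a}, I b c) :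
    InL I L (cn (W α (JJ I α e T) n) (fun j => ρ j ++ kap I α rep e T a j)) ↔
    InL I L (cn (W α (JJ I α e T) n) (fun j => ρ j ++ kap I α' rep e' T a j)) := by
  have haT : a ∈ T := (G.memT a).mpr (Or.inl ⟨ha, hr⟩)
  obtain ⟨ev, E⟩ := exists_enum (G.inf a ha)
  obtain ⟨ev', E'⟩ := exists_enum (G'.inf a ha)
  obtain ⟨P, hP⟩ := E.surj (e a) (G.g1 a haT)
  obtain ⟨P', hP'⟩ := E'.surj (e' a) (G'.g1 a haT)
  obtain ⟨N, hN, t1, t2⟩ := track hirr hsym hh M hmem E {c | c ∈ B ∧ rep c = a} P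
  obtain ⟨w0, r, u1, u2⟩ := G.U_dec hirr hsym ha hr E hP hn hN
  obtain ⟨x, s, hst⟩ := stepL hsym hh ht hS hwd u1 t1 u2 hρ
  have m1 : ∀ j, ∀ b ∈ yy I α ev (P + 1 + j), b ∈ {c | c ∈ B ∧ rep c = a} := fun j b hb =>
    G.yy_mem ha hr E hP (by omega) hb
  have m2 : ∀ j, ∀ b ∈ yy I α' ev' (P' + 1 + j), b ∈ {c | c ∈ B ∧ rep c = a} := fun j b hb =>
    G'.yy_mem ha hr E' hP' (by omega) hb
  rw [hst (fun j => yy I α ev (P + 1 + j)) _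
      (fun j => ⟨m1 j, List.ne_nil_of_mem (mem_yy hirr E _)⟩)
      (fun j b hb => G.kap_mem hirr hsym hb) (G.cof2 hirr hsym ha hr E hP)
      (G.cof1 hirr hsym ha hr E hP),
    hst (fun j => yy I α' ev' (P' + 1 + j)) _
      (fun j => ⟨m2 j, List.ne_nil_of_mem (mem_yy hirr E' _)⟩)
      (fun j b hb => G'.kap_mem hirr hsym hb) (G'.cof2 hirr hsym ha hr E' hP')
      (G'.cof1 hirr hsym ha hr E' hP')]
  have ne : ∀ {α : ℕ → A} {ev : ℕ → ℕ} (E : Enum α a ev) (P : ℕ) (z : List A),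
      InfNE (cn z (fun j => wd (h (yy I α ev (P + 1 + j))) ++ wd s)) := by
    intro α ev E P z N
    refine ⟨N + 1, by omega, List.ne_nil_of_mem (a := a) ?_⟩
    exact List.mem_append_left _ ((hmem _ _).mpr (mem_yy hirr E _))
  refine muleq hL M F hM (ne E P _) (ne E' P' _) ?_
  rw [infV_chain hirr hsym hh M hmem E m1 x s (t2 x s),
    infV_chain hirr hsym hh M hmem E' m2 x s (by rw [hP', ← hd, ← hP]; exact t2 x s)]
  simp only [hrec]

/-! ## Part 8c: hybrids -/

def mix (s : A → ℕ → List A) (l : List A) (j : ℕ) : List A := (l.map (fun a => s a j)).flatten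

theorem mem_mix {s : A → ℕ → List A} {l : List A} {j : ℕ} {b : A} :
    b ∈ mix s l j ↔ ∃ a ∈ l, b ∈ s a j := by simp [mix]

theorem hybrid {I : A → A → Prop} {L : Set (ℕ → A)} {U : List A} {κ κ' : A → ℕ → List A}
    {C : A → Set A} (hκ : ∀ a j, ∀ b ∈ κ a j, b ∈ C a) (hκ' : ∀ a j, ∀ b ∈ κ' a j, b ∈ C a)
    (hC : ∀ a a', a ≠ a' → ∀ b ∈ C a, ∀ c ∈ C a', I b c) {R : Set A}
    (sw : ∀ a ∈ R, ∀ ρ : ℕ → List A, (∀ j, ∀ b ∈ ρ j, ∀ c ∈ C a, I b c) →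
      (InL I L (cn U (fun j => ρ j ++ κ a j)) ↔ InL I L (cn U (fun j => ρ j ++ κ' a j))))
    (l1 l2 : List A) (hR : ∀ a ∈ l2, a ∈ R) (hnd : (l1 ++ l2).Nodup) :
    InL I L (cn U (fun j => mix κ' l1 j ++ mix κ l2 j)) ↔
      InL I L (cn U (fun j => mix κ' (l1 ++ l2) j)) := by
  induction l2 generalizing l1 with
  | nil => simp [mix]
  | cons a l2 ih =>
    have hnd' : ((l1 ++ [a]) ++ l2).Nodup := by simpa using hnd
    have ih' := ih (l1 ++ [a]) (fun b hb => hR b (List.mem_cons_of_mem _ hb)) hnd'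
    rw [show l1 ++ a :: l2 = (l1 ++ [a]) ++ l2 by simp, ← ih']
    have hne1 : ∀ b ∈ l1, b ≠ a := by
      rintro b hb rfl
      simp only [List.nodup_append] at hnd
      exact hnd.2.2 b hb b (by simp) rfl
    have hne2 : ∀ b ∈ l2, b ≠ a := by
      rintro b hb rfl
      simp only [List.nodup_append, List.nodup_cons] at hnd
      exact hnd.2.1.1 hb
    have hi2 : ∀ j, ∀ b ∈ mix κ l2 j, ∀ c ∈ C a, I b c := fun j b hb c hc => by
      obtain ⟨a', ha', hb⟩ := mem_mix.mp hb
      exact hC a' a (hne2 a' ha') b (hκ a' j b hb) c hc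
    have hi1 : ∀ j, ∀ b ∈ mix κ' l1 j, ∀ c ∈ C a, I b c := fun j b hb c hc => by
      obtain ⟨a', ha', hb⟩ := mem_mix.mp hb
      exact hC a' a (hne1 a' ha') b (hκ' a' j b hb) c hc
    have key := sw a (hR a (by simp)) (fun j => mix κ' l1 j ++ mix κ l2 j) (fun j b hb c hc => by
      rcases List.mem_append.mp hb with hb | hb
      · exact hi1 j b hb c hc
      · exact hi2 j b hb c hc)
    have hcomm : ∀ (κ1 : A → ℕ → List A), (∀ j, ∀ b ∈ κ1 a j, b ∈ C a) → ∀ j,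
        TrEq I (mix κ' l1 j ++ (κ1 a j ++ mix κ l2 j)) (mix κ' l1 j ++ mix κ l2 j ++ κ1 a j) := by
      intro κ1 h1 j
      rw [List.append_assoc]
      exact TrEq.rfl'.app (TrEq.sym (Ind.comm (fun b hb c hc => hi2 j b hb c (h1 j c hc))))
    have s1 : InL I L (cn U (fun j => mix κ' l1 j ++ mix κ (a :: l2) j)) ↔
        InL I L (cn U (fun j => mix κ' l1 j ++ mix κ l2 j ++ κ a j)) := by
      refine inL_treq ?_
      rintro (_ | j)
      · exact TrEq.rfl'
      · exact hcomm κ (hκ a) j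
    have s2 : InL I L (cn U (fun j => mix κ' (l1 ++ [a]) j ++ mix κ l2 j)) ↔
        InL I L (cn U (fun j => mix κ' l1 j ++ mix κ l2 j ++ κ' a j)) := by
      refine inL_treq ?_
      rintro (_ | j)
      · exact TrEq.rfl'
      · refine (TrEq.of_eq ?_).tr (hcomm κ' (hκ' a) j)
        simp [cn, mix]
    rw [s1, key, s2]

open Classical in
theorem mix_kap (I : A → A → Prop) (α : ℕ → A) (rep : A → A) (e : A → ℕ) (T : Finset A)
    {l : List A} (hl : l.Nodup) (j : ℕ) :
    mix (kap I α rep e T) l j = if ¬ JJ I α e T j ∧ rep (α j) ∈ l then [α j] else [] := by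
  induction l with
  | nil => simp [mix]
  | cons a l ih =>
    have e1 : mix (kap I α rep e T) (a :: l) j = kap I α rep e T a j ++
        mix (kap I α rep e T) l j := rfl
    rw [e1, ih (List.nodup_cons.mp hl).2, kap]
    have hal := (List.nodup_cons.mp hl).1
    by_cases h1 : JJ I α e T j
    · simp [h1]
    · by_cases h2 : rep (α j) = a
      · subst h2
        simp [h1, hal]
      · simp [h1, h2]

namespace Good
variable {I : A → A → Prop} {α : ℕ → A} {B : Set A} {rep : A → A} {n0 : ℕ} {e : A → ℕ}
    {T : Finset A}

theorem tlim (G : Good I α B rep n0 e T) (hirr : ∀ a, ¬ I a a) (hsym : ∀ a b, I a b → I b a)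
    {n : ℕ} (hn : ∀ b ∈ T, e b < n) {l : List A} (hl : l.Nodup)
    (hlB : ∀ b, b ∈ l ↔ b ∈ B ∧ rep b = b) :
    TLim I (cc (cn (W α (JJ I α e T) n) (mix (kap I α rep e T) l))) α := by
  have e1 : ∀ m, cc (mix (kap I α rep e T) l) m = W α (fun i => ¬ JJ I α e T i) m := by
    intro m
    induction m with
    | zero => rfl
    | succ m ih =>
      rw [cc, ih, W, mix_kap I α rep e T hl]
      congr 1
      by_cases hJ : JJ I α e T m
      · rw [if_neg (by simp [hJ]), if_neg (by simp [hJ])]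
      · have h0 : n0 ≤ m := by
          by_contra hc
          exact hJ (G.small hirr hsym (by omega))
        have hB := G.tail m h0
        rw [if_pos ⟨hJ, (hlB _).mpr ⟨G.rk.mem _ hB, G.rk.idem _ hB⟩⟩, if_pos hJ]
  have e2 : ∀ m, n ≤ m → TrEq I (wpre α m)
      (cc (cn (W α (JJ I α e T) n) (mix (kap I α rep e T) l)) (m+1)) := by
    intro m hm
    rw [cc_cn, e1, ← W_stable (m := m) (fun i hi => ?_) hm, ← W_true]
    · have : W α (fun _ => True) m = W α (fun i => JJ I α e T i ∨ ¬ JJ I α e T i) m :=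
        W_congr fun i _ => by simp [em]
      rw [this]
      refine W_split (fun i hi hi' => hi' hi) (fun i j hij hi hj => ?_) m
      by_contra hI
      obtain ⟨b, hb, hj⟩ := hj
      exact hi ⟨b, hb, (tle.of_dep hij.le hI).tr hj⟩
    · obtain ⟨b, hb, hi⟩ := hi
      exact lt_of_le_of_lt hi.le (hn b hb)
  constructor
  · intro m
    refine ⟨max n m, TrPre.tr (TrPre.of_prefix (cc_prefix _ ?_)) (e2 (max n m) (le_max_left _ _)).sym.pre⟩
    have := le_max_right n m
    omega
  · intro m
    exact ⟨max n m + 1, (TrPre.of_prefix (wpre_prefix α (le_max_right n m))).tr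
      (e2 (max n m) (le_max_left _ _)).pre⟩

end Good

theorem final_eq {A : Type*} [Finite A] [Finite σ] [Finite S] [Monoid S] {I : A → A → Prop}
    (hirr : ∀ a, ¬ I a a) (hsym : ∀ a b, I a b → I b a)
    {L : Set (ℕ → A)} (hL : OmTraceClosed I L)
    (M : DFA A σ) (F : Set (Set σ)) (hM : MullerLang M F = L)
    {h : List A → S} (hh : IsHom h)
    (ht : ∀ u v, TrEq I u v → h u = h v)
    (hS : ∀ f g : ℕ → List A, InfNE f → (∀ n, h (f n) = h (g n)) → (InL I L f ↔ InL I L g))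
    {wd : S → List A} (hwd : ∀ s, h (wd s) = s) (hmem : ∀ u a, a ∈ wd (h u) ↔ a ∈ u)
    {α α' : ℕ → A} {B : Set A} {rep : A → A} {n0 n0' : ℕ} {e e' : A → ℕ} {T : Finset A}
    (G : Good I α B rep n0 e T) (G' : Good I α' B rep n0' e' T)
    (hd : ∀ a ∈ T, dat I h M wd α (e a) = dat I h M wd α' (e' a))
    (hrec : ∀ a ∈ B, ∀ d, Rec I h M wd α a d ↔ Rec I h M wd α' a d) : α ∈ L ↔ α' ∈ L := by
  classical
  obtain ⟨n, hn⟩ : ∃ n, ∀ b ∈ T, e b < n := ⟨T.sup e + 1, fun b hb =>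
    Nat.lt_succ_of_le (Finset.le_sup (f := e) hb)⟩
  obtain ⟨n', hn'⟩ : ∃ n, ∀ b ∈ T, e' b < n := ⟨T.sup e' + 1, fun b hb =>
    Nat.lt_succ_of_le (Finset.le_sup (f := e') hb)⟩
  let l := (T.filter (fun b => b ∈ B)).toList
  have hl : l.Nodup := Finset.nodup_toList _
  have hlB : ∀ b, b ∈ l ↔ b ∈ B ∧ rep b = b := fun b => by
    simp only [l, Finset.mem_toList, Finset.mem_filter, G.memT]
    tauto
  rw [← inL_iff hL (G.tlim hirr hsym hn hl hlB), ← inL_iff hL (G'.tlim hirr hsym hn' hl hlB)]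
  have s1 := hybrid (I := I) (L := L) (U := W α (JJ I α e T) n) (κ := kap I α rep e T)
    (κ' := kap I α' rep e' T) (C := fun a => {c | c ∈ B ∧ rep c = a}) (R := {b | b ∈ B ∧ rep b = b})
    (fun a j b hb => G.kap_mem hirr hsym hb) (fun a j b hb => G'.kap_mem hirr hsym hb)
    (fun a a' hne b hb c hc => by
      by_contra hI
      exact hne (by rw [← hb.2, ← hc.2]; exact G.rk.dep b hb.1 c hc.1 hI))
    (fun a ha ρ hρ => swapC hirr hsym hL M F hM hh ht hS hwd hmem G G' ha.1 ha.2
      (hd a ((G.memT a).mpr (Or.inl ha))) (hrec a ha.1) hn hρ)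
    [] l (fun a ha => (hlB a).mp ha) (by simpa using hl)
  have s2 : (fun j => mix (kap I α' rep e' T) [] j ++ mix (kap I α rep e T) l j) =
    mix (kap I α rep e T) l := rfl
  rw [s2] at s1
  rw [s1]
  refine hS _ _ ?_ ?_
  · intro N
    obtain ⟨N', h1, h2⟩ : ∃ m ≥ N, ¬ JJ I α' e' T m := by
      refine ⟨max N n', le_max_left _ _, ?_⟩
      rintro ⟨b, hb, hi⟩
      have := hi.le; have := hn' b hb; have := le_max_right N n'; omega
    refine ⟨N' + 1, by omega, ?_⟩
    have h0 : n0' ≤ N' := by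
      by_contra hc
      exact h2 (G'.small hirr hsym (by omega))
    have hB := G'.tail _ h0
    simp only [cn, List.nil_append]
    rw [mix_kap I α' rep e' T hl, if_pos ⟨h2, (hlB _).mpr ⟨G.rk.mem _ hB, G.rk.idem _ hB⟩⟩]
    simp
  · rintro (_ | j)
    · exact FC hirr hsym hh ht M wd G.coh G'.coh hd hn hn'
    · rfl





/-! ## Part 10: colors determine the data -/

def RecC [Finite A] [Monoid S] (I : A → A → Prop) (h : List A → S)
    (M : DFA A σ) (wd : S → List A) (α : ℕ → A) (a : A) (x : Bool × Option (Dat A σ S)) : Prop :=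
  ∀ N, ∃ n ≥ N, color a (st I h M wd α n) = x

theorem color_const [Finite A] [Monoid S] (I : A → A → Prop) (h : List A → S)
    (M : DFA A σ) (wd : S → List A) {α : ℕ → A} {a : A} {N : ℕ} (hN : ∀ n ≥ N, α n ≠ a) :
    ∀ n ≥ N, color a (st I h M wd α n) = color a (st I h M wd α N) := by
  intro n hn
  induction n, hn using Nat.le_induction with
  | base => rfl
  | succ n hn ih => rw [st_succ, color_step I h M wd a _ _ (hN n hn), ih]

theorem color_flip [Finite A] [Monoid S] (I : A → A → Prop) (h : List A → S)
    (M : DFA A σ) (wd : S → List A) (α : ℕ → A) (n : ℕ) :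
    (color (α n) (st I h M wd α (n+1))).1 = !(color (α n) (st I h M wd α n)).1 := by
  classical
  rw [st_succ]; simp [color, aut]

theorem inf_transfer [Finite A] [Finite σ] [Finite S] [Monoid S] {I : A → A → Prop}
    {h : List A → S} {M : DFA A σ} {wd : S → List A} {α α' : ℕ → A} {a : A}
    (H : ∀ x, RecC I h M wd α a x → RecC I h M wd α' a x)
    (hi : ∀ N, ∃ n ≥ N, α n = a) : ∀ N, ∃ n ≥ N, α' n = a := by
  by_contra hc
  push Not at hc
  obtain ⟨N', hN'⟩ := hc
  have hconst := color_const I h M wd hN'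
  have hp : ∀ p : Bool, p = (color a (st I h M wd α' N')).1 := by
    intro p
    have : ∀ N, ∃ n ≥ N, (fun x : Bool × Option (Dat A σ S) => x.1 = p)
        (color a (st I h M wd α n)) := by
      intro N
      obtain ⟨m, hm, rfl⟩ := hi N
      by_cases hq : (color (α m) (st I h M wd α m)).1 = p
      · exact ⟨m, hm, hq⟩
      · refine ⟨m+1, by omega, ?_⟩
        show (color (α m) (st I h M wd α (m+1))).1 = p
        rw [color_flip]
        revert hq
        cases (color (α m) (st I h M wd α m)).1 <;> cases p <;> simp
    obtain ⟨x, hx, hr⟩ := frequently_fin (fun n => color a (st I h M wd α n)) (fun x => x.1 = p) this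
    obtain ⟨n, hn, hnx⟩ := H x hr N'
    rw [hconst n hn] at hnx
    rw [hnx]; exact hx.symm
  have h1 := hp true
  have h2 := hp false
  rw [← h2] at h1
  exact absurd h1 (by simp)

theorem rec_transfer [Finite A] [Finite σ] [Finite S] [Monoid S] {I : A → A → Prop}
    {h : List A → S} {M : DFA A σ} {wd : S → List A} {α α' : ℕ → A} {a : A}
    (H : ∀ x, RecC I h M wd α a x → RecC I h M wd α' a x)
    (hi : ∀ N, ∃ n ≥ N, α n = a) (d : Dat A σ S) (hd : Rec I h M wd α a d) :
    Rec I h M wd α' a d := by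
  have hi' := inf_transfer H hi
  have : ∀ N, ∃ n ≥ N, (fun x : Bool × Option (Dat A σ S) => x.2 = some d)
      (color a (st I h M wd α n)) := by
    intro N
    obtain ⟨e, he, rfl, hed⟩ := hd N
    refine ⟨e+1, by omega, ?_⟩
    rcases G_sem I h M wd α (e+1) (α e) with ⟨_, h2⟩ | ⟨e', h1, h2, h3, h4⟩
    · exact absurd rfl (h2 e (by omega))
    · have : e' = e := by have := h3 e (by omega) rfl; omega
      subst this
      show (st I h M wd α (e'+1)).2.2.1 (α e') = some d
      rw [h4, hed]
  obtain ⟨x, hx, hr⟩ := frequently_fin (fun n => color a (st I h M wd α n)) (fun x => x.2 = some d) this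
  intro N
  obtain ⟨m, hm, hma⟩ := hi' N
  obtain ⟨n, hn, hnx⟩ := H x hr (m+1)
  have h5 : (st I h M wd α' n).2.2.1 a = some d := by
    rw [← hx, ← hnx]; rfl
  rcases G_sem I h M wd α' n a with ⟨_, h2⟩ | ⟨e', h1, h2, h3, h4⟩
  · exact absurd hma (h2 m (by omega))
  · refine ⟨e', ?_, h2, ?_⟩
    · have := h3 m (by omega) hma; omega
    · rw [h5] at h4; exact (Option.some.inj h4).symm

def LastEv [Finite A] [Monoid S] (I : A → A → Prop) (h : List A → S)
    (M : DFA A σ) (wd : S → List A) (α : ℕ → A) (a : A) (d : Dat A σ S) : Prop :=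
  ∃ e, α e = a ∧ (∀ m, α m = a → m ≤ e) ∧ dat I h M wd α e = d

theorem fin_sem [Finite A] [Monoid S] {I : A → A → Prop}
    {h : List A → S} {M : DFA A σ} {wd : S → List A} {α : ℕ → A} {a : A}
    {N : ℕ} (hN : ∀ n ≥ N, α n ≠ a) :
    ((st I h M wd α N).2.2.1 a = none ∧ ∀ i, α i ≠ a) ∨
    ∃ d, LastEv I h M wd α a d ∧ (st I h M wd α N).2.2.1 a = some d := by
  rcases G_sem I h M wd α N a with ⟨h1, h2⟩ | ⟨e, h1, h2, h3, h4⟩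
  · refine Or.inl ⟨h1, fun i => ?_⟩
    by_cases hi : i < N
    · exact h2 i hi
    · exact hN i (by omega)
  · refine Or.inr ⟨_, ⟨e, h2, fun m hm => ?_, rfl⟩, h4⟩
    by_cases hi : m < N
    · exact h3 m hi hm
    · exact absurd hm (hN m (by omega))

theorem fin_transfer [Finite A] [Finite σ] [Finite S] [Monoid S] {I : A → A → Prop}
    {h : List A → S} {M : DFA A σ} {wd : S → List A} {α α' : ℕ → A} {a : A}
    (H : ∀ x, RecC I h M wd α a x ↔ RecC I h M wd α' a x)
    (hi : ¬ ∀ N, ∃ n ≥ N, α n = a) :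
    ((∀ i, α i ≠ a) ∧ ∀ i, α' i ≠ a) ∨
      ∃ d, LastEv I h M wd α a d ∧ LastEv I h M wd α' a d := by
  have hi' : ¬ ∀ N, ∃ n ≥ N, α' n = a := fun hh => hi (inf_transfer (fun x => (H x).mpr) hh)
  push Not at hi hi'
  obtain ⟨N, hN⟩ := hi
  obtain ⟨N', hN'⟩ := hi'
  have c := color_const I h M wd hN
  have c' := color_const I h M wd hN'
  have hr : RecC I h M wd α a (color a (st I h M wd α N)) := fun K =>
    ⟨max K N, le_max_left _ _, c _ (le_max_right _ _)⟩
  obtain ⟨n, hn, hnx⟩ := (H _).mp hr N'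
  rw [c' n hn] at hnx
  have hg : (st I h M wd α' N').2.2.1 a = (st I h M wd α N).2.2.1 a := congrArg Prod.snd hnx
  rcases fin_sem (I := I) (h := h) (M := M) (wd := wd) hN with ⟨h1, h2⟩ | ⟨d, h1, h2⟩ <;>
  rcases fin_sem (I := I) (h := h) (M := M) (wd := wd) hN' with ⟨h1', h2'⟩ | ⟨d', h1', h2'⟩
  · exact Or.inl ⟨h2, h2'⟩
  · rw [hg, h1] at h2'; cases h2'
  · rw [hg, h2] at h1'; cases h1'
  · rw [hg, h2] at h2'
    cases h2'
    exact Or.inr ⟨d, h1, h1'⟩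

theorem exists_rep (I : A → A → Prop) (B : Set A) : ∃ rep : A → A, RepOK I B rep := by
  let r : A → A → Prop := fun b c => b ∈ B ∧ c ∈ B ∧ ¬ I b c
  have hB : ∀ b c, EqvGen r b c → (b ∈ B ↔ c ∈ B) := by
    intro b c hbc
    induction hbc with
    | rel b c h => exact ⟨fun _ => h.2.1, fun _ => h.1⟩
    | refl b => exact Iff.rfl
    | symm b c _ ih => exact ih.symm
    | trans b c d _ _ ih1 ih2 => exact ih1.trans ih2
  let s : Setoid A := EqvGen.setoid r
  let rep : A → A := fun b => (Quotient.mk s b).out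
  have hp : ∀ b, EqvGen r b (rep b) := fun b =>
    EqvGen.symm _ _ (Quotient.exact (s := s) (Quotient.out_eq (Quotient.mk s b)))
  refine ⟨rep, ⟨?_, ?_, fun b _ => hp b, ?_⟩⟩
  · intro b hb c hc hbc
    have : Quotient.mk s b = Quotient.mk s c := Quotient.sound (EqvGen.rel _ _ ⟨hb, hc, hbc⟩)
    show (Quotient.mk s b).out = (Quotient.mk s c).out
    rw [this]
  · intro b hb
    exact (hB _ _ (hp b)).mp hb
  · intro b _
    show (Quotient.mk s (Quotient.mk s b).out).out = _
    rw [Quotient.out_eq]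

theorem mkGood [Finite A] [Finite σ] [Finite S] [Monoid S] {I : A → A → Prop}
    (hirr : ∀ a, ¬ I a a)
    {h : List A → S} {M : DFA A σ} {wd : S → List A} {α : ℕ → A} {B : Set A} {rep : A → A}
    {T : Finset A} (rk : RepOK I B rep) (hB : ∀ b, b ∈ B ↔ ∀ N, ∃ n ≥ N, α n = b)
    (hT : ∀ b, b ∈ T ↔ (b ∈ B ∧ rep b = b) ∨ (b ∉ B ∧ ∃ i, α i = b))
    (dd : A → Dat A σ S) (h1 : ∀ a ∈ B, Rec I h M wd α a (dd a))
    (h2 : ∀ a ∉ B, (∃ i, α i = a) → LastEv I h M wd α a (dd a)) :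
    ∃ n0 e, Good I α B rep n0 e T ∧ ∀ a ∈ T, dat I h M wd α (e a) = dd a := by
  classical
  have : Fintype A := Fintype.ofFinite A
  have hn : ∀ b, ∃ N, b ∉ B → ∀ n ≥ N, α n ≠ b := by
    intro b
    by_cases hb : b ∈ B
    · exact ⟨0, fun hh => absurd hb hh⟩
    · have := mt (hB b).mpr hb
      push Not at this
      obtain ⟨N, hN⟩ := this
      exact ⟨N, fun _ => hN⟩
  choose Nf hNf using hn
  let n0 := Finset.univ.sup Nf
  have htail : ∀ j, n0 ≤ j → α j ∈ B := by
    intro j hj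
    by_contra hc
    exact hNf _ hc j (le_trans (Finset.le_sup (f := Nf) (Finset.mem_univ _)) hj) rfl
  have key : ∀ a, ∃ e, (a ∈ T → α e = a ∧ dat I h M wd α e = dd a) ∧
      (a ∉ B → ∀ m, α m = a → m ≤ e) ∧
      (a ∈ B → rep a = a → n0 ≤ e ∧ ∀ i < n0, ∀ j, α j = a → tle I α i j → tle I α i e) := by
    intro a
    by_cases ha : a ∈ B
    · have hw : ∀ i, ∃ K, ∀ j, α j = a → tle I α i j → ∀ e ≥ K, α e = a → tle I α i e := by
        intro i
        by_cases hx : ∃ j, α j = a ∧ tle I α i j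
        · obtain ⟨j, hj, hij⟩ := hx
          refine ⟨j, fun _ _ _ e he hea => hij.tr (tle.of_dep he ?_)⟩
          rw [hj, hea]; exact hirr a
        · exact ⟨0, fun j hj hij => absurd ⟨j, hj, hij⟩ hx⟩
      choose K hK using hw
      obtain ⟨e, he, hea, hed⟩ := h1 a ha (max n0 ((Finset.range n0).sup K))
      refine ⟨e, fun _ => ⟨hea, hed⟩, fun hh => absurd ha hh, fun _ _ =>
        ⟨le_trans (le_max_left _ _) he, fun i hi j hj hij => hK i j hj hij e ?_ hea⟩⟩
      exact le_trans (le_trans (Finset.le_sup (f := K) (Finset.mem_range.mpr hi))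
        (le_max_right _ _)) he
    · by_cases hx : ∃ i, α i = a
      · obtain ⟨e, he1, he2, he3⟩ := h2 a ha hx
        exact ⟨e, fun _ => ⟨he1, he3⟩, fun _ => he2, fun hh => absurd hh ha⟩
      · refine ⟨0, fun hh => ?_, fun _ m hm => absurd ⟨m, hm⟩ hx, fun hh => absurd hh ha⟩
        rcases (hT a).mp hh with hh | hh
        · exact absurd hh.1 ha
        · exact absurd hh.2 hx
  choose e he using key
  exact ⟨n0, e, ⟨rk, fun b hb => (hB b).mp hb, htail, hT, fun b hb => ((he b).1 hb).1,
    fun b hb => (he b).2.1 hb, fun a ha hr => ((he a).2.2 ha hr).1,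
    fun a ha hr => ((he a).2.2 ha hr).2⟩, fun a ha => ((he a).1 ha).2⟩

theorem color_det {A : Type*} [Finite A] [Finite σ] [Finite S] [Monoid S] {I : A → A → Prop}
    (hirr : ∀ a, ¬ I a a) (hsym : ∀ a b, I a b → I b a)
    {L : Set (ℕ → A)} (hL : OmTraceClosed I L)
    (M : DFA A σ) (F : Set (Set σ)) (hM : MullerLang M F = L)
    {h : List A → S} (hh : IsHom h)
    (ht : ∀ u v, TrEq I u v → h u = h v)
    (hS : ∀ f g : ℕ → List A, InfNE f → (∀ n, h (f n) = h (g n)) → (InL I L f ↔ InL I L g))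
    {wd : S → List A} (hwd : ∀ s, h (wd s) = s) (hmem : ∀ u a, a ∈ wd (h u) ↔ a ∈ u)
    {α α' : ℕ → A} (H : ∀ a x, RecC I h M wd α a x ↔ RecC I h M wd α' a x) :
    α ∈ L ↔ α' ∈ L := by
  classical
  have : Fintype A := Fintype.ofFinite A
  let B : Set A := {b | ∀ N, ∃ n ≥ N, α n = b}
  obtain ⟨rep, rk⟩ := exists_rep I B
  have hB' : ∀ b, b ∈ B ↔ ∀ N, ∃ n ≥ N, α' n = b := fun b =>
    ⟨inf_transfer (fun x => (H b x).mp), inf_transfer (fun x => (H b x).mpr)⟩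
  have hrec : ∀ a ∈ B, ∀ d, Rec I h M wd α a d ↔ Rec I h M wd α' a d := fun a ha d =>
    ⟨rec_transfer (fun x => (H a x).mp) ha d,
      rec_transfer (fun x => (H a x).mpr) ((hB' a).mp ha) d⟩
  have hocc : ∀ b, b ∉ B → ((∃ i, α i = b) ↔ ∃ i, α' i = b) := by
    intro b hb
    rcases fin_transfer (H b) hb with ⟨h1, h2⟩ | ⟨d, ⟨e, h1, _⟩, ⟨e', h2, _⟩⟩
    · exact ⟨fun ⟨i, hi⟩ => absurd hi (h1 i), fun ⟨i, hi⟩ => absurd hi (h2 i)⟩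
    · exact ⟨fun _ => ⟨e', h2⟩, fun _ => ⟨e, h1⟩⟩
  let T : Finset A := Finset.univ.filter
    (fun b => (b ∈ B ∧ rep b = b) ∨ (b ∉ B ∧ ∃ i, α i = b))
  have hT : ∀ b, b ∈ T ↔ (b ∈ B ∧ rep b = b) ∨ (b ∉ B ∧ ∃ i, α i = b) := fun b => by
    simp only [T, Finset.mem_filter, Finset.mem_univ, true_and]
  have hT' : ∀ b, b ∈ T ↔ (b ∈ B ∧ rep b = b) ∨ (b ∉ B ∧ ∃ i, α' i = b) := fun b => by
    rw [hT]
    exact or_congr Iff.rfl (and_congr_right (fun hb => hocc b hb))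
  have hdd : ∀ a, ∃ d, (a ∈ B → Rec I h M wd α a d) ∧ (a ∉ B → (∃ i, α i = a) →
      LastEv I h M wd α a d ∧ LastEv I h M wd α' a d) := by
    intro a
    by_cases ha : a ∈ B
    · obtain ⟨ev, E⟩ := exists_enum ha
      obtain ⟨d, _, hd⟩ := frequently_fin (fun j => dat I h M wd α (ev j)) (fun _ => True)
        (fun N => ⟨N, le_refl _, trivial⟩)
      refine ⟨d, fun _ N => ?_, fun hh => absurd ha hh⟩
      obtain ⟨n, hn, hnd⟩ := hd N
      exact ⟨ev n, hn.trans (E.mono.id_le n), E.val n, hnd⟩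
    · rcases fin_transfer (H a) ha with ⟨h1, h2⟩ | ⟨d, hd⟩
      · exact ⟨dat I h M wd α 0, fun hh => absurd hh ha, fun _ ⟨i, hi⟩ => absurd hi (h1 i)⟩
      · exact ⟨d, fun hh => absurd hh ha, fun _ _ => hd⟩
  choose dd hd1 hd2 using hdd
  obtain ⟨n0, e, G, hG⟩ := mkGood hirr rk (fun _ => Iff.rfl) hT dd hd1
    (fun a ha hx => (hd2 a ha hx).1)
  obtain ⟨n0', e', G', hG'⟩ := mkGood hirr rk hB' hT' dd
    (fun a ha => (hrec a ha _).mp (hd1 a ha))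
    (fun a ha hx => (hd2 a ha ((hocc a ha).mpr hx)).2)
  exact final_eq hirr hsym hL M F hM hh ht hS hwd hmem G G'
    (fun a ha => (hG a ha).trans (hG' a ha).symm) hrec

theorem transport_state [Finite σ] {I : A → A → Prop} {M : DFA A σ} (hM : IDiamond I M)
    {X : Type*} (f : σ → X) (x : X) :
    ∃ (τ : Type) (_ : Fintype τ) (M' : DFA A τ), IDiamond I M' ∧ BuchiLang M' = ObsInf M f x := by
  obtain ⟨k, ⟨φ⟩⟩ := Finite.exists_equiv_fin σ
  let M' : DFA A (Fin k) :=
    { step := fun q a => φ (M.step (φ.symm q) a), start := φ M.start,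
      accept := {q | f (φ.symm q) = x} }
  have hr : ∀ w, ∀ q, M'.evalFrom (φ q) w = φ (M.evalFrom q w) := by
    intro w
    induction w with
    | nil => intro q; rfl
    | cons a w ih =>
      intro q
      have e1 : M'.step (φ q) a = φ (M.step q a) := by simp [M']
      show M'.evalFrom (M'.step (φ q) a) w = φ (M.evalFrom (M.step q a) w)
      rw [e1, ih]
  refine ⟨Fin k, inferInstance, M', ?_, ?_⟩
  · intro q a b hab
    simp [M', hM (φ.symm q) a b hab]
  · ext α
    have : ∀ n, M'.evalFrom M'.start (wpre α n) ∈ M'.accept ↔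
        f (M.evalFrom M.start (wpre α n)) = x := fun n => by
      show M'.evalFrom (φ M.start) (wpre α n) ∈ M'.accept ↔ _
      rw [hr]; simp [M']
    show (∀ N, ∃ n ≥ N, _) ↔ ∀ N, ∃ n ≥ N, _
    simp only [this]

theorem stmt14_fwd {A : Type*} [Fintype A] (I : A → A → Prop)
    (hirr : ∀ a, ¬ I a a) (hsym : ∀ a b, I a b → I b a)
    (L : Set (ℕ → A)) (hL : OmTraceClosed I L) (hreg : OmegaRegular L) :
    ∃ (n : ℕ) (Ls : Fin n → Set (ℕ → A)),
      (∀ i, OmTraceClosed I (Ls i) ∧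
        ∃ (σ : Type) (_ : Fintype σ) (M : DFA A σ),
          IDiamond I M ∧ BuchiLang M = Ls i) ∧
      BoolComb (Set.range Ls) L := by
  obtain ⟨σ, _, M, F, hM⟩ := hreg
  obtain ⟨S, _, _, h, hsurj, hh, ht, hal, hS⟩ := arnold hL M F hM
  let wd : S → List A := Function.surjInv hsurj
  have hwd : ∀ s, h (wd s) = s := Function.surjInv_eq hsurj
  have hmem : ∀ u a, a ∈ wd (h u) ↔ a ∈ u := fun u a => hal _ _ (hwd (h u)) a
  have hdia : IDiamond I (aut I h M wd) := aut_diamond hirr hsym hh ht M wd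
  rcases isEmpty_or_nonempty A with hA | hA
  · have hno : ∀ α : ℕ → A, False := fun α => hA.elim (α 0)
    refine ⟨1, fun _ => ∅, fun _ => ⟨fun α _ _ _ => (hno α).elim,
      Unit, inferInstance, ⟨fun _ _ => (), (), ∅⟩, fun _ _ _ _ => rfl, ?_⟩, .base ⟨0, ?_⟩⟩
    · ext α; exact (hno α).elim
    · ext α; exact (hno α).elim
  obtain ⟨n, ⟨φ⟩⟩ := Finite.exists_equiv_fin (A × (Bool × Option (Dat A σ S)))
  have f0 : Finite (Dat A σ S) := inferInstance
  have f1 : Finite (NSt A) := inferInstance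
  have f2 : Finite (HSt A S) := inferInstance
  have f3 : Finite (A → Option (Dat A σ S)) := inferInstance
  have f4 : Finite (ASt A σ S) := inferInstance
  have hn : 0 < n := Fin.pos (φ (Classical.arbitrary A, false, none))
  refine ⟨n, fun i => ObsInf (aut I h M wd) (color (φ.symm i).1) (φ.symm i).2, fun i =>
    ⟨robust_closed I hirr _ hdia _ (φ.symm i).1
      (fun q c hc => color_step I h M wd _ q c hc) _, transport_state hdia _ _⟩, ?_⟩
  refine boolComb_of_sat hn _ L (fun α α' H hα => ?_)
  refine (color_det hirr hsym hL M F hM hh ht hS hwd hmem (fun a x => ?_)).mp hα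
  have := H (φ (a, x))
  simp only [Equiv.symm_apply_apply] at this
  exact this

/-- A trace-closed ω-language is ω-regular iff it is a finite
Boolean combination of trace-closed ω-languages each recognized by an
`I`-diamond deterministic Büchi automaton. -/
theorem stmt14 [Fintype A] (I : A → A → Prop)
    (hirr : ∀ a, ¬ I a a) (hsym : ∀ a b, I a b → I b a)
    (L : Set (ℕ → A)) (hL : OmTraceClosed I L) :
    OmegaRegular L ↔
    ∃ (n : ℕ) (Ls : Fin n → Set (ℕ → A)),
      (∀ i, OmTraceClosed I (Ls i) ∧
        ∃ (σ : Type) (_ : Fintype σ) (M : DFA A σ),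
          IDiamond I M ∧ BuchiLang M = Ls i) ∧
      BoolComb (Set.range Ls) L := by
  constructor
  · exact stmt14_fwd I hirr hsym L hL
  · rintro ⟨n, Ls, hLs, hb⟩
    refine boolComb_omegaRegular ?_ hb
    rintro _ ⟨i, rfl⟩
    obtain ⟨_, σ, _, M, _, hM⟩ := hLs i
    rw [← hM]
    exact buchi_omegaRegular M
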